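/- Let U, V be domains in ℝ², each different from ℝ², and let f : ∂_H U → ∂_H V be an isometry of the Hausdorff boundaries in the relative metrics. Suppose x₁,…,x_m ∈ ∂U (m ≥ 3) are such that each ordered triple x_i, x_{i+1}, x_{i+2} determines a boundary angle for U for all i = 1,…,m−2. For each i, let x'_i denote the support of the f-image of the element of ∂_H U with support x_i generated by an adjacent boundary interval ]x_i, x_{i+1}[ or ]x_{i−1}, x_i[. Then |x'_i − x'_j| = |x_i − x_j| for all i,j = 1,…,m. -/

import Mathlib

open Set Metric Filter

noncomputable section

/-- Euclidean `n`-space. -/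
abbrev Euc (n : ℕ) := EuclideanSpace ℝ (Fin n)

/-- A domain: a nonempty open connected subset of Euclidean space. -/
def IsEucDomain {n : ℕ} (U : Set (Euc n)) : Prop := IsOpen U ∧ IsConnected U

/-- Intrinsic extended distance inside `S`: the infimum of the lengths (total
variations) of continuous paths joining `x` and `y` within `S`. -/
def intrinsicDist {n : ℕ} (S : Set (Euc n)) (x y : Euc n) : ENNReal :=
  ⨅ (γ : ℝ → Euc n) (_ : ContinuousOn γ (Icc (0:ℝ) 1)) (_ : γ 0 = x) (_ : γ 1 = y)
    (_ : MapsTo γ (Icc (0:ℝ) 1) S), eVariationOn γ (Icc (0:ℝ) 1)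

/-- A Cauchy sequence (in the intrinsic metric) of points of `U` that does not
converge (in the intrinsic metric) to a point of `U`; such sequences represent
elements of the Hausdorff boundary of `U`. -/
structure HBSeq {n : ℕ} (U : Set (Euc n)) where
  seq : ℕ → Euc n
  mem : ∀ k, seq k ∈ U
  cauchy : ∀ ε : ENNReal, 0 < ε → ∃ N : ℕ, ∀ j ≥ N, ∀ k ≥ N,
    intrinsicDist U (seq j) (seq k) < ε
  notConv : ¬ ∃ u ∈ U, Tendsto (fun k => intrinsicDist U (seq k) u) atTop (nhds 0)

/-- Two Cauchy sequences represent the same Hausdorff-boundary element iff the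
intrinsic distance between corresponding terms tends to `0`. -/
def HBEquiv {n : ℕ} (U : Set (Euc n)) (s t : HBSeq U) : Prop :=
  Tendsto (fun k => intrinsicDist U (s.seq k) (t.seq k)) atTop (nhds 0)

/-- The Hausdorff boundary of `U`: points of the completion of `(U, ρ_U)` not
corresponding to points of `U`. -/
def HausdorffBoundary {n : ℕ} (U : Set (Euc n)) : Type := Quot (HBEquiv U)

/-- The relative metric on the Hausdorff boundary (the completion metric). -/
def hbDist {n : ℕ} {U : Set (Euc n)} (a b : HausdorffBoundary U) : ENNReal :=
  limsup (fun k => intrinsicDist U ((Quot.out a).seq k) ((Quot.out b).seq k)) atTop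

/-- The support of a Hausdorff-boundary element: the Euclidean limit of a
representing Cauchy sequence. -/
def hbSupport {n : ℕ} {U : Set (Euc n)} (a : HausdorffBoundary U) : Euc n :=
  limUnder atTop (Quot.out a).seq

/-- A (bijective) isometry of Hausdorff boundaries in the relative metrics. -/
def IsHBIsometry {n : ℕ} {U V : Set (Euc n)}
    (f : HausdorffBoundary U → HausdorffBoundary V) : Prop :=
  Function.Bijective f ∧ ∀ a b : HausdorffBoundary U, hbDist (f a) (f b) = hbDist a b

/-- `U` is uniquely determined in the class `𝒰` by the relative metric of its
Hausdorff boundary: any member of `𝒰` with Hausdorff boundary isometric (in the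
relative metrics) to that of `U` is the image of `U` under a Euclidean isometry. -/
def UniquelyDeterminedIn {n : ℕ} (𝒰 : Set (Set (Euc n))) (U : Set (Euc n)) : Prop :=
  ∀ V ∈ 𝒰, (∃ f : HausdorffBoundary U → HausdorffBoundary V, IsHBIsometry f) →
    ∃ J : Euc n ≃ᵢ Euc n, J '' U = V

/-- `]x,y[` is a boundary interval for `U`. -/
def IsBoundaryInterval {n : ℕ} (U : Set (Euc n)) (x y : Euc n) : Prop :=
  x ≠ y ∧ x ∈ frontier U ∧ y ∈ frontier U ∧ openSegment ℝ x y ⊆ U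

/-- The Hausdorff-boundary element `a` is generated by the boundary interval
`]x,y[` at its endpoint `x`: it is represented by a Cauchy sequence of points of
`]x,y[` converging (in the Euclidean metric) to `x`. -/
def GeneratesEndpoint {n : ℕ} (U : Set (Euc n)) (x y : Euc n)
    (a : HausdorffBoundary U) : Prop :=
  ∃ s : HBSeq U, Quot.mk (HBEquiv U) s = a ∧ (∀ k, s.seq k ∈ openSegment ℝ x y) ∧
    Tendsto s.seq atTop (nhds x)

/-- The plane angle `∠(x,y,z) = {y + t(x−y) + s(z−y) : t ≥ 0, s ≥ 0}`. -/
def planeAngle (x y z : Euc 2) : Set (Euc 2) :=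
  {p | ∃ t s : ℝ, 0 ≤ t ∧ 0 ≤ s ∧ p = y + t • (x - y) + s • (z - y)}

/-- The ordered triple `x, y, z` determines a boundary angle for `U`. -/
def IsBoundaryAngle (U : Set (Euc 2)) (x y z : Euc 2) : Prop :=
  ¬ Collinear ℝ ({x, y, z} : Set (Euc 2)) ∧
    x ∈ frontier U ∧ y ∈ frontier U ∧ z ∈ frontier U ∧
    openSegment ℝ x y ⊆ U ∧ openSegment ℝ y z ⊆ U ∧
    ∃ r : ℝ, 0 < r ∧ (Metric.ball y r ∩ planeAngle x y z) \ {y} ⊆ U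

/-! ### Intrinsic metric -/

section Intrinsic

variable {n : ℕ} {S : Set (Euc n)} {x y z : Euc n}

theorem intrinsicDist_le_variation {γ : ℝ → Euc n} {a b : ℝ} (hab : a ≤ b)
    (hc : ContinuousOn γ (Icc a b)) (hS : MapsTo γ (Icc a b) S) :
    intrinsicDist S (γ a) (γ b) ≤ eVariationOn γ (Icc a b) := by
  set φ : ℝ → ℝ := fun t => a + t * (b - a)
  have hm : MapsTo φ (Icc 0 1) (Icc a b) := by
    rintro t ⟨h0, h1⟩
    constructor <;> simp only [φ] <;> nlinarith
  have hmono : MonotoneOn φ (Icc 0 1) := by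
    intro s _ t _ hst
    simp only [φ]
    nlinarith
  have h1 : intrinsicDist S (γ a) (γ b) ≤ eVariationOn (γ ∘ φ) (Icc (0:ℝ) 1) := by
    refine iInf_le_of_le (γ ∘ φ) (iInf_le_of_le ?_ (iInf_le_of_le ?_ (iInf_le_of_le ?_
      (iInf_le_of_le ?_ le_rfl))))
    · exact hc.comp (by fun_prop) hm
    · simp [φ]
    · simp [φ]
    · exact hS.comp hm
  exact h1.trans (eVariationOn.comp_le_of_monotoneOn _ _ hmono hm)

theorem exists_path_of_intrinsicDist_lt {r : ENNReal} (h : intrinsicDist S x y < r) :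
    ∃ γ : ℝ → Euc n, ContinuousOn γ (Icc (0:ℝ) 1) ∧ γ 0 = x ∧ γ 1 = y ∧
      MapsTo γ (Icc (0:ℝ) 1) S ∧ eVariationOn γ (Icc (0:ℝ) 1) < r := by
  simp only [intrinsicDist, iInf_lt_iff] at h
  obtain ⟨γ, h1, h2, h3, h4, h5⟩ := h
  exact ⟨γ, h1, h2, h3, h4, h5⟩

theorem edist_le_intrinsicDist : edist x y ≤ intrinsicDist S x y := by
  refine le_of_forall_gt fun r hr => ?_
  obtain ⟨γ, -, rfl, rfl, -, h⟩ := exists_path_of_intrinsicDist_lt hr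
  exact (eVariationOn.edist_le γ (by simp) (by simp)).trans_lt h

theorem intrinsicDist_comm_le : intrinsicDist S x y ≤ intrinsicDist S y x := by
  refine le_of_forall_gt fun r hr => ?_
  obtain ⟨γ, hc, rfl, rfl, hm, h⟩ := exists_path_of_intrinsicDist_lt hr
  have hmaps : MapsTo (fun t : ℝ => 1 - t) (Icc (0:ℝ) 1) (Icc (0:ℝ) 1) := by
    rintro t ⟨h0, h1⟩
    constructor <;> simp only [] <;> linarith
  have := intrinsicDist_le_variation (S := S) (γ := γ ∘ fun t => 1 - t) zero_le_one
    (hc.comp (by fun_prop) hmaps) (hm.comp hmaps)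
  simp only [Function.comp, sub_zero, sub_self] at this
  refine (this.trans ?_).trans_lt h
  refine eVariationOn.comp_le_of_antitoneOn γ (fun t : ℝ => 1 - t) ?_ hmaps
  intro s _ t _ hst
  simp only []
  linarith

theorem intrinsicDist_comm : intrinsicDist S x y = intrinsicDist S y x :=
  le_antisymm intrinsicDist_comm_le intrinsicDist_comm_le

theorem intrinsicDist_triangle :
    intrinsicDist S x z ≤ intrinsicDist S x y + intrinsicDist S y z := by
  by_cases hx : intrinsicDist S x y = ⊤
  · simp [hx]
  by_cases hz : intrinsicDist S y z = ⊤
  · simp [hz]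
  refine ENNReal.le_of_forall_pos_le_add fun ε hε _ => ?_
  have hε2 : (0 : ENNReal) < (ε / 2 : NNReal) := by
    exact_mod_cast half_pos hε
  obtain ⟨γ, hc, h0, h1, hm, h⟩ :=
    exists_path_of_intrinsicDist_lt (ENNReal.lt_add_right hx hε2.ne')
  obtain ⟨γ', hc', h0', h1', hm', h'⟩ :=
    exists_path_of_intrinsicDist_lt (ENNReal.lt_add_right hz hε2.ne')
  set g : ℝ → Euc n := fun t => if t ≤ 1 then γ t else γ' (t - 1)
  have hsub : MapsTo (fun t : ℝ => t - 1) (Icc (1:ℝ) 2) (Icc (0:ℝ) 1) := by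
    rintro t ⟨h0, h1⟩
    constructor <;> simp only [] <;> linarith
  have e1 : EqOn g γ (Icc 0 1) := fun t ht => by simp [g, ht.2]
  have e2 : EqOn g (γ' ∘ fun t => t - 1) (Icc 1 2) := by
    intro t ht
    rcases ht.1.eq_or_lt with rfl | h
    · simp [g, h1, h0']
    · simp [g, h]
  have hu : Icc (0:ℝ) 2 = Icc 0 1 ∪ Icc 1 2 := by
    rw [Icc_union_Icc_eq_Icc] <;> norm_num
  have hc2 : ContinuousOn (γ' ∘ fun t => t - 1) (Icc 1 2) := hc'.comp (by fun_prop) hsub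
  have hcg : ContinuousOn g (Icc 0 2) := by
    rw [hu]
    exact ContinuousOn.union_of_isClosed (hc.congr e1) (hc2.congr e2) isClosed_Icc isClosed_Icc
  have hmg : MapsTo g (Icc 0 2) S := by
    rw [hu]
    exact (hm.congr e1.symm).union ((hm'.comp hsub).congr e2.symm)
  have := intrinsicDist_le_variation (S := S) zero_le_two hcg hmg
  have g0 : g 0 = x := by simp [g, h0]
  have g2 : g 2 = z := by simp [g]; norm_num [h1']
  rw [g0, g2] at this
  refine this.trans ?_
  rw [hu, eVariationOn.union g (x := 1) (by simp [IsGreatest, upperBounds])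
    (by simp [IsLeast, lowerBounds]; intro a h _; exact h)]
  rw [eVariationOn.eq_of_eqOn e1, eVariationOn.eq_of_eqOn e2]
  have h3 : eVariationOn (γ' ∘ fun t => t - 1) (Icc 1 2) ≤ eVariationOn γ' (Icc 0 1) := by
    refine eVariationOn.comp_le_of_monotoneOn γ' (fun t : ℝ => t - 1) ?_ hsub
    intro s _ t _ hst
    simp only []
    linarith
  calc _ ≤ (intrinsicDist S x y + (ε / 2 : NNReal)) + (intrinsicDist S y z + (ε / 2 : NNReal)) :=
        add_le_add h.le (h3.trans h'.le)
    _ = intrinsicDist S x y + intrinsicDist S y z + ((ε / 2 : NNReal) + (ε / 2 : NNReal)) := by ring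
    _ = _ := by rw [← ENNReal.coe_add, add_halves]

theorem intrinsicDist_le_edist_of_segment (h : segment ℝ x y ⊆ S) :
    intrinsicDist S x y ≤ edist x y := by
  have key := intrinsicDist_le_variation (S := S) (γ := fun t : ℝ => AffineMap.lineMap x y t)
    zero_le_one (by fun_prop) (by
      intro t ht
      apply h
      rw [segment_eq_image_lineMap]
      exact ⟨t, ht, rfl⟩)
  simp only [AffineMap.lineMap_apply_zero, AffineMap.lineMap_apply_one] at key
  refine key.trans ?_
  have hl : LipschitzOnWith (nndist x y) (fun t : ℝ => (AffineMap.lineMap x y t : Euc n))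
      (univ) := (lipschitzWith_lineMap x y).lipschitzOnWith
  have := hl.comp_eVariationOn_le (g := (id : ℝ → ℝ)) (s := Icc (0:ℝ) 1) (mapsTo_univ _ _)
  refine this.trans ?_
  have h2 : eVariationOn (id : ℝ → ℝ) (Icc (0:ℝ) 1) ≤ 1 := by
    have := (monotone_id.monotoneOn (Icc (0:ℝ) 1)).eVariationOn_eq (a := (0:ℝ)) (b := 1)
      (by simp) (by simp)
    rw [inter_self] at this
    simp [this]
  calc _ ≤ (nndist x y : ENNReal) * 1 := by gcongr
    _ = _ := by rw [mul_one, edist_nndist]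

end Intrinsic

/-! ### Real-valued bounds for the completed metric -/

section Bounds

variable {n : ℕ} {S : Set (Euc n)}

/-- The intrinsic distance of two points is at most `r`. -/
def IntLE (S : Set (Euc n)) (x y : Euc n) (r : ℝ) : Prop :=
  0 ≤ r ∧ intrinsicDist S x y ≤ ENNReal.ofReal r

/-- The distance from a point to a Hausdorff boundary element is at most `r`. -/
def PtLE (w : Euc n) (a : HausdorffBoundary S) (r : ℝ) : Prop :=
  0 ≤ r ∧ ∀ ε > 0, ∀ᶠ k in atTop, intrinsicDist S w (a.out.seq k) ≤ ENNReal.ofReal (r + ε)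

/-- The relative distance of two Hausdorff boundary elements is at most `r`. -/
def BdLE (a b : HausdorffBoundary S) (r : ℝ) : Prop :=
  0 ≤ r ∧ ∀ ε > 0, ∀ᶠ k in atTop,
    intrinsicDist S (a.out.seq k) (b.out.seq k) ≤ ENNReal.ofReal (r + ε)

variable {w v x y z : Euc n} {a b c : HausdorffBoundary S} {r s : ℝ}

theorem intrinsicDist_le_ofReal_add {p q : ℝ} (hp : 0 ≤ p) (hq : 0 ≤ q)
    (h : intrinsicDist S x y ≤ ENNReal.ofReal p) (h' : intrinsicDist S y z ≤ ENNReal.ofReal q) :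
    intrinsicDist S x z ≤ ENNReal.ofReal (p + q) := by
  rw [ENNReal.ofReal_add hp hq]
  exact intrinsicDist_triangle.trans (add_le_add h h')

theorem dist_le_of_intrinsicDist_le (hr : 0 ≤ r) (h : intrinsicDist S x y ≤ ENNReal.ofReal r) :
    dist x y ≤ r := by
  have := edist_le_intrinsicDist.trans h
  rwa [edist_dist, ENNReal.ofReal_le_ofReal_iff hr] at this

theorem IntLE.dist_le (h : IntLE S x y r) : dist x y ≤ r :=
  dist_le_of_intrinsicDist_le h.1 h.2

theorem IntLE.symm (h : IntLE S x y r) : IntLE S y x r :=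
  ⟨h.1, intrinsicDist_comm.trans_le h.2⟩

theorem IntLE.trans (h : IntLE S x y r) (h' : IntLE S y z s) : IntLE S x z (r + s) :=
  ⟨add_nonneg h.1 h'.1, intrinsicDist_le_ofReal_add h.1 h'.1 h.2 h'.2⟩

theorem IntLE.mono (h : IntLE S x y r) (hrs : r ≤ s) : IntLE S x y s :=
  ⟨h.1.trans hrs, h.2.trans (ENNReal.ofReal_le_ofReal hrs)⟩

theorem IntLE.of_segment (h : segment ℝ x y ⊆ S) : IntLE S x y (dist x y) :=
  ⟨dist_nonneg, by rw [← edist_dist]; exact intrinsicDist_le_edist_of_segment h⟩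

theorem IntLE.of_forall_pos (h : ∀ ε > 0, IntLE S x y (r + ε)) : IntLE S x y r := by
  have hr : 0 ≤ r := le_of_forall_pos_le_add fun ε hε => (h ε hε).1
  refine ⟨hr, ENNReal.le_of_forall_pos_le_add fun ε hε _ => ?_⟩
  have := (h ε hε).2
  rwa [ENNReal.ofReal_add hr ε.coe_nonneg, ENNReal.ofReal_coe_nnreal] at this

theorem PtLE.mono (h : PtLE w a r) (hrs : r ≤ s) : PtLE w a s :=
  ⟨h.1.trans hrs, fun ε hε => (h.2 ε hε).mono fun _ hk =>
    hk.trans (ENNReal.ofReal_le_ofReal (by linarith))⟩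

theorem PtLE.of_forall_pos (h : ∀ ε > 0, PtLE w a (r + ε)) : PtLE w a r := by
  refine ⟨le_of_forall_pos_le_add fun ε hε => (h ε hε).1, fun ε hε => ?_⟩
  filter_upwards [(h (ε / 2) (by positivity)).2 (ε / 2) (by positivity)] with k hk
  rwa [add_assoc, add_halves] at hk

theorem IntLE.trans_pt (h : IntLE S w v r) (h' : PtLE v a s) : PtLE w a (r + s) := by
  refine ⟨add_nonneg h.1 h'.1, fun ε hε => ?_⟩
  filter_upwards [h'.2 ε hε] with k hk
  rw [add_assoc]
  exact intrinsicDist_le_ofReal_add h.1 (by linarith [h'.1]) h.2 hk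

theorem BdLE.mono (h : BdLE a b r) (hrs : r ≤ s) : BdLE a b s :=
  ⟨h.1.trans hrs, fun ε hε => (h.2 ε hε).mono fun _ hk =>
    hk.trans (ENNReal.ofReal_le_ofReal (by linarith))⟩

theorem BdLE.of_forall_pos (h : ∀ ε > 0, BdLE a b (r + ε)) : BdLE a b r := by
  refine ⟨le_of_forall_pos_le_add fun ε hε => (h ε hε).1, fun ε hε => ?_⟩
  filter_upwards [(h (ε / 2) (by positivity)).2 (ε / 2) (by positivity)] with k hk
  rwa [add_assoc, add_halves] at hk

theorem bdLE_iff : BdLE a b r ↔ 0 ≤ r ∧ hbDist a b ≤ ENNReal.ofReal r := by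
  refine and_congr_right fun hr => ?_
  rw [hbDist, Filter.limsup_le_iff]
  constructor
  · intro h t ht
    obtain ⟨q, hq0, hq, hqt⟩ := ENNReal.lt_iff_exists_real_btwn.1 ht
    have hrq : r < q := (ENNReal.ofReal_lt_ofReal_iff_of_nonneg hr).1 hq
    filter_upwards [h (q - r) (by linarith)] with k hk
    rw [add_sub_cancel] at hk
    exact hk.trans_lt hqt
  · intro h ε hε
    filter_upwards [h (ENNReal.ofReal (r + ε))
      ((ENNReal.ofReal_lt_ofReal_iff (by linarith)).2 (by linarith))] with k hk
    exact hk.le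

theorem PtLE.add_pt (h : PtLE w a r) (h' : PtLE w b s) : BdLE a b (r + s) := by
  refine ⟨add_nonneg h.1 h'.1, fun ε hε => ?_⟩
  filter_upwards [h.2 (ε / 2) (by positivity), h'.2 (ε / 2) (by positivity)] with k hk hk'
  rw [intrinsicDist_comm] at hk
  have := intrinsicDist_le_ofReal_add (by linarith [h.1]) (by linarith [h'.1]) hk hk'
  convert this using 2
  ring

theorem PtLE.trans_bd (h : PtLE w a r) (h' : BdLE a b s) : PtLE w b (r + s) := by
  refine ⟨add_nonneg h.1 h'.1, fun ε hε => ?_⟩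
  filter_upwards [h.2 (ε / 2) (by positivity), h'.2 (ε / 2) (by positivity)] with k hk hk'
  have := intrinsicDist_le_ofReal_add (by linarith [h.1]) (by linarith [h'.1]) hk hk'
  convert this using 2
  ring

theorem hbEquiv_equivalence : Equivalence (HBEquiv S) where
  refl s := by
    refine tendsto_const_nhds.congr fun k => le_antisymm (zero_le) ?_
    have := intrinsicDist_le_edist_of_segment (S := S) (x := s.seq k) (y := s.seq k)
      (by simp [s.mem k])
    simpa using this
  symm h := h.congr fun k => intrinsicDist_comm
  trans {s t u} h h' := by
    have := h.add h'
    rw [add_zero] at this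
    exact tendsto_of_tendsto_of_tendsto_of_le_of_le tendsto_const_nhds this
      (fun _ => zero_le) fun k => intrinsicDist_triangle

theorem hbEquiv_out (s : HBSeq S) : HBEquiv S (Quot.mk (HBEquiv S) s).out s := by
  have : Quot.mk (HBEquiv S) (Quot.mk (HBEquiv S) s).out = Quot.mk _ s := Quot.out_eq _
  exact hbEquiv_equivalence.eqvGen_iff.1 (Quot.eqvGen_exact this)

theorem BdLE.eq (h : BdLE a b 0) : a = b := by
  have h1 : HBEquiv S a.out b.out := by
    rw [HBEquiv, ENNReal.tendsto_nhds_zero]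
    intro ε hε
    obtain ⟨q, hq0, hq, hqt⟩ := ENNReal.lt_iff_exists_real_btwn.1 hε
    have : 0 < q := by simpa using hq
    filter_upwards [h.2 q this] with k hk
    rw [zero_add] at hk
    exact hk.trans hqt.le
  rw [← Quot.out_eq a, ← Quot.out_eq b]
  exact Quot.sound h1

theorem HBSeq.eventually_intLE (s : HBSeq S) {ε : ℝ} (hε : 0 < ε) :
    ∃ N : ℕ, ∀ j ≥ N, ∀ k ≥ N, IntLE S (s.seq j) (s.seq k) ε := by
  obtain ⟨N, hN⟩ := s.cauchy (ENNReal.ofReal ε) (by simpa using hε)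
  exact ⟨N, fun j hj k hk => ⟨hε.le, (hN j hj k hk).le⟩⟩

theorem tendsto_out_seq (a : HausdorffBoundary S) :
    Tendsto a.out.seq atTop (nhds (hbSupport a)) := by
  have : CauchySeq a.out.seq := by
    rw [Metric.cauchySeq_iff']
    intro ε hε
    obtain ⟨N, hN⟩ := a.out.eventually_intLE (half_pos hε)
    exact ⟨N, fun k hk => ((hN k hk N le_rfl).dist_le).trans_lt (by linarith)⟩
  obtain ⟨l, hl⟩ := cauchySeq_tendsto_of_complete this
  rw [hbSupport, hl.limUnder_eq]
  exact hl

theorem PtLE.dist_le (h : PtLE w a r) : dist w (hbSupport a) ≤ r := by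
  refine le_of_forall_pos_le_add fun ε hε => ?_
  refine le_of_tendsto (tendsto_const_nhds.dist (tendsto_out_seq a)) ?_
  filter_upwards [h.2 ε hε] with k hk
  exact dist_le_of_intrinsicDist_le (by linarith [h.1]) hk

theorem BdLE.dist_le (h : BdLE a b r) : dist (hbSupport a) (hbSupport b) ≤ r := by
  refine le_of_forall_pos_le_add fun ε hε => ?_
  refine le_of_tendsto ((tendsto_out_seq a).dist (tendsto_out_seq b)) ?_
  filter_upwards [h.2 ε hε] with k hk
  exact dist_le_of_intrinsicDist_le (by linarith [h.1]) hk

theorem exists_ptLE (a : HausdorffBoundary S) {ε : ℝ} (hε : 0 < ε) :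
    ∃ w ∈ S, PtLE w a ε := by
  obtain ⟨N, hN⟩ := a.out.eventually_intLE hε
  refine ⟨_, a.out.mem N, hε.le, fun η hη => ?_⟩
  filter_upwards [eventually_ge_atTop N] with k hk
  exact (hN N le_rfl k hk).2.trans (ENNReal.ofReal_le_ofReal (by linarith))

theorem eventually_ptLE (a : HausdorffBoundary S) {ε : ℝ} (hε : 0 < ε) :
    ∀ᶠ k in atTop, PtLE (a.out.seq k) a ε := by
  obtain ⟨N, hN⟩ := a.out.eventually_intLE hε
  filter_upwards [eventually_ge_atTop N] with j hj
  refine ⟨hε.le, fun η hη => ?_⟩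
  filter_upwards [eventually_ge_atTop N] with k hk
  exact (hN j hj k hk).2.trans (ENNReal.ofReal_le_ofReal (by linarith))

theorem eq_of_forall_ptLE (h : ∀ ε > 0, ∃ w, PtLE w a ε ∧ PtLE w b ε) : a = b := by
  refine BdLE.eq (BdLE.of_forall_pos fun ε hε => ?_)
  obtain ⟨w, h1, h2⟩ := h (ε / 2) (by positivity)
  exact (h1.add_pt h2).mono (by linarith)

theorem hbSupport_notMem (hS : IsOpen S) (a : HausdorffBoundary S) : hbSupport a ∉ S := by
  intro hmem
  refine a.out.notConv ⟨_, hmem, ?_⟩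
  obtain ⟨δ, hδ, hb⟩ := Metric.isOpen_iff.1 hS _ hmem
  have h1 : Tendsto (fun k => edist (a.out.seq k) (hbSupport a)) atTop (nhds 0) :=
    tendsto_iff_edist_tendsto_0.1 (tendsto_out_seq a)
  refine tendsto_of_tendsto_of_tendsto_of_le_of_le' tendsto_const_nhds h1
    (Eventually.of_forall fun _ => zero_le) ?_
  filter_upwards [(tendsto_out_seq a).eventually (Metric.ball_mem_nhds _ hδ)] with k hk
  refine intrinsicDist_le_edist_of_segment (Subset.trans ?_ hb)
  exact (convex_ball _ _).segment_subset hk (Metric.mem_ball_self hδ)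

theorem PtLE.tendsto_mk {s : HBSeq S} (h : ∀ ε > 0, ∀ᶠ k in atTop, IntLE S w (s.seq k) (r + ε))
    (hr : 0 ≤ r) : PtLE w (Quot.mk (HBEquiv S) s) r := by
  refine ⟨hr, fun ε hε => ?_⟩
  have h1 := hbEquiv_equivalence.symm (hbEquiv_out s)
  rw [HBEquiv, ENNReal.tendsto_nhds_zero] at h1
  filter_upwards [h (ε / 2) (by positivity), h1 (ENNReal.ofReal (ε / 2)) (by simpa using hε)]
    with k hk hk'
  have := intrinsicDist_le_ofReal_add (by linarith) (by linarith) hk.2 hk'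
  convert this using 2
  ring

theorem hbSupport_mk {s : HBSeq S} (h : Tendsto s.seq atTop (nhds x)) :
    hbSupport (Quot.mk (HBEquiv S) s) = x := by
  have h1 := hbEquiv_out s
  have h2 : Tendsto (fun k => edist ((Quot.mk (HBEquiv S) s).out.seq k) (s.seq k)) atTop
      (nhds 0) :=
    tendsto_of_tendsto_of_tendsto_of_le_of_le tendsto_const_nhds h1 (fun _ => zero_le)
      fun k => edist_le_intrinsicDist
  have h3 := (tendsto_out_seq (Quot.mk (HBEquiv S) s)).edist h
  have := tendsto_nhds_unique h3 h2
  rwa [edist_eq_zero] at this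

end Bounds

/-! ### Elements generated by segments and points along short paths -/

section Segments

open AffineMap (lineMap)

variable {n : ℕ} {S : Set (Euc n)} {w v x y q : Euc n} {a b : HausdorffBoundary S} {r : ℝ}

theorem exists_generatesEndpoint (h : openSegment ℝ w q ⊆ S) (hq : q ∉ S) :
    ∃ a : HausdorffBoundary S, GeneratesEndpoint S q w a := by
  set s : ℕ → Euc n := fun k => lineMap q w (1 / ((k : ℝ) + 2))
  have hs : ∀ k, s k ∈ openSegment ℝ q w := by
    intro k
    rw [openSegment_eq_image_lineMap]
    refine ⟨_, ⟨by positivity, ?_⟩, rfl⟩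
    rw [div_lt_one (by positivity)]
    have : (0:ℝ) ≤ k := by positivity
    linarith
  have hlim : Tendsto s atTop (nhds q) := by
    have h1 : Tendsto (fun k : ℕ => 1 / ((k : ℝ) + 2)) atTop (nhds 0) := by
      refine tendsto_const_nhds.div_atTop ?_
      exact tendsto_atTop_add_const_right _ _ tendsto_natCast_atTop_atTop
    have h2 : Continuous (fun t : ℝ => (lineMap q w t : Euc n)) := AffineMap.lineMap_continuous
    have h3 : Tendsto s atTop (nhds (lineMap q w (0:ℝ))) := (h2.tendsto 0).comp h1
    rwa [AffineMap.lineMap_apply_zero] at h3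
  have hseg : ∀ j k, segment ℝ (s j) (s k) ⊆ S := fun j k =>
    ((convex_openSegment q w).segment_subset (hs j) (hs k)).trans
      (by rw [openSegment_symm]; exact h)
  refine ⟨Quot.mk _ ⟨s, fun k => h (by rw [openSegment_symm]; exact hs k), ?_, ?_⟩, _, rfl, ?_, ?_⟩
  · intro ε hε
    have hc := hlim.cauchySeq
    rw [EMetric.cauchySeq_iff] at hc
    obtain ⟨N, hN⟩ := hc ε hε
    exact ⟨N, fun j hj k hk =>
      (intrinsicDist_le_edist_of_segment (hseg j k)).trans_lt (hN j hj k hk)⟩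
  · rintro ⟨u, hu, htend⟩
    have : Tendsto (fun k => edist (s k) u) atTop (nhds 0) :=
      tendsto_of_tendsto_of_tendsto_of_le_of_le tendsto_const_nhds htend (fun _ => zero_le)
        fun k => edist_le_intrinsicDist
    have := tendsto_nhds_unique hlim (tendsto_iff_edist_tendsto_0.2 this)
    exact hq (this ▸ hu)
  · exact hs
  · exact hlim

theorem GeneratesEndpoint.support (h : GeneratesEndpoint S x y a) : hbSupport a = x := by
  obtain ⟨s, rfl, -, hl⟩ := h
  exact hbSupport_mk hl

theorem GeneratesEndpoint.ptLE (h : GeneratesEndpoint S x y a) (hS : openSegment ℝ x y ⊆ S)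
    (hv : v ∈ openSegment ℝ x y) : PtLE v a (dist v x) := by
  obtain ⟨s, rfl, hs, hl⟩ := h
  refine PtLE.tendsto_mk (fun ε hε => ?_) dist_nonneg
  have h1 := (tendsto_const_nhds (x := v)).dist hl
  filter_upwards [h1.eventually_lt_const (show dist v x < dist v x + ε by linarith)] with k hk
  exact (IntLE.of_segment (((convex_openSegment x y).segment_subset hv (hs k)).trans hS)).mono hk.le

theorem exists_first_hit (hS : IsOpen S) (hw : w ∈ S) (hq : q ∉ S) :
    ∃ τ : ℝ, 0 < τ ∧ τ ≤ 1 ∧ (lineMap w q τ : Euc n) ∉ S ∧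
      ∀ t, 0 ≤ t → t < τ → (lineMap w q t : Euc n) ∈ S := by
  have hc : Continuous (fun t : ℝ => (lineMap w q t : Euc n)) := AffineMap.lineMap_continuous
  have hcpt : IsCompact (Icc (0:ℝ) 1 ∩ (fun t : ℝ => (lineMap w q t : Euc n)) ⁻¹' Sᶜ) :=
    isCompact_Icc.inter_right (hS.isClosed_compl.preimage hc)
  obtain ⟨τ, ⟨hτ1, hτ2⟩, hτ3⟩ := hcpt.exists_isLeast ⟨1, by simp, by simpa using hq⟩
  refine ⟨τ, lt_of_le_of_ne hτ1.1 ?_, hτ1.2, hτ2, fun t ht htτ => ?_⟩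
  · rintro rfl
    simp [hw] at hτ2
  · by_contra hcon
    exact (hτ3 ⟨⟨ht, htτ.le.trans hτ1.2⟩, hcon⟩).not_gt htτ

theorem dist_lineMap_lineMap_left {t τ : ℝ} (h : t ≤ τ) :
    dist (lineMap w q t : Euc n) (lineMap w q τ) = (τ - t) * dist w q := by
  rw [dist_lineMap_lineMap, Real.dist_eq, abs_sub_comm, abs_of_nonneg (sub_nonneg.2 h)]

theorem lineMap_mem_openSegment_left {t τ : ℝ} (h0 : 0 < t) (h : t < τ) :
    (lineMap w q t : Euc n) ∈ openSegment ℝ w (lineMap w q τ) := by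
  rw [openSegment_eq_image_lineMap]
  refine ⟨t / τ, ⟨div_pos h0 (h0.trans h), (div_lt_one (h0.trans h)).2 h⟩, ?_⟩
  rw [AffineMap.lineMap_lineMap_right, div_mul_cancel₀ _ (h0.trans h).ne']

theorem exists_first_hit_elem (hS : IsOpen S) (hw : w ∈ S) (hq : q ∉ S) :
    ∃ (τ : ℝ) (a : HausdorffBoundary S), 0 < τ ∧ τ ≤ 1 ∧ hbSupport a = lineMap w q τ ∧
      ∀ t, 0 ≤ t → t < τ → (lineMap w q t : Euc n) ∈ S ∧
        PtLE (lineMap w q t : Euc n) a ((τ - t) * dist w q) := by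
  obtain ⟨τ, h0, h1, hτ, hlt⟩ := exists_first_hit hS hw hq
  have hsub : openSegment ℝ w (lineMap w q τ) ⊆ S := by
    rw [openSegment_eq_image_lineMap]
    rintro _ ⟨t, ⟨ht0, ht1⟩, rfl⟩
    rw [AffineMap.lineMap_lineMap_right]
    exact hlt _ (mul_nonneg ht0.le h0.le) (by nlinarith)
  obtain ⟨a, ha⟩ := exists_generatesEndpoint hsub hτ
  have hpos : ∀ t, 0 < t → t < τ → PtLE (lineMap w q t : Euc n) a ((τ - t) * dist w q) := by
    intro t ht htτ
    rw [openSegment_symm] at hsub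
    have := ha.ptLE (v := lineMap w q t) hsub
      (by rw [openSegment_symm]; exact lineMap_mem_openSegment_left ht htτ)
    rwa [dist_lineMap_lineMap_left htτ.le] at this
  refine ⟨τ, a, h0, h1, ha.support, fun t ht htτ => ⟨hlt t ht htτ, ?_⟩⟩
  rcases ht.eq_or_lt with rfl | ht
  · have hseg : segment ℝ (lineMap w q (0:ℝ) : Euc n) (lineMap w q (τ / 2)) ⊆ S := by
      rw [segment_eq_image_lineMap]
      rintro _ ⟨s, ⟨hs0, hs1⟩, rfl⟩
      rw [AffineMap.lineMap_apply_zero, AffineMap.lineMap_lineMap_right]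
      exact hlt _ (mul_nonneg hs0 (half_pos h0).le) (by nlinarith)
    have h2 := (IntLE.of_segment hseg).trans_pt (hpos (τ / 2) (by linarith) (by linarith))
    rw [dist_lineMap_lineMap_left (by linarith)] at h2
    exact h2.mono (by linarith)
  · exact hpos t ht htτ

theorem exists_nearest_elem (hS : IsOpen S) (hS' : S ≠ univ) (hw : w ∈ S) :
    ∃ a : HausdorffBoundary S, PtLE w a (dist w (hbSupport a)) ∧
      Metric.ball w (dist w (hbSupport a)) ⊆ S := by
  obtain ⟨q, hq, hqd⟩ := hS.isClosed_compl.exists_infDist_eq_dist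
    (nonempty_compl.2 hS') w
  have hball : Metric.ball w (dist w q) ⊆ S := by
    intro v hv
    by_contra hcon
    have := Metric.infDist_le_dist_of_mem (x := w) (show v ∈ Sᶜ from hcon)
    rw [Metric.mem_ball, dist_comm] at hv
    linarith
  obtain ⟨τ, a, h0, h1, ha, h⟩ := exists_first_hit_elem hS hw hq
  have h1' : τ = 1 := by
    by_contra hne
    have hlt : τ < 1 := lt_of_le_of_ne h1 hne
    have hmem : hbSupport a ∈ S := by
      apply hball
      rw [ha, Metric.mem_ball, dist_lineMap_left, Real.norm_of_nonneg h0.le]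
      have : 0 < dist w q := dist_pos.2 (fun h => hq (h ▸ hw))
      nlinarith
    exact hbSupport_notMem hS a hmem
  subst h1'
  rw [AffineMap.lineMap_apply_one] at ha
  refine ⟨a, ?_, ha ▸ hball⟩
  rw [ha]
  simpa using (h 0 le_rfl zero_lt_one).2

theorem PtLE.split (hS : IsOpen S) (hw : w ∈ S) {t η : ℝ} (h : PtLE w b r)
    (ht : 0 ≤ t) (htr : t ≤ r) (hη : 0 < η) :
    ∃ v ∈ S, IntLE S w v t ∧ PtLE v b (r - t + η) := by
  obtain ⟨k, hk, hkb⟩ := ((h.2 (η / 4) (by positivity)).and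
    (eventually_ptLE b (show 0 < η / 4 by positivity))).exists
  set z := b.out.seq k
  by_cases hz : intrinsicDist S w z ≤ ENNReal.ofReal t
  · exact ⟨z, b.out.mem k, ⟨ht, hz⟩, hkb.mono (by linarith)⟩
  push Not at hz
  obtain ⟨γ, hc, h0, h1, hm, hvar⟩ := exists_path_of_intrinsicDist_lt
    (hk.trans_lt ((ENNReal.ofReal_lt_ofReal_iff (by linarith)).2
      (show r + η / 4 < r + η / 2 by linarith)))
  have hfin : ∀ τ ∈ Icc (0:ℝ) 1, intrinsicDist S w (γ τ) ≠ ⊤ := by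
    intro τ hτ
    have h2 : intrinsicDist S (γ 0) (γ τ) ≤ eVariationOn γ (Icc 0 τ) :=
      intrinsicDist_le_variation hτ.1 (hc.mono (Icc_subset_Icc_right hτ.2))
        (hm.mono_left (Icc_subset_Icc_right hτ.2))
    rw [h0] at h2
    exact (h2.trans_lt ((eVariationOn.mono _ (Icc_subset_Icc_right hτ.2)).trans_lt
      (hvar.trans ENNReal.ofReal_lt_top))).ne
  have hcont : ContinuousOn (fun τ => intrinsicDist S w (γ τ)) (Icc 0 1) := by
    intro τ hτ
    obtain ⟨δ, hδ, hb⟩ := Metric.isOpen_iff.1 hS _ (hm hτ)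
    have hseg : ∀ p ∈ Metric.ball (γ τ) δ, intrinsicDist S (γ τ) p ≤ edist (γ τ) p := fun p hp =>
      intrinsicDist_le_edist_of_segment
        (((convex_ball _ _).segment_subset (Metric.mem_ball_self hδ) hp).trans hb)
    have h2 : ∀ᶠ σ in nhdsWithin τ (Icc 0 1), γ σ ∈ Metric.ball (γ τ) δ :=
      (hc τ hτ).eventually (Metric.ball_mem_nhds _ hδ)
    rw [ContinuousWithinAt, ENNReal.tendsto_nhds (hfin τ hτ)]
    intro ε hε
    have h3 : ∀ᶠ σ in nhdsWithin τ (Icc 0 1), edist (γ τ) (γ σ) < ε := by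
      have := (hc τ hτ).eventually (Metric.eball_mem_nhds (γ τ) hε)
      filter_upwards [this] with σ hσ
      rw [edist_comm]
      exact hσ
    filter_upwards [h2, h3] with σ hσ hσ'
    have h4 := (hseg _ hσ).trans hσ'.le
    constructor
    · rw [tsub_le_iff_right]
      refine intrinsicDist_triangle.trans (add_le_add le_rfl (intrinsicDist_comm.trans_le h4))
    · exact intrinsicDist_triangle.trans (add_le_add le_rfl h4)
  have hivt := intermediate_value_Icc (zero_le_one) hcont
  have hself : intrinsicDist S w w = 0 := by
    have := intrinsicDist_le_edist_of_segment (S := S) (x := w) (y := w) (by simp [hw])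
    simpa using this
  obtain ⟨τ, hτ, hτt⟩ := hivt (show ENNReal.ofReal t ∈ _ by
    simp only [h0, h1, hself]
    exact ⟨zero_le, hz.le⟩)
  simp only at hτt
  refine ⟨γ τ, hm hτ, ⟨ht, hτt.le⟩, ?_⟩
  have e1 : ENNReal.ofReal t ≤ eVariationOn γ (Icc 0 τ) := by
    rw [← hτt, ← h0]
    exact intrinsicDist_le_variation hτ.1 (hc.mono (Icc_subset_Icc_right hτ.2))
        (hm.mono_left (Icc_subset_Icc_right hτ.2))
  have e2 : intrinsicDist S (γ τ) z ≤ eVariationOn γ (Icc τ 1) := by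
    rw [← h1]
    exact intrinsicDist_le_variation hτ.2 (hc.mono (Icc_subset_Icc_left hτ.1))
        (hm.mono_left (Icc_subset_Icc_left hτ.1))
  have e3 : eVariationOn γ (Icc 0 τ) + eVariationOn γ (Icc τ 1) < ENNReal.ofReal (r + η / 2) := by
    rw [← eVariationOn.union γ (x := τ) (isGreatest_Icc hτ.1) (isLeast_Icc hτ.2),
      Icc_union_Icc_eq_Icc hτ.1 hτ.2]
    exact hvar
  have e4 : IntLE S (γ τ) z (r - t + η / 2) := by
    refine ⟨by linarith, ?_⟩
    have := (add_le_add e1 e2).trans e3.le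
    rw [show r - t + η / 2 = r + η / 2 - t by ring, ENNReal.ofReal_sub _ ht]
    exact ENNReal.le_sub_of_add_le_left ENNReal.ofReal_ne_top this
  exact (e4.trans_pt hkb).mono (by linarith)

theorem BdLE.split (hS : IsOpen S) {t η : ℝ} (h : BdLE a b r)
    (ht : 0 ≤ t) (htr : t ≤ r) (hη : 0 < η) :
    ∃ v ∈ S, PtLE v a (t + η) ∧ PtLE v b (r - t + η) := by
  obtain ⟨w, hw, hwa⟩ := exists_ptLE a (half_pos hη)
  have hwa' := hwa
  obtain ⟨v, hv, h1, h2⟩ := (hwa.trans_bd h).split hS hw ht (by linarith) (half_pos hη)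
  refine ⟨v, hv, ?_, h2.mono (by linarith)⟩
  exact (h1.symm.trans_pt hwa').mono (by linarith)

end Segments

/-! ### Mutual visibility of boundary elements -/

section Sees

open AffineMap (lineMap)

variable {n : ℕ} {S : Set (Euc n)} {w v x y : Euc n} {a b c : HausdorffBoundary S} {r : ℝ}

/-- The open segment between the supports of `a` and `b` lies in `S` and generates `a` and `b`. -/
structure Sees (a b : HausdorffBoundary S) : Prop where
  ne : hbSupport a ≠ hbSupport b
  mem : ∀ w ∈ openSegment ℝ (hbSupport a) (hbSupport b), w ∈ S
  left : ∀ w ∈ openSegment ℝ (hbSupport a) (hbSupport b), PtLE w a (dist w (hbSupport a))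
  right : ∀ w ∈ openSegment ℝ (hbSupport a) (hbSupport b), PtLE w b (dist w (hbSupport b))

theorem Sees.symm (h : Sees a b) : Sees b a := by
  obtain ⟨h1, h2, h3, h4⟩ := h
  rw [openSegment_symm] at h2 h3 h4
  exact ⟨h1.symm, h2, h4, h3⟩

theorem lineMap_mem_openSeg {t : ℝ} (h0 : 0 < t) (h1 : t < 1) :
    (lineMap x y t : Euc n) ∈ openSegment ℝ x y := by
  rw [openSegment_eq_image_lineMap]
  exact ⟨t, ⟨h0, h1⟩, rfl⟩

theorem Sees.bdLE (h : Sees a b) : BdLE a b (dist (hbSupport a) (hbSupport b)) := by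
  have hm := lineMap_mem_openSeg (x := hbSupport a) (y := hbSupport b)
    (show (0:ℝ) < 1 / 2 by norm_num) (by norm_num)
  have := (h.left _ hm).add_pt (h.right _ hm)
  rw [dist_lineMap_left, dist_lineMap_right] at this
  refine this.mono (le_of_eq ?_)
  norm_num
  ring

theorem intLE_of_mem_ball {δ : ℝ} (h : Metric.ball x δ ⊆ S) (hy : y ∈ Metric.ball x δ) :
    IntLE S x y (dist x y) := by
  have hδ : 0 < δ := lt_of_le_of_lt dist_nonneg hy
  exact IntLE.of_segment (((convex_ball _ _).segment_subset (Metric.mem_ball_self hδ) hy).trans h)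

/-- Stewart's theorem. -/
theorem dist_sq_lineMap (p : Euc n) (t : ℝ) :
    dist p (lineMap x y t) ^ 2 =
      (1 - t) * dist p x ^ 2 + t * dist p y ^ 2 - t * (1 - t) * dist x y ^ 2 := by
  have e1 : p - lineMap x y t = (1 - t) • (p - x) + t • (p - y) := by
    rw [AffineMap.lineMap_apply]
    simp only [vsub_eq_sub, vadd_eq_add]
    module
  have e2 : x - y = (p - y) - (p - x) := by abel
  rw [dist_eq_norm, dist_eq_norm, dist_eq_norm, dist_eq_norm, e1, e2]
  generalize p - x = X
  generalize p - y = Y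
  rw [norm_add_sq_real, norm_sub_sq_real, norm_smul, norm_smul, inner_smul_left, inner_smul_right,
    mul_pow, mul_pow, Real.norm_eq_abs, Real.norm_eq_abs, sq_abs, sq_abs, real_inner_comm X Y]
  simp only [conj_trivial]
  ring

theorem Sees.of_bdLE (hS : IsOpen S) (hne : hbSupport a ≠ hbSupport b)
    (hm : ∀ w ∈ openSegment ℝ (hbSupport a) (hbSupport b), w ∈ S)
    (h : BdLE a b (dist (hbSupport a) (hbSupport b))) : Sees a b := by
  set L := dist (hbSupport a) (hbSupport b) with hL
  have hLpos : 0 < L := dist_pos.2 hne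
  have key : ∀ t, 0 < t → t < 1 → ∀ ε > 0,
      PtLE (lineMap (hbSupport a) (hbSupport b) t : Euc n) a (t * L + ε) ∧
      PtLE (lineMap (hbSupport a) (hbSupport b) t : Euc n) b ((1 - t) * L + ε) := by
    intro t ht0 ht1 ε hε
    set w : Euc n := lineMap (hbSupport a) (hbSupport b) t
    obtain ⟨δ, hδ, hb⟩ := Metric.isOpen_iff.1 hS w (hm w (lineMap_mem_openSeg ht0 ht1))
    set κ := min δ (ε / 2)
    have hκ : 0 < κ := lt_min hδ (by positivity)
    set η := min (min (ε / 2) L) (κ ^ 2 / (16 * L)) with hη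
    have hηpos : 0 < η := lt_min (lt_min (by positivity) hLpos) (by positivity)
    have hη1 : η ≤ ε / 2 := (min_le_left _ _).trans (min_le_left _ _)
    have hη2 : η ≤ L := (min_le_left _ _).trans (min_le_right _ _)
    have hη3 : η * (16 * L) ≤ κ ^ 2 := by
      rw [← le_div_iff₀ (by positivity)]; exact min_le_right _ _
    obtain ⟨v, hv, hva, hvb⟩ := h.split hS (t := t * L) (by positivity) (by nlinarith) hηpos
    have hd := dist_sq_lineMap (x := hbSupport a) (y := hbSupport b) v t
    have h1 := hva.dist_le
    have h2 := hvb.dist_le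
    have h1' : dist v (hbSupport a) ^ 2 ≤ (t * L + η) ^ 2 := by gcongr
    have h2' : dist v (hbSupport b) ^ 2 ≤ (L - t * L + η) ^ 2 := by gcongr
    have hd2 : dist v w ^ 2 < κ ^ 2 := by
      rw [hd, ← hL]
      have e1 : (1 - t) * dist v (hbSupport a) ^ 2 ≤ (1 - t) * (t * L + η) ^ 2 :=
        mul_le_mul_of_nonneg_left h1' (by linarith)
      have e2 : t * dist v (hbSupport b) ^ 2 ≤ t * (L - t * L + η) ^ 2 :=
        mul_le_mul_of_nonneg_left h2' (by linarith)
      have e3 : t * (1 - t) * L * η ≤ 1 * L * η := by gcongr; nlinarith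
      nlinarith [mul_le_mul_of_nonneg_left hη2 hηpos.le]
    have hd3 : dist v w < κ := lt_of_pow_lt_pow_left₀ 2 hκ.le hd2
    have hi : IntLE S w v (dist w v) :=
      intLE_of_mem_ball hb (hd3.trans_le (min_le_left _ _))
    rw [dist_comm] at hi
    have : dist v w < ε / 2 := hd3.trans_le (min_le_right _ _)
    exact ⟨(hi.trans_pt hva).mono (by linarith), (hi.trans_pt hvb).mono (by linarith)⟩
  refine ⟨hne, hm, ?_, ?_⟩ <;> rw [openSegment_eq_image_lineMap] <;>
    rintro _ ⟨t, ⟨ht0, ht1⟩, rfl⟩ <;> refine PtLE.of_forall_pos fun ε hε => ?_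
  · rw [dist_lineMap_left, Real.norm_of_nonneg ht0.le]
    exact (key t ht0 ht1 ε hε).1
  · rw [dist_lineMap_right, Real.norm_of_nonneg (by linarith)]
    exact (key t ht0 ht1 ε hε).2

theorem Sees.of_generates (hm : openSegment ℝ x y ⊆ S) (hne : x ≠ y)
    (ha : GeneratesEndpoint S x y a) (hb : GeneratesEndpoint S y x b) : Sees a b := by
  refine ⟨?_, ?_, ?_, ?_⟩ <;> rw [ha.support, hb.support]
  · exact hne
  · exact fun w hw => hm hw
  · exact fun w hw => ha.ptLE hm hw
  · intro w hw
    rw [openSegment_symm] at hm hw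
    exact hb.ptLE hm hw

theorem Sees.eq_of_support_eq (hb : Sees a b) (hc : Sees a c) (h : hbSupport b = hbSupport c) :
    b = c := by
  refine eq_of_forall_ptLE fun ε hε => ?_
  set L := dist (hbSupport a) (hbSupport b)
  have hL : 0 < L := dist_pos.2 hb.ne
  set t := min (1 / 2) (ε / (2 * L))
  have ht : 0 < t := lt_min (by norm_num) (by positivity)
  have ht1 : t ≤ 1 / 2 := min_le_left _ _
  have ht2 : t * L ≤ ε := by
    have : t ≤ ε / (2 * L) := min_le_right _ _
    rw [le_div_iff₀ (by positivity)] at this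
    linarith
  have hw := lineMap_mem_openSeg (x := hbSupport a) (y := hbSupport b)
    (show 0 < 1 - t by linarith) (by linarith)
  have h1 := hb.right _ hw
  rw [h] at hw
  have h2 := hc.right _ hw
  rw [dist_lineMap_right, sub_sub_cancel, Real.norm_of_nonneg ht.le] at h1 h2
  rw [← h] at h2
  exact ⟨_, h1.mono ht2, h2.mono ht2⟩

/-- Elements seen from `a` in the same direction coincide. -/
theorem Sees.eq_of_ray (hS : IsOpen S) (hb : Sees a b) (hc : Sees a c) {t : ℝ} (ht : 0 < t)
    (h : hbSupport c - hbSupport a = t • (hbSupport b - hbSupport a)) : b = c := by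
  have h' : hbSupport c = lineMap (hbSupport a) (hbSupport b) t := by
    rw [AffineMap.lineMap_apply]
    simp [← h]
  rcases lt_trichotomy t 1 with h1 | rfl | h1
  · refine absurd (hb.mem (hbSupport c) ?_) (hbSupport_notMem hS c)
    rw [h']
    exact lineMap_mem_openSeg ht h1
  · exact hb.eq_of_support_eq hc (by simpa using h'.symm)
  · refine absurd (hc.mem (hbSupport b) ?_) (hbSupport_notMem hS b)
    have e : hbSupport b = lineMap (hbSupport a) (hbSupport c) t⁻¹ := by
      rw [AffineMap.lineMap_apply]
      simp [h, smul_smul, inv_mul_cancel₀ ht.ne']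
    rw [e]
    exact lineMap_mem_openSeg (by positivity) (inv_lt_one_of_one_lt₀ h1)

end Sees

/-! ### Isometries of Hausdorff boundaries preserve visibility -/

/-- An isometry of Hausdorff boundaries of proper open sets. -/
structure HBIso {n : ℕ} (U V : Set (Euc n)) where
  isOpen_left : IsOpen U
  isOpen_right : IsOpen V
  ne_univ_left : U ≠ univ
  ne_univ_right : V ≠ univ
  toEquiv : HausdorffBoundary U ≃ HausdorffBoundary V
  bdLE_iff' : ∀ a b r, BdLE (toEquiv a) (toEquiv b) r ↔ BdLE a b r

namespace HBIso

open AffineMap (lineMap)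

variable {n : ℕ} {U V : Set (Euc n)} {a b : HausdorffBoundary U} {r : ℝ}

instance : CoeFun (HBIso U V) fun _ => HausdorffBoundary U → HausdorffBoundary V :=
  ⟨fun I => I.toEquiv⟩

/-- The inverse isometry. -/
def symm (I : HBIso U V) : HBIso V U where
  isOpen_left := I.isOpen_right
  isOpen_right := I.isOpen_left
  ne_univ_left := I.ne_univ_right
  ne_univ_right := I.ne_univ_left
  toEquiv := I.toEquiv.symm
  bdLE_iff' a b r := by rw [← I.bdLE_iff']; simp

@[simp] theorem symm_apply_apply (I : HBIso U V) (a : HausdorffBoundary U) : I.symm (I a) = a :=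
  I.toEquiv.symm_apply_apply a

@[simp] theorem apply_symm_apply (I : HBIso U V) (a : HausdorffBoundary V) : I (I.symm a) = a :=
  I.toEquiv.apply_symm_apply a

theorem bdLE_iff (I : HBIso U V) : BdLE (I a) (I b) r ↔ BdLE a b r := I.bdLE_iff' a b r

theorem bdLE_symm_iff (I : HBIso U V) {c : HausdorffBoundary V} :
    BdLE a (I.symm c) r ↔ BdLE (I a) c r := by
  rw [← I.bdLE_iff, apply_symm_apply]

end HBIso

section Rigidity

open AffineMap (lineMap)

variable {n : ℕ} {U V : Set (Euc n)} {a b : HausdorffBoundary U} {r : ℝ}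

theorem exists_limit_point {S : Set (Euc n)} {δ R : ℝ} (hδ : 0 < δ) (o : Euc n)
    (Q : Euc n → ℝ → Prop) (hQ : ∀ v r s, r ≤ s → Q v r → Q v s)
    (h : ∀ η > 0, ∃ v, Metric.ball v δ ⊆ S ∧ dist v o ≤ R ∧ Q v η) :
    ∃ v ∈ S, ∀ ε > 0, ∃ v', IntLE S v v' ε ∧ Q v' ε := by
  have hpos : ∀ k : ℕ, (0:ℝ) < 1 / ((k:ℝ) + 1) := fun k => by positivity
  choose v hv1 hv2 hv3 using fun k : ℕ => h (1 / ((k:ℝ) + 1)) (hpos k)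
  obtain ⟨w, -, φ, hφ, hlim⟩ := (isCompact_closedBall o R).tendsto_subseq (x := v)
    (fun k => hv2 k)
  have hev : ∀ ε > 0, ∀ᶠ k in atTop, dist w (v (φ k)) < ε := by
    intro ε hε
    filter_upwards [hlim.eventually (Metric.ball_mem_nhds _ hε)] with k hk
    rw [dist_comm]
    exact hk
  have hmem : w ∈ S := by
    obtain ⟨k, hk⟩ := (hev δ hδ).exists
    exact hv1 (φ k) hk
  refine ⟨w, hmem, fun ε hε => ?_⟩
  have h0 : Tendsto (fun k : ℕ => 1 / ((φ k : ℝ) + 1)) atTop (nhds 0) :=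
    tendsto_one_div_add_atTop_nhds_zero_nat.comp hφ.tendsto_atTop
  obtain ⟨k, h1, h2, h3⟩ := ((hev δ hδ).and ((hev ε hε).and (h0.eventually_lt_const hε))).exists
  refine ⟨v (φ k), ?_, hQ _ _ _ h3.le (hv3 _)⟩
  refine (IntLE.symm (intLE_of_mem_ball (hv1 (φ k)) h1)).mono ?_
  rw [dist_comm]
  exact h2.le

theorem sub_eq_sub_of_dist_le {x y z : Euc n} {h : ℝ} (hxy : dist x y ≤ h) (hyz : dist y z ≤ h)
    (hxz : 2 * h ≤ dist x z) : y - x = z - y := by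
  have h0 : 0 ≤ h := dist_nonneg.trans hxy
  rw [dist_comm, dist_eq_norm] at hxy hyz hxz
  have hp := parallelogram_law_with_norm ℝ (z - y) (y - x)
  rw [sub_add_sub_cancel] at hp
  have e1 : ‖z - y - (y - x)‖ * ‖z - y - (y - x)‖ ≤ 0 := by
    nlinarith [norm_nonneg (z - y), norm_nonneg (y - x), norm_nonneg (z - x)]
  have e2 : ‖z - y - (y - x)‖ = 0 := by nlinarith [norm_nonneg (z - y - (y - x))]
  exact (sub_eq_zero.1 (norm_eq_zero.1 e2)).symm

theorem Sees.exists_clearance (I : HBIso U V) (h : Sees a b) {ε : ℝ} (hε : 0 < ε) :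
    ∃ δ > 0, ∀ t, ε ≤ t → t ≤ dist (hbSupport a) (hbSupport b) - ε → ∀ w ∈ V,
      PtLE w (I a) (t + δ) → PtLE w (I b) (dist (hbSupport a) (hbSupport b) - t + δ) →
      Metric.ball w δ ⊆ V := by
  set L := dist (hbSupport a) (hbSupport b) with hL
  have hLpos : 0 < L := dist_pos.2 h.ne
  set C : Set (Euc n) := (fun t : ℝ => lineMap (hbSupport a) (hbSupport b) t) ''
    Icc (ε / L) (1 - ε / L)
  have hC : IsCompact C := isCompact_Icc.image AffineMap.lineMap_continuous
  have hεL : 0 < ε / L := by positivity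
  have hCU : C ⊆ U := by
    rintro _ ⟨t, ⟨h0, h1⟩, rfl⟩
    exact h.mem _ (lineMap_mem_openSeg (by linarith) (by linarith))
  obtain ⟨κ, hκ, hsub⟩ := hC.exists_thickening_subset_open I.isOpen_left hCU
  set σ := min L (κ ^ 2 / (4 * L)) with hσ
  have hσpos : 0 < σ := lt_min hLpos (by positivity)
  have hσ1 : σ ≤ L := min_le_left _ _
  have hσ2 : σ * (4 * L) ≤ κ ^ 2 := by
    rw [← le_div_iff₀ (by positivity)]; exact min_le_right _ _
  refine ⟨σ / 2, by positivity, fun t ht1 ht2 w hw hwa hwb => ?_⟩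
  obtain ⟨c, hc1, hc2⟩ := exists_nearest_elem I.isOpen_right I.ne_univ_right hw
  by_contra hcon
  have hd : dist w (hbSupport c) < σ / 2 := by
    by_contra hd
    exact hcon ((Metric.ball_subset_ball (not_lt.1 hd)).trans hc2)
  have h1 : dist (hbSupport a) (hbSupport (I.symm c)) ≤ t + σ :=
    ((I.bdLE_symm_iff.2 (hwa.add_pt hc1)).mono (by linarith)).dist_le
  have h2 : dist (hbSupport b) (hbSupport (I.symm c)) ≤ L - t + σ :=
    ((I.bdLE_symm_iff.2 (hwb.add_pt hc1)).mono (by linarith)).dist_le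
  have hst := dist_sq_lineMap (x := hbSupport a) (y := hbSupport b) (hbSupport (I.symm c)) (t / L)
  rw [← hL] at hst
  rw [dist_comm] at h1 h2
  set s := t / L with hs
  have htL : t = s * L := by rw [hs]; field_simp
  have hs0 : ε / L ≤ s := by rw [hs]; gcongr
  have hs1 : s ≤ 1 - ε / L := by
    rw [hs, div_le_iff₀ hLpos, sub_mul, div_mul_cancel₀ _ hLpos.ne']; linarith
  rw [htL] at h1 h2
  have h1' : dist (hbSupport (I.symm c)) (hbSupport a) ^ 2 ≤ (s * L + σ) ^ 2 := by gcongr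
  have h2' : dist (hbSupport (I.symm c)) (hbSupport b) ^ 2 ≤ (L - s * L + σ) ^ 2 := by gcongr
  have hlt : dist (hbSupport (I.symm c)) (lineMap (hbSupport a) (hbSupport b) s) ^ 2 < κ ^ 2 := by
    rw [hst]
    have e1 : (1 - s) * dist (hbSupport (I.symm c)) (hbSupport a) ^ 2 ≤ (1 - s) * (s * L + σ) ^ 2 :=
      mul_le_mul_of_nonneg_left h1' (by linarith)
    have e2 : s * dist (hbSupport (I.symm c)) (hbSupport b) ^ 2 ≤ s * (L - s * L + σ) ^ 2 :=
      mul_le_mul_of_nonneg_left h2' (by linarith)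
    have e3 : 4 * (s * (1 - s)) * (L * σ) ≤ 1 * (L * σ) := by
      gcongr
      nlinarith [sq_nonneg (2 * s - 1)]
    nlinarith [mul_le_mul_of_nonneg_left hσ1 hσpos.le, mul_pos hLpos hσpos]
  refine hbSupport_notMem I.isOpen_left (I.symm c) (hsub ?_)
  rw [Metric.mem_thickening_iff]
  exact ⟨_, ⟨s, ⟨hs0, hs1⟩, rfl⟩, lt_of_pow_lt_pow_left₀ 2 hκ.le hlt⟩

/-- `w` lies at distance `t` from `a` and `L - t` from `b`. -/
def IsBetween {S : Set (Euc n)} (a b : HausdorffBoundary S) (L t : ℝ) (w : Euc n) : Prop :=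
  w ∈ S ∧ PtLE w a t ∧ PtLE w b (L - t)

theorem Sees.exists_isBetween (I : HBIso U V) (h : Sees a b) {ε t : ℝ} (hε : 0 < ε)
    (ht : ε ≤ t) (htL : t ≤ dist (hbSupport a) (hbSupport b) - ε) :
    ∃ w, IsBetween (I a) (I b) (dist (hbSupport a) (hbSupport b)) t w := by
  obtain ⟨δ, hδ, hcl⟩ := h.exists_clearance I hε
  set L := dist (hbSupport a) (hbSupport b)
  obtain ⟨v, hv, hlim⟩ := exists_limit_point (S := V) (R := t + δ) hδ (hbSupport (I a))
    (fun v η => PtLE v (I a) (t + η) ∧ PtLE v (I b) (L - t + η))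
    (fun v r s hrs hv => ⟨hv.1.mono (by linarith), hv.2.mono (by linarith)⟩) (fun η hη => by
      obtain ⟨v, hv, h1, h2⟩ := (I.bdLE_iff.2 h.bdLE).split I.isOpen_right (t := t)
        (η := min η δ) (by linarith) (by linarith) (lt_min hη hδ)
      have m1 := min_le_left η δ
      have m2 := min_le_right η δ
      refine ⟨v, hcl t ht htL v hv (h1.mono (by linarith)) (h2.mono (by linarith)),
        (h1.mono (by linarith)).dist_le, h1.mono (by linarith), h2.mono (by linarith)⟩)
  refine ⟨v, hv, PtLE.of_forall_pos fun η hη => ?_, PtLE.of_forall_pos fun η hη => ?_⟩ <;>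
    obtain ⟨v', h1, h2, h3⟩ := hlim (η / 2) (by positivity)
  · exact (h1.trans_pt h2).mono (by linarith)
  · exact (h1.trans_pt h3).mono (by linarith)

theorem Sees.extend_isBetween (I : HBIso U V) (h : Sees a b) {ε t u : ℝ} {w : Euc n} (hε : 0 < ε)
    (ht : ε ≤ t) (htu : t ≤ u) (huL : u ≤ dist (hbSupport a) (hbSupport b) - ε)
    (hw : IsBetween (I a) (I b) (dist (hbSupport a) (hbSupport b)) t w) :
    ∃ v, IsBetween (I a) (I b) (dist (hbSupport a) (hbSupport b)) u v ∧ IntLE V w v (u - t) := by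
  obtain ⟨δ, hδ, hcl⟩ := h.exists_clearance I hε
  set L := dist (hbSupport a) (hbSupport b)
  obtain ⟨v, hv, hlim⟩ := exists_limit_point (S := V) (R := u - t) hδ w
    (fun v η => IntLE V w v (u - t) ∧ PtLE v (I b) (L - u + η))
    (fun v r s hrs hv => ⟨hv.1, hv.2.mono (by linarith)⟩) (fun η hη => by
      obtain ⟨v, hv, h1, h2⟩ := hw.2.2.split I.isOpen_right hw.1 (t := u - t)
        (η := min η δ) (by linarith) (by linarith) (lt_min hη hδ)
      have m1 := min_le_left η δ
      have m2 := min_le_right η δ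
      have h3 := h1.symm.trans_pt hw.2.1
      refine ⟨v, hcl u (by linarith) huL v hv (h3.mono (by linarith)) (h2.mono (by linarith)),
        h1.symm.dist_le, h1, h2.mono (by linarith)⟩)
  have hint : IntLE V w v (u - t) := IntLE.of_forall_pos fun η hη => by
    obtain ⟨v', h1, h2, h3⟩ := hlim η hη
    exact (h2.trans h1.symm)
  refine ⟨v, ⟨hv, ?_, PtLE.of_forall_pos fun η hη => ?_⟩, hint⟩
  · exact (hint.symm.trans_pt hw.2.1).mono (by linarith)
  · obtain ⟨v', h1, h2, h3⟩ := hlim (η / 2) (by positivity)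
    exact (h1.trans_pt h3).mono (by linarith)

theorem exists_seq_of_step {α : Type*} (P : ℕ → α → Prop) (R : ℕ → α → α → Prop) {x₀ : α}
    (h0 : P 0 x₀) (hstep : ∀ k x, P k x → ∃ y, P (k + 1) y ∧ R k x y) :
    ∃ x : ℕ → α, (∀ k, P k (x k)) ∧ ∀ k, R k (x k) (x (k + 1)) := by
  choose g hg1 hg2 using hstep
  let f : (k : ℕ) → {x // P k x} := fun k =>
    Nat.rec ⟨x₀, h0⟩ (fun k x => ⟨g k x.1 x.2, hg1 k x.1 x.2⟩) k
  exact ⟨fun k => (f k).1, fun k => (f k).2, fun k => hg2 k (f k).1 (f k).2⟩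

theorem Sees.dist_map_ge (I : HBIso U V) (h : Sees a b) {ε : ℝ} (hε : 0 < ε)
    (hεL : 2 * ε < dist (hbSupport a) (hbSupport b)) :
    dist (hbSupport a) (hbSupport b) - 4 * ε ≤ dist (hbSupport (I a)) (hbSupport (I b)) := by
  obtain ⟨δ, hδ, hcl⟩ := h.exists_clearance I hε
  set L := dist (hbSupport a) (hbSupport b) with hL
  obtain ⟨N, hN⟩ := exists_nat_gt ((L - 2 * ε) / δ)
  set M : ℝ := (N : ℝ) + 1
  have hM : 0 < M := by positivity
  set s := (L - 2 * ε) / M with hs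
  have hspos : 0 < s := div_pos (by linarith) hM
  have hsδ : s < δ := by
    rw [hs, div_lt_iff₀ hM]
    rw [div_lt_iff₀ hδ] at hN
    simp only [M]
    nlinarith
  have hsM : M * s = L - 2 * ε := by rw [hs]; field_simp
  obtain ⟨w₀, hw₀⟩ := h.exists_isBetween I hε (t := ε) le_rfl (by linarith)
  obtain ⟨w, hw, hstep⟩ := exists_seq_of_step
    (fun k w => (k : ℝ) ≤ M → IsBetween (I a) (I b) L (ε + k * s) w)
    (fun k w v => (k : ℝ) + 1 ≤ M → IntLE V w v s) (x₀ := w₀) (by simpa using fun _ => hw₀) (by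
      intro k w hw
      by_cases hk : (k : ℝ) + 1 ≤ M
      · obtain ⟨v, hv1, hv2⟩ := h.extend_isBetween I hε (t := ε + k * s) (u := ε + (k + 1 : ℕ) * s)
          (by have : 0 ≤ (k : ℝ) * s := by positivity
              linarith)
          (by push_cast; nlinarith)
          (by push_cast; nlinarith) (hw (by linarith))
        refine ⟨v, fun _ => hv1, fun _ => ?_⟩
        convert hv2 using 1
        push_cast; ring
      · exact ⟨w, fun hk' => absurd (by push_cast at hk'; exact hk') hk, fun hk' => absurd hk' hk⟩)
  have hmid : ∀ k : ℕ, (k : ℝ) + 2 ≤ M → w (k + 1) - w k = w (k + 2) - w (k + 1) ∧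
      s ≤ dist (w k) (w (k + 1)) := by
    intro k hk
    have h1 := hstep k (by linarith)
    have h2 := hstep (k + 1) (by push_cast; linarith)
    have b0 := hw k (by linarith)
    have b1 := hw (k + 1) (by push_cast; linarith)
    have b2 := hw (k + 2) (by push_cast; linarith)
    have hball : Metric.ball (w (k + 1)) δ ⊆ V := by
      refine hcl (ε + (k + 1 : ℕ) * s) ?_ ?_ _ b1.1 (b1.2.1.mono (by linarith))
        (b1.2.2.mono (by linarith))
      · have : 0 ≤ ((k + 1 : ℕ) : ℝ) * s := by positivity
        linarith
      · push_cast
        nlinarith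
    have i := IntLE.of_segment (((convex_ball _ _).segment_subset
      (show w k ∈ Metric.ball (w (k + 1)) δ from h1.dist_le.trans_lt hsδ)
      (show w (k + 2) ∈ Metric.ball (w (k + 1)) δ from h2.symm.dist_le.trans_lt hsδ)).trans hball)
    have hlow := (I.bdLE_iff.1 ((i.symm.trans_pt b0.2.1).add_pt b2.2.2)).dist_le
    rw [← hL] at hlow
    push_cast at hlow
    have hlow' : 2 * s ≤ dist (w k) (w (k + 2)) := by linarith
    refine ⟨sub_eq_sub_of_dist_le h1.dist_le h2.dist_le hlow', ?_⟩
    have := dist_triangle (w k) (w (k + 1)) (w (k + 2))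
    have := h2.dist_le
    linarith
  have hlin : ∀ k : ℕ, (k : ℝ) + 1 ≤ M → w (k + 1) - w k = w 1 - w 0 := by
    intro k
    induction k with
    | zero => simp
    | succ k ih =>
      intro hk
      push_cast at hk
      rw [← ih (by linarith), (hmid k (by linarith)).1]
  have hlin' : ∀ k : ℕ, (k : ℝ) ≤ M → w k - w 0 = (k : ℝ) • (w 1 - w 0) := by
    intro k
    induction k with
    | zero => simp
    | succ k ih =>
      intro hk
      push_cast at hk ⊢
      rw [add_smul, one_smul, ← ih (by linarith), ← hlin k hk]
      abel
  have hend := hlin' (N + 1) (by push_cast; exact le_rfl)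
  have hs01 : s ≤ dist (w 0) (w 1) ∨ N = 0 := by
    rcases Nat.eq_zero_or_pos N with h0 | h0
    · exact Or.inr h0
    · left
      refine (hmid 0 ?_).2
      have : (1 : ℝ) ≤ N := by exact_mod_cast h0
      simp only [M]
      push_cast
      linarith
  have b0 := hw 0 (by simpa using hM.le)
  have bN := hw (N + 1) (by push_cast; exact le_rfl)
  have hd : M * s ≤ dist (w 0) (w (N + 1)) := by
    rcases hs01 with h1 | h1
    · rw [dist_comm, dist_eq_norm, hend, norm_smul, ← dist_eq_norm, dist_comm, Real.norm_eq_abs,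
        abs_of_nonneg (by positivity)]
      push_cast
      gcongr
    · subst h1
      have i := (hstep 0 (by simp [M]))
      have hball : Metric.ball (w 0) δ ⊆ V := by
        refine hcl (ε + (0 : ℕ) * s) (by simp) ?_ _ b0.1 (b0.2.1.mono (by linarith))
          (b0.2.2.mono (by linarith))
        push_cast
        linarith
      have i2 := intLE_of_mem_ball hball (show w 1 ∈ Metric.ball (w 0) δ from
        i.symm.dist_le.trans_lt hsδ)
      have hlow := (I.bdLE_iff.1 ((i2.symm.trans_pt b0.2.1).add_pt bN.2.2)).dist_le
      rw [← hL] at hlow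
      push_cast at hlow
      simp only [zero_add, zero_mul, add_zero, one_mul, M, Nat.cast_zero] at *
      linarith
  have d0 := b0.2.1.dist_le
  have dN := bN.2.2.dist_le
  have t1 := dist_triangle (w 0) (hbSupport (I a)) (w (N + 1))
  have t2 := dist_triangle (hbSupport (I a)) (hbSupport (I b)) (w (N + 1))
  rw [dist_comm (hbSupport (I b))] at t2
  push_cast at d0 dN
  simp only [M] at hsM hd
  linarith

/-- Isometries preserve the Euclidean distance of elements that see each other. -/
theorem Sees.dist_map (I : HBIso U V) (h : Sees a b) :
    dist (hbSupport (I a)) (hbSupport (I b)) = dist (hbSupport a) (hbSupport b) := by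
  refine le_antisymm (I.bdLE_iff.2 h.bdLE).dist_le ?_
  have hL : 0 < dist (hbSupport a) (hbSupport b) := dist_pos.2 h.ne
  refine le_of_forall_pos_le_add fun ε hε => ?_
  have h1 := min_le_left (ε / 4) (dist (hbSupport a) (hbSupport b) / 4)
  have h2 := min_le_right (ε / 4) (dist (hbSupport a) (hbSupport b) / 4)
  have := h.dist_map_ge I (ε := min (ε / 4) (dist (hbSupport a) (hbSupport b) / 4))
    (lt_min (by positivity) (by positivity)) (by linarith)
  linarith

/-- Isometries preserve visibility. -/
theorem Sees.map (I : HBIso U V) (h : Sees a b) : Sees (I a) (I b) := by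
  have hd := h.dist_map I
  have hL : 0 < dist (hbSupport a) (hbSupport b) := dist_pos.2 h.ne
  refine Sees.of_bdLE I.isOpen_right ?_ ?_ (hd ▸ I.bdLE_iff.2 h.bdLE)
  · rw [← dist_pos, hd]
    exact hL
  · rw [openSegment_eq_image_lineMap]
    rintro _ ⟨t, ⟨ht0, ht1⟩, rfl⟩
    set L := dist (hbSupport a) (hbSupport b)
    have hm1 := min_le_left (t * L) ((1 - t) * L)
    have hm2 := min_le_right (t * L) ((1 - t) * L)
    obtain ⟨w, hw, h1, h2⟩ := h.exists_isBetween I (ε := min (t * L) ((1 - t) * L)) (t := t * L)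
      (lt_min (by positivity) (mul_pos (by linarith) hL)) hm1 (by simp only [L] at *; linarith)
    have hst := dist_sq_lineMap (x := hbSupport (I a)) (y := hbSupport (I b)) w t
    rw [hd] at hst
    have h1' : dist w (hbSupport (I a)) ^ 2 ≤ (t * L) ^ 2 := by gcongr; exact h1.dist_le
    have h2' : dist w (hbSupport (I b)) ^ 2 ≤ (L - t * L) ^ 2 := by gcongr; exact h2.dist_le
    have e1 := mul_le_mul_of_nonneg_left h1' (show 0 ≤ 1 - t by linarith)
    have e2 := mul_le_mul_of_nonneg_left h2' ht0.le
    have e3 : dist w (lineMap (hbSupport (I a)) (hbSupport (I b)) t) ^ 2 ≤ 0 := by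
      rw [hst]
      nlinarith
    have e4 : dist w (lineMap (hbSupport (I a)) (hbSupport (I b)) t) = 0 := by
      nlinarith [sq_nonneg (dist w (lineMap (hbSupport (I a)) (hbSupport (I b)) t))]
    rw [dist_eq_zero] at e4
    rw [← e4]
    exact hw

end Rigidity

/-! ### Orthonormal frames of the plane -/

open InnerProductGeometry (angle)

/-- An orthonormal frame of the Euclidean plane, of either orientation. -/
structure OFrame where
  u : Euc 2
  v : Euc 2
  norm_u : inner ℝ u u = 1
  norm_v : inner ℝ v v = 1
  orth : inner ℝ u v = 0

/-- The planar cross product. -/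
def cross (x y : Euc 2) : ℝ := x 0 * y 1 - x 1 * y 0

theorem inner_eq_coord (x y : Euc 2) : inner ℝ x y = x 0 * y 0 + x 1 * y 1 := by
  simp [PiLp.inner_apply, Fin.sum_univ_two]
  ring

namespace OFrame

variable (B : OFrame)

/-- The unit vector at polar angle `φ`. -/
def dir (φ : ℝ) : Euc 2 := Real.cos φ • B.u + Real.sin φ • B.v

theorem eq_add (d : Euc 2) : d = inner ℝ B.u d • B.u + inner ℝ B.v d • B.v := by
  have h1 := B.norm_u
  have h2 := B.norm_v
  have h3 := B.orth
  simp only [inner_eq_coord] at *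
  set a := B.u 0
  set b := B.u 1
  set c := B.v 0
  set e := B.v 1
  have hc : c = -b * (a * e - b * c) := by linear_combination (-c) * h1 + a * h3
  have he : e = a * (a * e - b * c) := by linear_combination (-e) * h1 + b * h3
  have hD : (a * e - b * c) ^ 2 = 1 := by
    linear_combination h2 + (c ^ 2 + e ^ 2) * h1 - (a * c + b * e) * h3
  set D := a * e - b * c
  have k1 : a ^ 2 + c ^ 2 = 1 := by rw [hc]; linear_combination h1 + b ^ 2 * hD
  have k2 : b ^ 2 + e ^ 2 = 1 := by rw [he]; linear_combination h1 + a ^ 2 * hD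
  have k3 : a * b + c * e = 0 := by rw [hc, he]; linear_combination (-a * b) * hD
  ext i
  fin_cases i
  · simp only [Fin.zero_eta, PiLp.add_apply, PiLp.smul_apply, smul_eq_mul]
    change d 0 = (a * d 0 + b * d 1) * a + (c * d 0 + e * d 1) * c
    linear_combination (-d 0) * k1 - d 1 * k3
  · simp only [Fin.mk_one, PiLp.add_apply, PiLp.smul_apply, smul_eq_mul]
    change d 1 = (a * d 0 + b * d 1) * b + (c * d 0 + e * d 1) * e
    linear_combination (-d 1) * k2 - d 0 * k3

theorem inner_comb (a b c d : ℝ) :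
    inner ℝ (a • B.u + b • B.v) (c • B.u + d • B.v) = a * c + b * d := by
  simp only [inner_add_left, inner_add_right, inner_smul_left, inner_smul_right, conj_trivial,
    B.norm_u, B.norm_v, B.orth, real_inner_comm B.u B.v]
  ring

@[simp] theorem inner_dir (φ ψ : ℝ) : inner ℝ (B.dir φ) (B.dir ψ) = Real.cos (φ - ψ) := by
  rw [dir, dir, inner_comb, Real.cos_sub]

@[simp] theorem norm_dir (φ : ℝ) : ‖B.dir φ‖ = 1 := by
  have := B.inner_dir φ φ
  rw [sub_self, Real.cos_zero, real_inner_self_eq_norm_sq] at this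
  nlinarith [norm_nonneg (B.dir φ)]

theorem dir_ne_zero (φ : ℝ) : B.dir φ ≠ 0 := by
  rw [← norm_ne_zero_iff, norm_dir]; norm_num

theorem norm_smul_dir {r : ℝ} (hr : 0 ≤ r) (φ : ℝ) : ‖r • B.dir φ‖ = r := by
  rw [norm_smul, norm_dir, mul_one, Real.norm_of_nonneg hr]

theorem angle_dir {a b : ℝ} (h : |a - b| ≤ Real.pi) : angle (B.dir a) (B.dir b) = |a - b| := by
  rw [InnerProductGeometry.angle, norm_dir, norm_dir, inner_dir, mul_one, div_one, ← Real.cos_abs,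
    Real.arccos_cos (abs_nonneg _) h]

theorem angle_smul_dir {a b r s : ℝ} (hr : 0 < r) (hs : 0 < s) (h : |a - b| ≤ Real.pi) :
    angle (r • B.dir a) (s • B.dir b) = |a - b| := by
  rw [InnerProductGeometry.angle_smul_left_of_pos _ _ hr,
    InnerProductGeometry.angle_smul_right_of_pos _ _ hs, angle_dir B h]

theorem ext_inner {d e : Euc 2} (h1 : inner ℝ B.u d = inner ℝ B.u e)
    (h2 : inner ℝ B.v d = inner ℝ B.v e) : d = e := by
  rw [B.eq_add d, B.eq_add e, h1, h2]

/-- Polar coordinates. -/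
theorem exists_polar (d : Euc 2) : ∃ φ, -Real.pi < φ ∧ φ ≤ Real.pi ∧ d = ‖d‖ • B.dir φ := by
  set z : ℂ := ⟨inner ℝ B.u d, inner ℝ B.v d⟩
  have hz : ‖z‖ = ‖d‖ := by
    have h1 : ‖d‖ ^ 2 = ‖z‖ ^ 2 := by
      rw [← real_inner_self_eq_norm_sq, B.eq_add d, inner_comb, Complex.sq_norm, Complex.normSq_mk]
    exact ((pow_left_inj₀ (norm_nonneg _) (norm_nonneg _) two_ne_zero).1 h1).symm
  refine ⟨z.arg, Complex.neg_pi_lt_arg z, Complex.arg_le_pi z, ?_⟩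
  rw [dir, smul_add, smul_smul, smul_smul, ← hz, Complex.norm_mul_cos_arg, Complex.norm_mul_sin_arg]
  exact B.eq_add d

/-- The frame with the opposite orientation and the same first vector. -/
def flip : OFrame := ⟨B.u, -B.v, B.norm_u, by rw [inner_neg_neg, B.norm_v], by simp [B.orth]⟩

theorem flip_dir (φ : ℝ) : B.flip.dir φ = B.dir (-φ) := by
  simp [dir, flip]

/-- The frame rotated by `c`. -/
def rot (c : ℝ) : OFrame := ⟨B.dir c, B.dir (c + Real.pi / 2), by simp, by simp, by
  rw [inner_dir]; simp⟩

theorem rot_dir (c φ : ℝ) : (B.rot c).dir φ = B.dir (c + φ) := by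
  simp only [dir, rot, Real.cos_add, Real.sin_add, Real.cos_pi_div_two, Real.sin_pi_div_two]
  module

theorem exists_of_ne_zero {X : Euc 2} (hX : X ≠ 0) : ∃ B : OFrame, X = ‖X‖ • B.dir 0 := by
  have hn : 0 < ‖X‖ := norm_pos_iff.2 hX
  have h1 : X 0 * X 0 + X 1 * X 1 = ‖X‖ ^ 2 := by
    rw [← inner_eq_coord, real_inner_self_eq_norm_sq]
  refine ⟨⟨‖X‖⁻¹ • X, ‖X‖⁻¹ • !₂[-X 1, X 0], ?_, ?_, ?_⟩, ?_⟩
  · rw [inner_smul_left, inner_smul_right, real_inner_self_eq_norm_sq]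
    simp; field_simp
  · rw [inner_smul_left, inner_smul_right, inner_eq_coord]
    simp
    field_simp
    linarith
  · rw [inner_smul_left, inner_smul_right, inner_eq_coord]
    simp
    ring_nf; simp
  · simp [dir, smul_smul, hn.ne']

theorem angle_eq_abs {r s a b : ℝ} (hr : 0 < r) (hs : 0 < s) (ha : -Real.pi ≤ a - b)
    (hb : a - b ≤ Real.pi) : angle (r • B.dir a) (s • B.dir b) = |a - b| :=
  B.angle_smul_dir hr hs (abs_le.2 ⟨ha, hb⟩)

/-- A frame adapted to an ordered pair of vectors. -/
theorem exists_adapted {X Z : Euc 2} (hX : X ≠ 0) (hZ : Z ≠ 0) :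
    ∃ B : OFrame, X = ‖X‖ • B.dir 0 ∧ Z = ‖Z‖ • B.dir (angle X Z) := by
  obtain ⟨B, hB⟩ := exists_of_ne_zero hX
  obtain ⟨φ, h1, h2, hφ⟩ := B.exists_polar Z
  have hXn : 0 < ‖X‖ := norm_pos_iff.2 hX
  have hZn : 0 < ‖Z‖ := norm_pos_iff.2 hZ
  have ha : angle X Z = |0 - φ| := by
    have := B.angle_eq_abs (a := 0) (b := φ) hXn hZn (by linarith) (by linarith)
    rwa [← hB, ← hφ] at this
  rw [zero_sub, abs_neg] at ha
  rcases le_total 0 φ with h | h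
  · exact ⟨B, hB, by rw [ha, abs_of_nonneg h]; exact hφ⟩
  · refine ⟨B.flip, by rw [flip_dir, neg_zero]; exact hB, ?_⟩
    rw [ha, abs_of_nonpos h, flip_dir, neg_neg]
    exact hφ

end OFrame

theorem cross_smul_left (r : ℝ) (x y : Euc 2) : cross (r • x) y = r * cross x y := by
  simp [cross]; ring

theorem cross_smul_right (r : ℝ) (x y : Euc 2) : cross x (r • y) = r * cross x y := by
  simp [cross]; ring

theorem cross_add_left (x y z : Euc 2) : cross (x + y) z = cross x z + cross y z := by
  simp [cross]; ring

theorem cross_add_right (x y z : Euc 2) : cross x (y + z) = cross x y + cross x z := by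
  simp [cross]; ring

@[simp] theorem cross_self_eq (x : Euc 2) : cross x x = 0 := by
  simp [cross]; ring

theorem cross_swap (x y : Euc 2) : cross y x = -cross x y := by
  simp [cross]; ring

theorem cross_sq (x y : Euc 2) : cross x y ^ 2 = ‖x‖ ^ 2 * ‖y‖ ^ 2 - inner ℝ x y ^ 2 := by
  rw [← real_inner_self_eq_norm_sq, ← real_inner_self_eq_norm_sq]
  simp only [inner_eq_coord, cross]; ring

theorem abs_cross_le (x y : Euc 2) : |cross x y| ≤ ‖x‖ * ‖y‖ := by
  refine abs_le_of_sq_le_sq ?_ (by positivity)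
  rw [cross_sq]
  nlinarith [sq_nonneg (inner ℝ x y)]

/-- Cramer's rule. -/
theorem exists_coords {X Z : Euc 2} (h : cross X Z ≠ 0) (d : Euc 2) :
    d = (cross d Z / cross X Z) • X + (cross X d / cross X Z) • Z := by
  have : cross X Z • d = cross d Z • X + cross X d • Z := by
    ext i
    fin_cases i <;> simp [cross] <;> ring
  rw [div_eq_inv_mul, div_eq_inv_mul, ← smul_smul, ← smul_smul, ← smul_add, ← this, smul_smul,
    inv_mul_cancel₀ h, one_smul]

/-! ### Boundary angles in terms of elements of the Hausdorff boundary -/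

section Wedge

variable {n : ℕ} {S : Set (Euc n)} {a b e y : HausdorffBoundary S} {X W : Euc n}

/-- The position of the support of `e` relative to the support of `y`. -/
def rel (y e : HausdorffBoundary S) : Euc n := hbSupport e - hbSupport y

theorem add_rel (y e : HausdorffBoundary S) : hbSupport y + rel y e = hbSupport e := by
  simp [rel]

theorem Sees.rel_ne_zero (h : Sees y e) : rel y e ≠ 0 := sub_ne_zero.2 h.ne.symm

theorem Sees.norm_rel_pos (h : Sees y e) : 0 < ‖rel y e‖ := norm_pos_iff.2 h.rel_ne_zero

theorem norm_rel (y e : HausdorffBoundary S) : ‖rel y e‖ = dist (hbSupport y) (hbSupport e) := by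
  rw [rel, dist_comm, dist_eq_norm]

theorem Sees.norm_rel_map {U V : Set (Euc n)} {y e : HausdorffBoundary U} (I : HBIso U V)
    (h : Sees y e) : ‖rel (I y) (I e)‖ = ‖rel y e‖ := by
  rw [norm_rel, norm_rel, h.dist_map I]

theorem Sees.smul_mem (h : Sees y e) {t : ℝ} (h0 : 0 < t) (h1 : t < 1) :
    hbSupport y + t • rel y e ∈ S := by
  have := h.mem _ (lineMap_mem_openSeg h0 h1)
  rwa [AffineMap.lineMap_apply, vsub_eq_sub, vadd_eq_add, add_comm] at this

theorem Sees.smul_ptLE_left (h : Sees y e) {t : ℝ} (h0 : 0 < t) (h1 : t < 1) :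
    PtLE (hbSupport y + t • rel y e) y (t * ‖rel y e‖) := by
  have := h.left _ (lineMap_mem_openSeg h0 h1)
  rw [dist_lineMap_left, Real.norm_of_nonneg h0.le, ← norm_rel] at this
  rwa [AffineMap.lineMap_apply, vsub_eq_sub, vadd_eq_add, add_comm] at this

theorem Sees.smul_ptLE_right (h : Sees y e) {t : ℝ} (h0 : 0 < t) (h1 : t < 1) :
    PtLE (hbSupport y + t • rel y e) e ((1 - t) * ‖rel y e‖) := by
  have := h.right _ (lineMap_mem_openSeg h0 h1)
  rw [dist_lineMap_right, Real.norm_of_nonneg (sub_nonneg.2 h1.le), ← norm_rel] at this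
  rwa [AffineMap.lineMap_apply, vsub_eq_sub, vadd_eq_add, add_comm] at this

/-- The wedge at `o` spanned by `X` and `W` is contained in `S` near `o`, except possibly for `o`
itself. -/
def Free (S : Set (Euc n)) (o X W : Euc n) : Prop :=
  ∃ R > 0, ∀ s t : ℝ, 0 ≤ s → 0 ≤ t → 0 < s + t → s + t < R → o + (s • X + t • W) ∈ S

theorem Free.symm {o : Euc n} (h : Free S o X W) : Free S o W X := by
  obtain ⟨R, hR, h⟩ := h
  exact ⟨R, hR, fun s t hs ht h0 h1 => by
    rw [add_comm (s • W)]; exact h t s ht hs (by linarith) (by linarith)⟩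

theorem Free.mono {o : Euc n} (h : Free S o X W) {a b c d : ℝ} (ha : 0 ≤ a) (hb : 0 ≤ b)
    (hc : 0 ≤ c) (hd : 0 ≤ d) (hab : 0 < a + b) (hcd : 0 < c + d) :
    Free S o (a • X + b • W) (c • X + d • W) := by
  obtain ⟨R, hR, h⟩ := h
  set M := a + b + (c + d)
  have hM : 0 < M := by positivity
  refine ⟨R / M, by positivity, fun s t hs ht h0 h1 => ?_⟩
  have h2 : s • (a • X + b • W) + t • (c • X + d • W) =
      (s * a + t * c) • X + (s * b + t * d) • W := by module
  rw [h2]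
  refine h _ _ (by positivity) (by positivity) ?_ ?_
  · have : s * a + t * c + (s * b + t * d) = s * (a + b) + t * (c + d) := by ring
    rw [this]
    rcases hs.eq_or_lt with h | h
    · rw [← h] at h0 ⊢
      have : 0 < t := by linarith
      positivity
    · positivity
  · rw [lt_div_iff₀ hM] at h1
    have h3 := mul_nonneg hs hcd.le
    have h4 := mul_nonneg ht hab.le
    simp only [M] at h1
    nlinarith

theorem segment_subset_of_smul {o v w : Euc n}
    (h : ∀ t : ℝ, 0 ≤ t → t ≤ 1 → o + ((1 - t) • v + t • w) ∈ S) :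
    segment ℝ (o + v) (o + w) ⊆ S := by
  rw [segment_eq_image_lineMap]
  rintro _ ⟨t, ⟨h0, h1⟩, rfl⟩
  convert h t h0 h1 using 1
  rw [AffineMap.lineMap_apply, vsub_eq_sub, vadd_eq_add]
  module

theorem wedge_ptLE (h : Sees y e) {R : ℝ}
    (hf : ∀ s t : ℝ, 0 ≤ s → 0 ≤ t → 0 < s + t → s + t < R →
      hbSupport y + (s • rel y e + t • W) ∈ S) {s t : ℝ} (hs : 0 ≤ s) (ht : 0 ≤ t)
    (h0 : 0 < s + t) (h1 : s + t < R) :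
    PtLE (hbSupport y + (s • rel y e + t • W)) y ‖s • rel y e + t • W‖ := by
  set X := rel y e
  set o := hbSupport y
  set v := s • X + t • W
  refine PtLE.of_forall_pos fun ε hε => ?_
  set C := ‖v - (s + t) • X‖ + (s + t) * ‖X‖ + (s + t) + 1
  have hC : 0 < C := by positivity
  obtain ⟨l, hl0, hl1⟩ : ∃ l : ℝ, 0 < l ∧ l < min 1 (min (1 / C) (ε / C)) :=
    exists_between (by positivity)
  have hla : l < 1 := hl1.trans_le (min_le_left _ _)
  have hlb : l * C < 1 := by
    rw [← lt_div_iff₀ hC]; exact hl1.trans_le ((min_le_right _ _).trans (min_le_left _ _))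
  have hlc : l * C < ε := by
    rw [← lt_div_iff₀ hC]; exact hl1.trans_le ((min_le_right _ _).trans (min_le_right _ _))
  have e1 : IntLE S (o + v) (o + l • v) (dist (o + v) (o + l • v)) := by
    refine IntLE.of_segment (segment_subset_of_smul fun r hr0 hr1 => ?_)
    have hk : 0 < 1 - r + r * l := by
      rcases hr1.eq_or_lt with h | h
      · rw [h]; linarith
      · have := mul_nonneg hr0 hl0.le; linarith
    have hk1 : 1 - r + r * l ≤ 1 := by nlinarith
    have : (1 - r) • v + r • l • v = ((1 - r + r * l) * s) • X + ((1 - r + r * l) * t) • W := by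
      simp only [v]; module
    rw [this]
    refine hf _ _ (by positivity) (by positivity) ?_ ?_
    · rw [← mul_add]; positivity
    · rw [← mul_add]; nlinarith
  have e2 : IntLE S (o + l • v) (o + (l * (s + t)) • X)
      (dist (o + l • v) (o + (l * (s + t)) • X)) := by
    refine IntLE.of_segment (segment_subset_of_smul fun r hr0 hr1 => ?_)
    have : (1 - r) • l • v + r • (l * (s + t)) • X =
      (l * (s + r * t)) • X + (l * ((1 - r) * t)) • W := by
      simp only [v]; module
    rw [this]
    have hr2 : 0 ≤ 1 - r := by linarith
    have : l * (s + r * t) + l * ((1 - r) * t) = l * (s + t) := by ring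
    refine hf _ _ (by positivity) (by positivity) ?_ ?_
    · rw [this]; positivity
    · rw [this]; nlinarith
  have hls : l * (s + t) < 1 := by
    refine lt_of_le_of_lt (mul_le_mul_of_nonneg_left ?_ hl0.le) hlb
    simp only [C]
    have := norm_nonneg (v - (s + t) • X)
    have : 0 ≤ (s + t) * ‖X‖ := by positivity
    linarith
  have e3 := h.smul_ptLE_left (t := l * (s + t)) (by positivity) hls
  refine (e1.trans_pt (e2.trans_pt e3)).mono ?_
  have d1 : dist (o + v) (o + l • v) ≤ ‖v‖ := by
    rw [dist_add_left, dist_eq_norm, show v - l • v = (1 - l) • v by module, norm_smul,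
      Real.norm_of_nonneg (by linarith)]
    nlinarith [norm_nonneg v]
  have d2 : dist (o + l • v) (o + (l * (s + t)) • X) = l * ‖v - (s + t) • X‖ := by
    rw [dist_add_left, dist_eq_norm,
      show l • v - (l * (s + t)) • X = l • (v - (s + t) • X) by module, norm_smul,
      Real.norm_of_nonneg hl0.le]
  rw [d2]
  simp only [C] at hlc
  have hlst : 0 < l * (s + t) := by positivity
  linarith

/-- From the apex of a free wedge one sees the first boundary point along each ray. -/
theorem sees_first_hit (hS : IsOpen S) (h : Sees y e) (hF : Free S (hbSupport y) (rel y e) W)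
    {s t : ℝ} (hs : 0 ≤ s) (ht : 0 ≤ t)
    (hq : hbSupport y + (s • rel y e + t • W) ∉ S) (hne : s • rel y e + t • W ≠ 0) :
    ∃ (g : HausdorffBoundary S) (τ : ℝ), 0 < τ ∧ τ ≤ 1 ∧
      rel y g = τ • (s • rel y e + t • W) ∧ Sees y g := by
  obtain ⟨R, hR, hf⟩ := hF
  set X := rel y e with hX
  set o := hbSupport y with ho
  set v := s • X + t • W with hv
  have h0 : 0 < s + t := by
    rcases (add_nonneg hs ht).eq_or_lt with h | h
    · have h1 : s = 0 := by linarith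
      have h2 : t = 0 := by linarith
      simp [hv, h1, h2] at hne
    · exact h
  obtain ⟨l, hl0, hl1⟩ : ∃ l : ℝ, 0 < l ∧ l < min 1 (R / (s + t)) :=
    exists_between (by positivity)
  have hla : l < 1 := hl1.trans_le (min_le_left _ _)
  have hlb : l * (s + t) < R := by
    rw [← lt_div_iff₀ h0]; exact hl1.trans_le (min_le_right _ _)
  have hfl : ∀ k, 0 < k → k ≤ l → o + k • v ∈ S := by
    intro k hk0 hkl
    have := hf (k * s) (k * t) (by positivity) (by positivity) (by rw [← mul_add]; positivity)
      (by rw [← mul_add]; nlinarith)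
    convert this using 2
    simp only [hv]; module
  have hp := wedge_ptLE h hf (s := l * s) (t := l * t) (by positivity) (by positivity)
    (by rw [← mul_add]; positivity) (by rw [← mul_add]; exact hlb)
  rw [← hX, ← ho, show (l * s) • X + (l * t) • W = l • v by simp only [hv]; module] at hp
  obtain ⟨r, g, hr0, hr1, hg, hpt⟩ := exists_first_hit_elem hS (hfl l hl0 le_rfl) hq
  have hlin : ∀ k : ℝ, (AffineMap.lineMap (o + l • v) (o + v) k : Euc n) =
      o + (l + k * (1 - l)) • v := by
    intro k
    rw [AffineMap.lineMap_apply, vsub_eq_sub, vadd_eq_add]; module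
  rw [hlin] at hg
  set τ := l + r * (1 - l) with hτ
  have hτ0 : 0 < τ := by have := mul_pos hr0 (sub_pos.2 hla); linarith
  have hrel : rel y g = τ • v := by rw [rel, hg, ← ho]; abel
  have hrn : o ≠ hbSupport g := by
    rw [hg]; intro h
    have : τ • v = 0 := by simpa using h
    rcases smul_eq_zero.1 this with h | h
    · exact hτ0.ne' h
    · exact hne h
  refine ⟨g, τ, hτ0, by nlinarith, hrel, ?_⟩
  refine Sees.of_bdLE hS hrn ?_ ?_
  · intro w hw
    rw [openSegment_eq_image_lineMap] at hw
    obtain ⟨k, ⟨hk0, hk1⟩, rfl⟩ := hw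
    have hw : (AffineMap.lineMap o (hbSupport g) k : Euc n) = o + (k * τ) • v := by
      rw [AffineMap.lineMap_apply, vsub_eq_sub, vadd_eq_add, hg]; module
    rw [← ho, hw]
    rcases le_total (k * τ) l with h | h
    · exact hfl _ (by positivity) h
    · have h1l : 0 < 1 - l := sub_pos.2 hla
      have := (hpt ((k * τ - l) / (1 - l)) (div_nonneg (by linarith) h1l.le) (by
        rw [div_lt_iff₀ h1l]; nlinarith)).1
      rw [hlin, div_mul_cancel₀ _ h1l.ne'] at this
      convert this using 3
      ring
  · have h2 := (hpt 0 le_rfl hr0).2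
    rw [AffineMap.lineMap_apply_zero] at h2
    have h3 := hp.add_pt h2
    convert h3 using 1
    rw [← norm_rel, hrel, dist_add_left, dist_eq_norm, show l • v - v = -((1 - l) • v) by module,
      norm_neg, norm_smul, norm_smul, norm_smul, Real.norm_of_nonneg hτ0.le,
      Real.norm_of_nonneg hl0.le, Real.norm_of_nonneg (by linarith), hτ]
    ring

end Wedge

section

variable {S : Set (Euc 2)} {x y z : HausdorffBoundary S}

/-- The elements `x`, `y`, `z` determine a boundary angle with vertex `y`. -/
structure BA (x y z : HausdorffBoundary S) : Prop where
  left : Sees y x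
  right : Sees y z
  indep : cross (rel y x) (rel y z) ≠ 0
  free : Free S (hbSupport y) (rel y x) (rel y z)

theorem BA.symm (h : BA x y z) : BA z y x :=
  ⟨h.right, h.left, by rw [cross_swap]; exact neg_ne_zero.2 h.indep, h.free.symm⟩

theorem comb_eq_zero_iff {X Z : Euc 2} (h : cross X Z ≠ 0) {s t : ℝ} :
    s • X + t • Z = 0 ↔ s = 0 ∧ t = 0 := by
  refine ⟨fun h0 => ?_, fun ⟨h1, h2⟩ => by simp [h1, h2]⟩
  have h1 : cross (s • X + t • Z) Z = 0 := by rw [h0]; simp [cross]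
  have h2 : cross X (s • X + t • Z) = 0 := by rw [h0]; simp [cross]
  rw [cross_add_left, cross_smul_left, cross_smul_left, cross_self_eq] at h1
  rw [cross_add_right, cross_smul_right, cross_smul_right, cross_self_eq] at h2
  constructor
  · simpa [h] using h1
  · simpa [h] using h2

theorem BA.exists_argmin (hS : IsOpen S) (h : BA x y z) {n : Euc 2} (hx : 0 < inner ℝ n (rel y x))
    (hz : 0 < inner ℝ n (rel y z)) :
    ∃ (e : HausdorffBoundary S) (s t : ℝ), 0 ≤ s ∧ 0 ≤ t ∧ s + t ≤ 1 ∧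
      rel y e = s • rel y x + t • rel y z ∧ Sees y e ∧ 0 < inner ℝ n (rel y e) ∧
      ∀ s' t' : ℝ, 0 ≤ s' → 0 ≤ t' → 0 < s' + t' →
        inner ℝ n (s' • rel y x + t' • rel y z) < inner ℝ n (rel y e) →
        hbSupport y + (s' • rel y x + t' • rel y z) ∈ S := by
  obtain ⟨R, hR, hf⟩ := h.free
  set X := rel y x with hX
  set Z := rel y z with hZ
  set K : Set (ℝ × ℝ) := {q | (0 ≤ q.1 ∧ 0 ≤ q.2 ∧ R ≤ q.1 + q.2 ∧ q.1 + q.2 ≤ 1) ∧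
    hbSupport y + (q.1 • X + q.2 • Z) ∉ S}
  have hKc : IsCompact K := by
    have hcl : IsClosed K := by
      refine IsClosed.inter ?_ ?_
      · refine (isClosed_le continuous_const continuous_fst).inter
          ((isClosed_le continuous_const continuous_snd).inter
          ((isClosed_le continuous_const (continuous_fst.add continuous_snd)).inter
          (isClosed_le (continuous_fst.add continuous_snd) continuous_const)))
      · exact (hS.isClosed_compl).preimage (f := fun q : ℝ × ℝ => hbSupport y + (q.1 • X + q.2 • Z))
          (by fun_prop)
    refine (isCompact_Icc (a := ((0:ℝ), (0:ℝ))) (b := (1, 1))).of_isClosed_subset hcl ?_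
    rintro ⟨s, t⟩ ⟨⟨h1, h2, h3, h4⟩, -⟩
    simp only at h1 h2 h3 h4
    exact ⟨⟨h1, h2⟩, ⟨by simp only; linarith, by simp only; linarith⟩⟩
  have hxS : hbSupport y + ((1:ℝ) • X + (0:ℝ) • Z) ∉ S := by
    rw [one_smul, zero_smul, add_zero, hX, add_rel]; exact hbSupport_notMem hS x
  have hzS : hbSupport y + ((0:ℝ) • X + (1:ℝ) • Z) ∉ S := by
    rw [one_smul, zero_smul, zero_add, hZ, add_rel]; exact hbSupport_notMem hS z
  have hR1 : R ≤ 1 := by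
    by_contra hc
    exact hxS (hf 1 0 zero_le_one le_rfl (by norm_num) (by linarith))
  have hK1 : ((1:ℝ), (0:ℝ)) ∈ K := ⟨⟨zero_le_one, le_rfl, by simpa, by norm_num⟩, hxS⟩
  have hK2 : ((0:ℝ), (1:ℝ)) ∈ K := ⟨⟨le_rfl, zero_le_one, by simpa, by norm_num⟩, hzS⟩
  obtain ⟨⟨s, t⟩, ⟨⟨hs, ht, hst, hst1⟩, hq⟩, hmin⟩ := hKc.exists_isMinOn ⟨_, hK1⟩
    (f := fun q : ℝ × ℝ => inner ℝ n (q.1 • X + q.2 • Z)) (by fun_prop)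
  simp only at hs ht hst hst1 hq
  have hin : ∀ s t : ℝ, inner ℝ n (s • X + t • Z) = s * inner ℝ n X + t * inner ℝ n Z := by
    intro s t
    rw [inner_add_right, inner_smul_right, inner_smul_right]
  set p := inner ℝ n X
  set q := inner ℝ n Z
  set m := s * p + t * q with hm
  have hmin' : ∀ s' t', (s', t') ∈ K → m ≤ s' * p + t' * q := by
    intro s' t' h
    have : inner ℝ n (s • X + t • Z) ≤ inner ℝ n (s' • X + t' • Z) := hmin h
    rwa [hin, hin] at this
  have hm1 : m ≤ p := by simpa using hmin' _ _ hK1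
  have hm2 : m ≤ q := by simpa using hmin' _ _ hK2
  have hm0 : 0 < m := by
    rcases hs.eq_or_lt with h | h
    · have : 0 < t := by linarith
      positivity
    · positivity
  have hfree : ∀ s' t' : ℝ, 0 ≤ s' → 0 ≤ t' → 0 < s' + t' → s' * p + t' * q < m →
      hbSupport y + (s' • X + t' • Z) ∈ S := by
    intro s' t' hs' ht' h0 hlt
    by_contra hc
    have h1 : R ≤ s' + t' := by
      by_contra h1
      exact hc (hf s' t' hs' ht' h0 (by linarith))
    have h2 : s' + t' ≤ 1 := by
      by_contra h2
      nlinarith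
    exact absurd (hmin' s' t' ⟨⟨hs', ht', h1, h2⟩, hc⟩) (by linarith)
  obtain ⟨e, τ, hτ0, hτ1, he, hsee⟩ := sees_first_hit hS h.left h.free hs ht hq (by
    intro h0
    have := hin s t
    rw [← hX, ← hZ] at h0
    rw [h0, inner_zero_right] at this
    exact hm0.ne this)
  rw [← hX, ← hZ] at he
  have hτ : τ = 1 := by
    refine le_antisymm hτ1 (not_lt.1 fun hlt => ?_)
    have h1 := hfree (τ * s) (τ * t) (by positivity) (by positivity)
      (by rw [← mul_add]; exact mul_pos hτ0 (by linarith)) (by nlinarith)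
    rw [show (τ * s) • X + (τ * t) • Z = τ • (s • X + t • Z) by module, ← he, add_rel] at h1
    exact hbSupport_notMem hS e h1
  rw [hτ, one_smul] at he
  refine ⟨e, s, t, hs, ht, hst1, he, hsee, ?_, fun s' t' hs' ht' h0 hlt => ?_⟩
  · rw [he, hin]; exact hm0
  · rw [he, hin, hin] at hlt
    exact hfree s' t' hs' ht' h0 hlt

end

/-! ### Angles do not increase -/

theorem angle_le_of_dist_le {n : ℕ} {v w v' w' : Euc n} {r D T : ℝ} (hr : 0 < r) (hT : 0 ≤ T)
    (hv : r ≤ ‖v‖) (hw : r ≤ ‖w‖) (hv' : ‖v'‖ = ‖v‖) (hw' : ‖w'‖ = ‖w‖) (hD : ‖w' - v'‖ ≤ D)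
    (hDT : D ^ 2 ≤ (1 + T ^ 2) * ‖w - v‖ ^ 2) :
    angle v' w' ≤ angle v w + Real.pi * T / (2 * r) * ‖w - v‖ := by
  set θ := angle v w with hθ
  set θ' := angle v' w' with hθ'
  have hpi := Real.pi_pos
  rcases le_total θ' θ with h | h
  · have : 0 ≤ Real.pi * T / (2 * r) * ‖w - v‖ := by positivity
    linarith
  have h1 := InnerProductGeometry.norm_sub_sq_eq_norm_sq_add_norm_sq_sub_two_mul_norm_mul_norm_mul_cos_angle w v
  have h2 := InnerProductGeometry.norm_sub_sq_eq_norm_sq_add_norm_sq_sub_two_mul_norm_mul_norm_mul_cos_angle w' v'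
  rw [InnerProductGeometry.angle_comm] at h1 h2
  rw [← hθ] at h1
  rw [← hθ', hv', hw'] at h2
  have h3 : ‖w' - v'‖ * ‖w' - v'‖ ≤ D ^ 2 := by nlinarith [norm_nonneg (w' - v')]
  have h4 : 2 * (‖w‖ * ‖v‖) * (Real.cos θ - Real.cos θ') ≤ T ^ 2 * ‖w - v‖ ^ 2 := by nlinarith
  have h5 : Real.cos θ - Real.cos θ' = 2 * (Real.sin ((θ + θ') / 2) * Real.sin ((θ' - θ) / 2)) := by
    rw [Real.cos_sub_cos, show (θ - θ') / 2 = -((θ' - θ) / 2) by ring, Real.sin_neg]; ring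
  have hθ0 : 0 ≤ θ := InnerProductGeometry.angle_nonneg _ _
  have hθ1 : θ' ≤ Real.pi := InnerProductGeometry.angle_le_pi _ _
  have h6 : (θ' - θ) / Real.pi ≤ Real.sin ((θ' - θ) / 2) := by
    have := Real.mul_le_sin (x := (θ' - θ) / 2) (by linarith) (by linarith)
    convert this using 1
    field_simp
  have h7 : Real.sin ((θ' - θ) / 2) ≤ Real.sin ((θ + θ') / 2) := by
    rcases le_total ((θ + θ') / 2) (Real.pi / 2) with h | h
    · exact Real.sin_le_sin_of_le_of_le_pi_div_two (by linarith) h (by linarith)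
    · rw [← Real.sin_pi_sub ((θ + θ') / 2)]
      exact Real.sin_le_sin_of_le_of_le_pi_div_two (by linarith) (by linarith) (by linarith)
  have h0 : 0 ≤ (θ' - θ) / Real.pi := div_nonneg (by linarith) hpi.le
  have h8 : ((θ' - θ) / Real.pi) ^ 2 ≤ Real.sin ((θ + θ') / 2) * Real.sin ((θ' - θ) / 2) := by
    rw [sq]; exact mul_le_mul (h6.trans h7) h6 h0 (h0.trans (h6.trans h7))
  have h9 : r * r ≤ ‖w‖ * ‖v‖ := mul_le_mul hw hv hr.le (norm_nonneg _)
  have h10 : (2 * r * ((θ' - θ) / Real.pi)) ^ 2 ≤ (T * ‖w - v‖) ^ 2 := by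
    rw [h5] at h4
    have := mul_le_mul h9 h8 (by positivity) (by positivity)
    nlinarith
  have h11 := abs_le_of_sq_le_sq' h10 (by positivity)
  have h12 : θ' - θ ≤ Real.pi * T / (2 * r) * ‖w - v‖ := by
    have := h11.2
    rw [mul_div_assoc', div_le_iff₀ hpi] at this
    rw [div_mul_eq_mul_div, le_div_iff₀ (by positivity)]
    nlinarith
  linarith

theorem bdLE_of_hull_path {n : ℕ} {S : Set (Euc n)} {y e e' : HausdorffBoundary S} (h : Sees y e)
    (h' : Sees y e') {P : Euc n}
    (h1 : ∀ l : ℝ, 0 < l → l < 1 → ∀ r : ℝ, 0 ≤ r → r ≤ 1 →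
      hbSupport y + l • ((1 - r) • rel y e + r • P) ∈ S)
    (h2 : ∀ l : ℝ, 0 < l → l < 1 → ∀ r : ℝ, 0 ≤ r → r ≤ 1 →
      hbSupport y + l • ((1 - r) • P + r • rel y e') ∈ S) :
    BdLE e e' (dist (rel y e) P + dist P (rel y e')) := by
  refine BdLE.of_forall_pos fun ε hε => ?_
  set C := ‖rel y e‖ + ‖rel y e'‖ + 1
  have hC : 0 < C := by positivity
  obtain ⟨k, hk0, hk1⟩ : ∃ k : ℝ, 0 < k ∧ k < min 1 (ε / C) := exists_between (by positivity)
  have hka : k < 1 := hk1.trans_le (min_le_left _ _)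
  have hkb : k * C < ε := by
    rw [← lt_div_iff₀ hC]; exact hk1.trans_le (min_le_right _ _)
  have hl0 : 0 < 1 - k := by linarith
  have hl1 : 1 - k < 1 := by linarith
  have d : ∀ v w : Euc n, dist (hbSupport y + (1 - k) • v) (hbSupport y + (1 - k) • w) ≤ dist v w := by
    intro v w
    rw [dist_add_left, dist_smul₀, Real.norm_of_nonneg hl0.le]
    nlinarith [dist_nonneg (x := v) (y := w)]
  have e1 := IntLE.of_segment (segment_subset_of_smul (v := (1 - k) • rel y e) (w := (1 - k) • P)
    (S := S) (o := hbSupport y) fun r hr0 hr1 => by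
      convert h1 (1 - k) hl0 hl1 r hr0 hr1 using 2
      module)
  have e2 := IntLE.of_segment (segment_subset_of_smul (v := (1 - k) • P) (w := (1 - k) • rel y e')
    (S := S) (o := hbSupport y) fun r hr0 hr1 => by
      convert h2 (1 - k) hl0 hl1 r hr0 hr1 using 2
      module)
  refine ((h.smul_ptLE_right hl0 hl1).add_pt (e1.trans_pt (e2.trans_pt
    (h'.smul_ptLE_right hl0 hl1)))).mono ?_
  have := d (rel y e) P
  have := d P (rel y e')
  simp only [C] at hkb
  linarith

section

variable {S : Set (Euc 2)} {x y z e e' : HausdorffBoundary S} {n n' τ τ' : Euc 2}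
  {s t s' t' a b a' b' T σ : ℝ}

/-- A vertex of the hull of the complement of `S` in a boundary angle, with inner normal `n`. -/
structure HullVertex (x y z : HausdorffBoundary S) (n : Euc 2) (e : HausdorffBoundary S)
    (s t : ℝ) : Prop where
  hs : 0 ≤ s
  ht : 0 ≤ t
  hs1 : s ≤ 1
  ht1 : t ≤ 1
  rel_eq : rel y e = s • rel y x + t • rel y z
  sees : Sees y e
  lower : ∀ s' t' : ℝ, 0 ≤ s' → 0 ≤ t' → 0 < s' + t' →
    hbSupport y + (s' • rel y x + t' • rel y z) ∉ S →
    inner ℝ n (rel y e) ≤ inner ℝ n (s' • rel y x + t' • rel y z)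
  path : ∀ s' t' : ℝ, 0 ≤ s' → 0 ≤ t' → 0 < s' + t' → s' ≤ 1 → t' ≤ 1 →
    inner ℝ n (s' • rel y x + t' • rel y z) = inner ℝ n (rel y e) →
    ∀ l : ℝ, 0 < l → l < 1 → hbSupport y + l • (s' • rel y x + t' • rel y z) ∈ S

theorem BA.hullVertex_left (h : BA x y z) (hx : inner ℝ n (rel y x) = 0)
    (hz : 0 < inner ℝ n (rel y z)) : HullVertex x y z n x 1 0 where
  hs := zero_le_one
  ht := le_rfl
  hs1 := le_rfl
  ht1 := zero_le_one
  rel_eq := by simp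
  sees := h.left
  lower := fun s' t' _ ht' _ _ => by
    rw [inner_add_right, inner_smul_right, inner_smul_right, hx]; simp; positivity
  path := fun s' t' _ _ h0 hs1 _ hi l hl0 hl1 => by
    rw [inner_add_right, inner_smul_right, inner_smul_right, hx, mul_zero, zero_add] at hi
    have ht' : t' = 0 := by simpa [hz.ne'] using hi
    subst ht'
    rw [zero_smul, add_zero, smul_smul]
    rw [add_zero] at h0
    exact h.left.smul_mem (by positivity) (by nlinarith)

theorem HullVertex.symm (h : HullVertex x y z n e s t) : HullVertex z y x n e t s where
  hs := h.ht
  ht := h.hs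
  hs1 := h.ht1
  ht1 := h.hs1
  rel_eq := by rw [h.rel_eq, add_comm]
  sees := h.sees
  lower := fun s' t' hs' ht' h0 hn => by
    rw [add_comm (s' • rel y z)] at hn ⊢
    exact h.lower t' s' ht' hs' (by linarith) hn
  path := fun s' t' hs' ht' h0 hs1 ht1 hi => by
    rw [add_comm (s' • rel y z)] at hi ⊢
    exact h.path t' s' ht' hs' (by linarith) ht1 hs1 hi

theorem BA.hullVertex_right (h : BA x y z) (hz : inner ℝ n (rel y z) = 0)
    (hx : 0 < inner ℝ n (rel y x)) : HullVertex x y z n z 0 1 :=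
  (h.symm.hullVertex_left hz hx).symm

theorem BA.exists_hullVertex (hS : IsOpen S) (h : BA x y z) (hx : 0 < inner ℝ n (rel y x))
    (hz : 0 < inner ℝ n (rel y z)) :
    ∃ e s t, HullVertex x y z n e s t ∧ 0 < inner ℝ n (rel y e) := by
  obtain ⟨e, s, t, hs, ht, hst, he, hsee, hpos, hfree⟩ := h.exists_argmin hS hx hz
  refine ⟨e, s, t, ⟨hs, ht, by linarith, by linarith, he, hsee, ?_, ?_⟩, hpos⟩
  · intro s' t' hs' ht' h0 hn
    by_contra hc
    exact hn (hfree s' t' hs' ht' h0 (not_le.1 hc))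
  · intro s' t' hs' ht' h0 _ _ hi l hl0 hl1
    have := hfree (l * s') (l * t') (by positivity) (by positivity)
      (by rw [← mul_add]; positivity)
    rw [mul_smul, mul_smul, ← smul_add, inner_smul_right, hi] at this
    exact this (by nlinarith)

set_option maxHeartbeats 1000000 in
theorem HullVertex.step (hS : IsOpen S) (hXZ : cross (rel y x) (rel y z) ≠ 0)
    (h : HullVertex x y z n e s t) (h' : HullVertex x y z n' e' s' t')
    (hm : 0 < inner ℝ n (rel y e) ∨ 0 < inner ℝ n' (rel y e'))
    (ha : 0 ≤ a) (hb : 0 ≤ b) (ha' : 0 ≤ a') (hb' : 0 ≤ b')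
    (hτ : τ = (-a) • rel y x + b • rel y z) (hτ' : τ' = (-a') • rel y x + b' • rel y z)
    (h1 : ‖τ‖ = 1) (h1' : ‖τ'‖ = 1) (hc : inner ℝ τ τ' * (1 + T ^ 2) = 1 - T ^ 2)
    (hn : inner ℝ n τ = 0) (hn' : inner ℝ n' τ' = 0) (hσ : 0 < σ) (hnσ : inner ℝ n τ' = σ)
    (hnσ' : inner ℝ n' τ = -σ) (hcr : cross τ τ' ≠ 0) :
    s' ≤ s ∧ t ≤ t' ∧ ∃ D, BdLE e e' D ∧ D ^ 2 ≤ (1 + T ^ 2) * ‖rel y e' - rel y e‖ ^ 2 := by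
  set X := rel y x with hX
  set Z := rel y z with hZ
  set w := rel y e with hw
  set w' := rel y e' with hw'
  obtain ⟨A, B, hAB⟩ : ∃ A B : ℝ, w' - w = A • τ + B • τ' := ⟨_, _, exists_coords hcr _⟩
  have hwn : inner ℝ n w' = inner ℝ n w + B * σ := by
    rw [show w' = w + (w' - w) by abel, hAB, inner_add_right, inner_add_right, inner_smul_right,
      inner_smul_right, hn, hnσ]; ring
  have hwn' : inner ℝ n' w' = inner ℝ n' w - A * σ := by
    rw [show w' = w + (w' - w) by abel, hAB, inner_add_right, inner_add_right, inner_smul_right,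
      inner_smul_right, hn', hnσ']; ring
  have hst : 0 < s + t := by
    rcases (add_nonneg h.hs h.ht).eq_or_lt with h0 | h0
    · have e1 : s = 0 := by linarith [h.hs, h.ht]
      have e2 : t = 0 := by linarith [h.hs, h.ht]
      exact absurd h.rel_eq (by rw [e1, e2]; simpa using h.sees.rel_ne_zero)
    · exact h0
  have hst' : 0 < s' + t' := by
    rcases (add_nonneg h'.hs h'.ht).eq_or_lt with h0 | h0
    · have e1 : s' = 0 := by linarith [h'.hs, h'.ht]
      have e2 : t' = 0 := by linarith [h'.hs, h'.ht]
      exact absurd h'.rel_eq (by rw [e1, e2]; simpa using h'.sees.rel_ne_zero)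
    · exact h0
  have hB : 0 ≤ B := by
    have := h.lower s' t' h'.hs h'.ht hst' (by
      rw [← h'.rel_eq, add_rel]; exact hbSupport_notMem hS e')
    rw [← h'.rel_eq, ← hw', hwn] at this
    exact nonneg_of_mul_nonneg_left (by linarith) hσ
  have hA : 0 ≤ A := by
    have := h'.lower s t h.hs h.ht hst (by
      rw [← h.rel_eq, add_rel]; exact hbSupport_notMem hS e)
    rw [← h.rel_eq, ← hw', ← hw, hwn'] at this
    exact nonneg_of_mul_nonneg_left (by linarith) hσ
  have hcoord := (comb_eq_zero_iff hXZ (s := s' - s + (A * a + B * a'))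
    (t := t' - t - (A * b + B * b'))).1 (by
      have : w' - w - (A • τ + B • τ') = 0 := by rw [hAB, sub_self]
      rw [hw', h'.rel_eq, hw, h.rel_eq, hτ, hτ'] at this
      rw [← this, hX, hZ]; module)
  obtain ⟨hc1, hc2⟩ := hcoord
  have p1 := mul_nonneg hA ha
  have p2 := mul_nonneg hB ha'
  have p3 := mul_nonneg hA hb
  have p4 := mul_nonneg hB hb'
  refine ⟨by linarith, by linarith, A + B, ?_, ?_⟩
  · have hP0 : w + A • τ = (s - A * a) • X + (t + A * b) • Z := by
      rw [hw, h.rel_eq, hτ]; module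
    have hnP : inner ℝ n (w + A • τ) = inner ℝ n w := by
      rw [inner_add_right, inner_smul_right, hn]; ring
    have hnP' : inner ℝ n' (w + A • τ) = inner ℝ n' w' := by
      rw [inner_add_right, inner_smul_right, hnσ', hwn']; ring
    have hPne : 0 < (s - A * a) + (t + A * b) := by
      have q1 : 0 ≤ s - A * a := by linarith [h'.hs]
      have q2 : 0 ≤ t + A * b := by linarith [h.ht]
      rcases (add_nonneg q1 q2).eq_or_lt with h0 | h0
      · have e1 : s - A * a = 0 := by linarith
        have e2 : t + A * b = 0 := by linarith
        rw [hP0, e1, e2] at hnP hnP'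
        simp at hnP hnP'
        rcases hm with hm | hm <;> linarith
      · exact h0
    have key := bdLE_of_hull_path h.sees h'.sees (P := w + A • τ) ?_ ?_
    · refine key.mono (le_of_eq ?_)
      rw [← hw, ← hw', dist_self_add_right, dist_comm, dist_eq_norm,
        show w' - (w + A • τ) = (w' - w) - A • τ by abel, hAB, add_sub_cancel_left, norm_smul,
        norm_smul, h1, h1', Real.norm_of_nonneg hA, Real.norm_of_nonneg hB]; ring
    · intro l hl0 hl1 r hr0 hr1
      have hr2 : 0 ≤ 1 - r := by linarith
      have hrA : r * (A * a) ≤ A * a := by nlinarith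
      have hrA' : r * (A * b) ≤ A * b := by nlinarith
      have hrA2 := mul_nonneg hr0 p1
      have hrA3 := mul_nonneg hr0 p3
      have e1 : (1 - r) • rel y e + r • (w + A • τ) =
          (s - r * (A * a)) • X + (t + r * (A * b)) • Z := by
        rw [hP0, h.rel_eq]; module
      rw [e1]
      refine h.path _ _ (by linarith [h'.hs]) (by linarith [h.ht]) ?_ ?_ ?_ ?_ l hl0 hl1
      · have : s - r * (A * a) + (t + r * (A * b)) =
          (1 - r) * (s + t) + r * (s - A * a + (t + A * b)) := by ring
        rw [this]
        rcases hr1.eq_or_lt with h | h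
        · rw [h]; linarith
        · have : 0 < 1 - r := by linarith
          have := mul_pos this hst
          have := mul_nonneg hr0 hPne.le
          linarith
      · linarith [h.hs1]
      · linarith [h'.ht1]
      · rw [← hX, ← hZ, ← e1, ← hw, inner_add_right, inner_smul_right, inner_smul_right, hnP]; ring
    · intro l hl0 hl1 r hr0 hr1
      have hr2 : 0 ≤ 1 - r := by linarith
      have hrA : (1 - r) * (B * a') ≤ B * a' := by nlinarith
      have hrA' : (1 - r) * (B * b') ≤ B * b' := by nlinarith
      have hrA2 := mul_nonneg hr2 p2
      have hrA3 := mul_nonneg hr2 p4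
      have e1 : (1 - r) • (w + A • τ) + r • rel y e' =
          (s' + (1 - r) * (B * a')) • X + (t' - (1 - r) * (B * b')) • Z := by
        rw [hP0, h'.rel_eq, show s - A * a = s' + B * a' by linarith,
          show t + A * b = t' - B * b' by linarith]; module
      rw [e1]
      refine h'.path _ _ (by linarith [h'.hs]) (by linarith [h.ht]) ?_ ?_ ?_ ?_ l hl0 hl1
      · have : s' + (1 - r) * (B * a') + (t' - (1 - r) * (B * b')) =
          r * (s' + t') + (1 - r) * (s - A * a + (t + A * b)) := by
          rw [show s - A * a = s' + B * a' by linarith,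
          show t + A * b = t' - B * b' by linarith]; ring
        rw [this]
        rcases hr0.eq_or_lt with h | h
        · rw [← h]; linarith
        · have := mul_pos h hst'
          have := mul_nonneg hr2 hPne.le
          linarith
      · linarith [h.hs1]
      · linarith [h'.ht1]
      · rw [← hX, ← hZ, ← e1, ← hw', inner_add_right, inner_smul_right, inner_smul_right, hnP']; ring
  · rw [hAB, ← real_inner_self_eq_norm_sq]
    have : inner ℝ (A • τ + B • τ') (A • τ + B • τ') = A ^ 2 + B ^ 2 + 2 * A * B * inner ℝ τ τ' := by
      simp only [inner_add_left, inner_add_right, inner_smul_left, inner_smul_right, conj_trivial,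
        real_inner_self_eq_norm_sq, h1, h1', real_inner_comm τ τ']
      ring
    rw [this]
    nlinarith [mul_nonneg (sq_nonneg T) (sq_nonneg (A - B)), congrArg (fun q => 2 * A * B * q) hc]

end

theorem angle_eq_add_of_comb {n : ℕ} {x y z : Euc n} (hy : y ≠ 0) {a b : ℝ} (ha : 0 ≤ a)
    (hb : 0 ≤ b) (h : y = a • x + b • z) : angle x z = angle x y + angle y z := by
  refine InnerProductGeometry.angle_eq_angle_add_add_angle_add_of_mem_span hy ?_
  rw [Submodule.mem_span_pair]
  exact ⟨⟨a, ha⟩, ⟨b, hb⟩, h.symm⟩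

theorem cross_eq_zero_of_sin {X Z : Euc 2} (h : Real.sin (angle X Z) = 0) : cross X Z = 0 := by
  have h1 := cross_sq X Z
  have h2 := Real.sin_sq_add_cos_sq (angle X Z)
  rw [← InnerProductGeometry.cos_angle_mul_norm_mul_norm] at h1
  rw [h] at h2
  have : cross X Z ^ 2 = 0 := by
    rw [h1]; linear_combination (-(‖X‖ ^ 2 * ‖Z‖ ^ 2)) * h2
  exact pow_eq_zero_iff two_ne_zero |>.1 this

theorem angle_pos_of_cross {X Z : Euc 2} (h : cross X Z ≠ 0) : 0 < angle X Z :=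
  lt_of_le_of_ne (InnerProductGeometry.angle_nonneg _ _) fun h0 =>
    h (cross_eq_zero_of_sin (by rw [← h0, Real.sin_zero]))

theorem angle_lt_pi_of_cross {X Z : Euc 2} (h : cross X Z ≠ 0) : angle X Z < Real.pi :=
  lt_of_le_of_ne (InnerProductGeometry.angle_le_pi _ _) fun h0 =>
    h (cross_eq_zero_of_sin (by rw [h0, Real.sin_pi]))

theorem OFrame.dir_eq_comb (B : OFrame) {α : ℝ} (h : Real.sin α ≠ 0) (φ : ℝ) :
    B.dir φ = (Real.sin (α - φ) / Real.sin α) • B.dir 0 +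
      (Real.sin φ / Real.sin α) • B.dir α := by
  have h1 : Real.sin (α - φ) / Real.sin α + Real.sin φ / Real.sin α * Real.cos α = Real.cos φ := by
    rw [Real.sin_sub]; field_simp; ring
  have h2 : Real.sin φ / Real.sin α * Real.sin α = Real.sin φ := by field_simp
  simp only [OFrame.dir, Real.cos_zero, Real.sin_zero, smul_add, smul_smul]
  rw [h2, ← h1]
  module

section

variable {U V : Set (Euc 2)} {x y z : HausdorffBoundary U}

theorem HullVertex.coords_pos {e : HausdorffBoundary U} {n : Euc 2} {s t : ℝ}
    (h : HullVertex x y z n e s t) : 0 < s + t := by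
  rcases (add_nonneg h.hs h.ht).eq_or_lt with h0 | h0
  · have e1 : s = 0 := by linarith [h.hs, h.ht]
    have e2 : t = 0 := by linarith [h.hs, h.ht]
    exact absurd h.rel_eq (by rw [e1, e2]; simpa using h.sees.rel_ne_zero)
  · exact h0

theorem norm_ge_of_coords {X Z : Euc 2} {s t R : ℝ} (hs : 0 ≤ s) (ht : 0 ≤ t) (hR : R ≤ s + t) :
    R * |cross X Z| ≤ ‖s • X + t • Z‖ * (‖X‖ + ‖Z‖) := by
  have h1 := abs_cross_le X (s • X + t • Z)
  have h2 := abs_cross_le (s • X + t • Z) Z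
  rw [cross_add_right, cross_smul_right, cross_smul_right, cross_self_eq, mul_zero, zero_add,
    abs_mul, abs_of_nonneg ht] at h1
  rw [cross_add_left, cross_smul_left, cross_smul_left, cross_self_eq, mul_zero, add_zero,
    abs_mul, abs_of_nonneg hs] at h2
  nlinarith [mul_le_mul_of_nonneg_right hR (abs_nonneg (cross X Z))]

theorem angle_step (I : HBIso U V) {e e' : HausdorffBoundary U} {n n' : Euc 2} {s t s' t' r D T : ℝ}
    (h : HullVertex x y z n e s t) (h' : HullVertex x y z n' e' s' t') (hr : 0 < r) (hT : 0 ≤ T)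
    (he : r ≤ ‖rel y e‖) (he' : r ≤ ‖rel y e'‖) (hs : s' ≤ s) (ht : t ≤ t') (hD : BdLE e e' D)
    (hDT : D ^ 2 ≤ (1 + T ^ 2) * ‖rel y e' - rel y e‖ ^ 2)
    (ih : angle (rel (I y) (I x)) (rel (I y) (I e)) ≤ angle (rel y x) (rel y e) +
      Real.pi * T / (2 * r) * ((1 - s) * ‖rel y x‖ + t * ‖rel y z‖)) :
    angle (rel (I y) (I x)) (rel (I y) (I e')) ≤ angle (rel y x) (rel y e') +
      Real.pi * T / (2 * r) * ((1 - s') * ‖rel y x‖ + t' * ‖rel y z‖) := by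
  have h1 : ‖rel (I y) (I e') - rel (I y) (I e)‖ ≤ D := by
    rw [rel, rel, sub_sub_sub_cancel_right, ← dist_eq_norm, dist_comm]
    exact (I.bdLE_iff.2 hD).dist_le
  have h2 := angle_le_of_dist_le hr hT he he' (h.sees.norm_rel_map I) (h'.sees.norm_rel_map I) h1
    hDT
  have h3 := InnerProductGeometry.angle_le_angle_add_angle (rel (I y) (I x)) (rel (I y) (I e))
    (rel (I y) (I e'))
  have h4 : ‖rel y e' - rel y e‖ ≤ (s - s') * ‖rel y x‖ + (t' - t) * ‖rel y z‖ := by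
    rw [h.rel_eq, h'.rel_eq, show s' • rel y x + t' • rel y z - (s • rel y x + t • rel y z) =
      (-(s - s')) • rel y x + (t' - t) • rel y z by module]
    refine (norm_add_le _ _).trans ?_
    rw [norm_smul, norm_smul, norm_neg, Real.norm_of_nonneg (by linarith),
      Real.norm_of_nonneg (by linarith)]
  have h5 : angle (rel y x) (rel y e') = angle (rel y x) (rel y e) + angle (rel y e) (rel y e') := by
    rcases (h.ht.trans ht).eq_or_lt with h0 | h0
    · have : t = 0 := le_antisymm (by rw [h0]; exact ht) h.ht
      refine angle_eq_add_of_comb h.sees.rel_ne_zero h.hs le_rfl (a := s) (b := 0) ?_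
      rw [h.rel_eq, this]; simp
    · refine angle_eq_add_of_comb h.sees.rel_ne_zero (a := s - t / t' * s') (b := t / t') ?_
        (div_nonneg h.ht h0.le) ?_
      · have : t / t' ≤ 1 := (div_le_one h0).2 ht
        have := mul_le_mul_of_nonneg_right this h'.hs
        linarith
      · rw [h'.rel_eq, h.rel_eq, smul_add, smul_smul, smul_smul, div_mul_cancel₀ _ h0.ne']
        module
  have h6 : 0 ≤ Real.pi * T / (2 * r) := by positivity
  have h7 := mul_le_mul_of_nonneg_left h4 h6
  rw [h5]
  nlinarith

theorem BA.angle_map_le_aux (I : HBIso U V) (h : BA x y z) {N : ℕ} (hN : 2 ≤ N) {r δ : ℝ}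
    (hr : 0 < r)
    (hre : ∀ (e : HausdorffBoundary U) (s t : ℝ), 0 ≤ s → 0 ≤ t → 0 < s + t →
      rel y e = s • rel y x + t • rel y z → r ≤ ‖rel y e‖)
    (hδ : N * δ = Real.pi - angle (rel y x) (rel y z)) :
    angle (rel (I y) (I x)) (rel (I y) (I z)) ≤ angle (rel y x) (rel y z) +
      Real.pi * Real.tan (δ / 2) / (2 * r) * (‖rel y x‖ + ‖rel y z‖) := by
  have hXZ := h.indep
  have hXn := h.left.norm_rel_pos
  have hZn := h.right.norm_rel_pos
  obtain ⟨B, hX, hZ⟩ := OFrame.exists_adapted h.left.rel_ne_zero h.right.rel_ne_zero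
  have hα0 := angle_pos_of_cross hXZ
  have hα1 := angle_lt_pi_of_cross hXZ
  set α := angle (rel y x) (rel y z) with hα
  have hpi := Real.pi_pos
  have hN' : (2:ℝ) ≤ N := by exact_mod_cast hN
  have hδ0 : 0 < δ := by
    by_contra hc
    nlinarith
  have hδ1 : δ < Real.pi / 2 := by nlinarith
  have hsα : 0 < Real.sin α := Real.sin_pos_of_pos_of_lt_pi hα0 hα1
  have hsδ : 0 < Real.sin δ := Real.sin_pos_of_pos_of_lt_pi hδ0 (by linarith)
  have hT0 : 0 ≤ Real.tan (δ / 2) :=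
    Real.tan_nonneg_of_nonneg_of_le_pi_div_two (by linarith) (by linarith)
  set nn : ℕ → Euc 2 := fun k => B.dir (Real.pi / 2 - k * δ) with hnn
  set tt : ℕ → Euc 2 := fun k => B.dir (Real.pi - k * δ) with htt
  have hnX : ∀ k, inner ℝ (nn k) (rel y x) = ‖rel y x‖ * Real.sin (k * δ) := by
    intro k
    rw [hX, inner_smul_right, norm_smul, B.norm_dir, B.inner_dir, ← Real.cos_pi_div_two_sub]
    simp
  have hnZ : ∀ k, inner ℝ (nn k) (rel y z) = ‖rel y z‖ * Real.sin (α + k * δ) := by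
    intro k
    rw [hZ, inner_smul_right, norm_smul, B.norm_dir, B.inner_dir, ← Real.cos_pi_div_two_sub]
    simp only [Real.norm_eq_abs, abs_norm, mul_one]
    congr 2; ring
  have hle : ∀ k : ℕ, k ≤ N → k * δ ≤ Real.pi - α := by
    intro k hk
    rw [← hδ]
    exact mul_le_mul_of_nonneg_right (by exact_mod_cast hk) hδ0.le
  have hlt : ∀ k : ℕ, k < N → k * δ < Real.pi - α := by
    intro k hk
    rw [← hδ]
    exact mul_lt_mul_of_pos_right (by exact_mod_cast hk) hδ0
  have htcoord : ∀ k : ℕ, k ≤ N → ∃ a b : ℝ, 0 ≤ a ∧ 0 ≤ b ∧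
      tt k = (-a) • rel y x + b • rel y z := by
    intro k hk
    have h1 := hle k hk
    have h2 : 0 ≤ k * δ := by positivity
    refine ⟨Real.sin (Real.pi - k * δ - α) / Real.sin α / ‖rel y x‖,
      Real.sin (Real.pi - k * δ) / Real.sin α / ‖rel y z‖, ?_, ?_, ?_⟩
    · have := Real.sin_nonneg_of_nonneg_of_le_pi (x := Real.pi - k * δ - α) (by linarith)
        (by linarith)
      positivity
    · have := Real.sin_nonneg_of_nonneg_of_le_pi (x := Real.pi - k * δ) (by linarith)
        (by linarith)
      positivity
    · have e1 := B.dir_eq_comb hsα.ne' (Real.pi - k * δ)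
      rw [htt]
      simp only
      rw [e1, show α - (Real.pi - k * δ) = -(Real.pi - k * δ - α) by ring, Real.sin_neg]
      nth_rw 2 [hX]
      nth_rw 2 [hZ]
      rw [smul_smul, smul_smul, neg_mul, div_mul_cancel₀ _ hXn.ne', div_mul_cancel₀ _ hZn.ne',
        neg_div]
  have step : ∀ k : ℕ, k < N → ∀ e e' s t s' t', HullVertex x y z (nn k) e s t →
      HullVertex x y z (nn (k + 1)) e' s' t' →
      (0 < inner ℝ (nn k) (rel y e) ∨ 0 < inner ℝ (nn (k + 1)) (rel y e')) →
      angle (rel (I y) (I x)) (rel (I y) (I e)) ≤ angle (rel y x) (rel y e) +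
        Real.pi * Real.tan (δ / 2) / (2 * r) * ((1 - s) * ‖rel y x‖ + t * ‖rel y z‖) →
      angle (rel (I y) (I x)) (rel (I y) (I e')) ≤ angle (rel y x) (rel y e') +
        Real.pi * Real.tan (δ / 2) / (2 * r) * ((1 - s') * ‖rel y x‖ + t' * ‖rel y z‖) := by
    intro k hk e e' s t s' t' he he' hm ih
    obtain ⟨a, b, ha, hb, hτ⟩ := htcoord k hk.le
    obtain ⟨a', b', ha', hb', hτ'⟩ := htcoord (k + 1) hk
    have hin : inner ℝ (tt k) (tt (k + 1)) = Real.cos δ := by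
      simp only [htt, B.inner_dir]; congr 1; push_cast; ring
    obtain ⟨h1, h2, D, hD, hDT⟩ := HullVertex.step I.isOpen_left hXZ he he' hm ha hb ha' hb' hτ hτ'
      (B.norm_dir _) (B.norm_dir _) (T := Real.tan (δ / 2)) (σ := Real.sin δ) (by
        have hc : Real.cos (δ / 2) ≠ 0 := (Real.cos_pos_of_mem_Ioo ⟨by linarith, by linarith⟩).ne'
        rw [hin, Real.tan_eq_sin_div_cos, show δ = 2 * (δ / 2) by ring, Real.cos_two_mul]
        have := Real.sin_sq_add_cos_sq (δ / 2)
        rw [show 2 * (δ / 2) / 2 = δ / 2 by ring, div_pow]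
        field_simp
        linear_combination (2 * Real.cos (δ / 2) ^ 2) * this) (by
        simp only [hnn, htt, B.inner_dir]
        rw [show Real.pi / 2 - k * δ - (Real.pi - k * δ) = -(Real.pi / 2) by ring]
        simp) (by
        simp only [hnn, htt, B.inner_dir]
        rw [show Real.pi / 2 - ((k + 1 : ℕ):ℝ) * δ - (Real.pi - ((k + 1 : ℕ):ℝ) * δ) =
          -(Real.pi / 2) by ring]
        simp) hsδ (by
        simp only [hnn, htt, B.inner_dir]
        rw [show Real.pi / 2 - k * δ - (Real.pi - ((k + 1 : ℕ):ℝ) * δ) = -(Real.pi / 2 - δ) by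
          push_cast; ring, Real.cos_neg, Real.cos_pi_div_two_sub]) (by
        simp only [hnn, htt, B.inner_dir]
        rw [show Real.pi / 2 - ((k + 1 : ℕ):ℝ) * δ - (Real.pi - k * δ) = -(δ + Real.pi / 2) by
          push_cast; ring, Real.cos_neg, Real.cos_add_pi_div_two]) (by
        intro h0
        have h1 := cross_sq (tt k) (tt (k + 1))
        rw [h0, hin] at h1
        simp only [htt, B.norm_dir] at h1
        nlinarith [Real.sin_sq_add_cos_sq δ])
    exact angle_step I he he' hr hT0 (hre e s t he.hs he.ht he.coords_pos he.rel_eq)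
      (hre e' s' t' he'.hs he'.ht he'.coords_pos he'.rel_eq) h1 h2 hD hDT ih
  have hn0X : inner ℝ (nn 0) (rel y x) = 0 := by rw [hnX]; simp
  have hn0Z : 0 < inner ℝ (nn 0) (rel y z) := by rw [hnZ]; simp; positivity
  have main : ∀ k : ℕ, k < N → ∃ e s t, HullVertex x y z (nn k) e s t ∧
      (0 < k → 0 < inner ℝ (nn k) (rel y e)) ∧
      angle (rel (I y) (I x)) (rel (I y) (I e)) ≤ angle (rel y x) (rel y e) +
        Real.pi * Real.tan (δ / 2) / (2 * r) * ((1 - s) * ‖rel y x‖ + t * ‖rel y z‖) := by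
    intro k
    induction k with
    | zero =>
      intro _
      refine ⟨x, 1, 0, h.hullVertex_left hn0X hn0Z, fun h => absurd h (lt_irrefl _), ?_⟩
      rw [InnerProductGeometry.angle_self h.left.rel_ne_zero, InnerProductGeometry.angle_self
        (h.left.map I).rel_ne_zero]
      simp
    | succ k ih =>
      intro hk
      obtain ⟨e, s, t, he, -, hih⟩ := ih (by omega)
      have h1 := hlt (k + 1) hk
      have h2 : (0:ℝ) < ((k + 1 : ℕ):ℝ) * δ := by positivity
      obtain ⟨e', s', t', he', hpos⟩ := h.exists_hullVertex I.isOpen_left (n := nn (k + 1))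
        (by rw [hnX]; exact mul_pos hXn (Real.sin_pos_of_pos_of_lt_pi h2 (by linarith)))
        (by rw [hnZ]; exact mul_pos hZn (Real.sin_pos_of_pos_of_lt_pi (by linarith) (by linarith)))
      exact ⟨e', s', t', he', fun _ => hpos, step k (by omega) e e' s t s' t' he he' (Or.inr hpos)
        hih⟩
  obtain ⟨M, rfl⟩ : ∃ M, N = M + 1 := ⟨N - 1, by omega⟩
  obtain ⟨e, s, t, he, hpos, hih⟩ := main M (by omega)
  have := step M (by omega) e z s t 0 1 he (h.hullVertex_right (by
    rw [hnZ, hδ, add_sub_cancel, Real.sin_pi, mul_zero]) (by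
    rw [hnX, hδ, Real.sin_pi_sub]; positivity)) (Or.inl (hpos (by omega))) hih
  simpa using this

/-- Passing to the other domain does not increase a boundary angle. -/
theorem BA.angle_map_le (I : HBIso U V) (h : BA x y z) :
    angle (rel (I y) (I x)) (rel (I y) (I z)) ≤ angle (rel y x) (rel y z) := by
  obtain ⟨R, hR, hf⟩ := h.free
  have hXn := h.left.norm_rel_pos
  have hZn := h.right.norm_rel_pos
  have hcr : 0 < |cross (rel y x) (rel y z)| := abs_pos.2 h.indep
  set r := R * |cross (rel y x) (rel y z)| / (‖rel y x‖ + ‖rel y z‖) with hr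
  have hr0 : 0 < r := by positivity
  have hre : ∀ (e : HausdorffBoundary U) (s t : ℝ), 0 ≤ s → 0 ≤ t → 0 < s + t →
      rel y e = s • rel y x + t • rel y z → r ≤ ‖rel y e‖ := by
    intro e s t hs ht h0 he
    rw [hr, div_le_iff₀ (by positivity), he]
    refine norm_ge_of_coords hs ht ?_
    by_contra hc
    have := hf s t hs ht h0 (not_le.1 hc)
    rw [← he, add_rel] at this
    exact hbSupport_notMem I.isOpen_left e this
  set α := angle (rel y x) (rel y z) with hα
  have hlim : Tendsto (fun N : ℕ => α + Real.pi * Real.tan ((Real.pi - α) / N / 2) / (2 * r) *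
      (‖rel y x‖ + ‖rel y z‖)) atTop (nhds (α + Real.pi * Real.tan 0 / (2 * r) *
      (‖rel y x‖ + ‖rel y z‖))) := by
    have h1 : Tendsto (fun N : ℕ => (Real.pi - α) / N / 2) atTop (nhds 0) := by
      have := (tendsto_const_div_atTop_nhds_zero_nat (Real.pi - α)).div_const 2
      simpa using this
    have h2 : Tendsto Real.tan (nhds 0) (nhds (Real.tan 0)) :=
      (Real.continuousAt_tan.2 (by simp)).tendsto
    exact (((h2.comp h1).const_mul Real.pi).div_const (2 * r)).mul_const _ |>.const_add α
  rw [Real.tan_zero, mul_zero, zero_div, zero_mul, add_zero] at hlim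
  refine ge_of_tendsto hlim ?_
  filter_upwards [eventually_ge_atTop 2] with N hN
  refine h.angle_map_le_aux I hN hr0 hre ?_
  have : (N:ℝ) ≠ 0 := by positivity
  rw [← hα]
  field_simp

end

section Polar

variable {S : Set (Euc 2)} {o : Euc 2} {B : OFrame} {a b c d r s : ℝ}

/-- `S` contains all points close to `o`, but different from `o`, at polar angles in `[a, b]`. -/
def FreeDir (S : Set (Euc 2)) (o : Euc 2) (B : OFrame) (a b : ℝ) : Prop :=
  ∃ R > 0, ∀ t : ℝ, 0 < t → t < R → ∀ β : ℝ, a ≤ β → β ≤ b → o + t • B.dir β ∈ S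

theorem FreeDir.mono (h : FreeDir S o B a b) (hc : a ≤ c) (hd : d ≤ b) : FreeDir S o B c d := by
  obtain ⟨R, hR, h⟩ := h
  exact ⟨R, hR, fun t h0 h1 β hβ hβ' => h t h0 h1 β (hc.trans hβ) (hβ'.trans hd)⟩

theorem FreeDir.union (h : FreeDir S o B a b) (h' : FreeDir S o B c d) (hcb : c ≤ b) :
    FreeDir S o B a d := by
  obtain ⟨R, hR, h⟩ := h
  obtain ⟨R', hR', h'⟩ := h'
  refine ⟨min R R', lt_min hR hR', fun t h0 h1 β hβ hβ' => ?_⟩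
  rcases le_total β b with h2 | h2
  · exact h t h0 (h1.trans_le (min_le_left _ _)) β hβ h2
  · exact h' t h0 (h1.trans_le (min_le_right _ _)) β (hcb.trans h2) hβ'

theorem FreeDir.flip (h : FreeDir S o B a b) : FreeDir S o B.flip (-b) (-a) := by
  obtain ⟨R, hR, h⟩ := h
  refine ⟨R, hR, fun t h0 h1 β hβ hβ' => ?_⟩
  rw [OFrame.flip_dir]
  exact h t h0 h1 _ (by linarith) (by linarith)

theorem OFrame.flip_flip (B : OFrame) : B.flip.flip = B := by
  simp [OFrame.flip]

theorem freeDir_flip_iff : FreeDir S o B.flip a b ↔ FreeDir S o B (-b) (-a) := by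
  constructor
  · intro h
    have := h.flip
    rwa [OFrame.flip_flip] at this
  · intro h
    have := h.flip
    rwa [neg_neg, neg_neg] at this

theorem freeDir_rot_iff : FreeDir S o (B.rot c) a b ↔ FreeDir S o B (c + a) (c + b) := by
  constructor
  · rintro ⟨R, hR, h⟩
    refine ⟨R, hR, fun t h0 h1 β hβ hβ' => ?_⟩
    have := h t h0 h1 (β - c) (by linarith) (by linarith)
    rwa [OFrame.rot_dir, add_sub_cancel] at this
  · rintro ⟨R, hR, h⟩
    refine ⟨R, hR, fun t h0 h1 β hβ hβ' => ?_⟩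
    rw [OFrame.rot_dir]
    exact h t h0 h1 _ (by linarith) (by linarith)

/-- A nonnegative combination of two directions points between them. -/
theorem OFrame.exists_polar_between (B : OFrame) (hab : a ≤ b) (hb : b < a + Real.pi) {p q : ℝ}
    (hp : 0 ≤ p) (hq : 0 ≤ q) :
    ∃ φ, a ≤ φ ∧ φ ≤ b ∧ p • B.dir a + q • B.dir b = ‖p • B.dir a + q • B.dir b‖ • B.dir φ := by
  set v := p • B.dir a + q • B.dir b with hv
  rcases hab.eq_or_lt with h | h
  · refine ⟨a, le_rfl, hab, ?_⟩
    have : v = (p + q) • B.dir a := by rw [hv, ← h]; module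
    rw [this, B.norm_smul_dir (by positivity)]
  rcases eq_or_ne v 0 with h0 | h0
  · exact ⟨a, le_rfl, hab, by rw [h0]; simp⟩
  have hvn : 0 < ‖v‖ := norm_pos_iff.2 h0
  obtain ⟨φ, h1, h2, hφ⟩ := (B.rot a).exists_polar v
  rw [OFrame.rot_dir] at hφ
  have hs : 0 < Real.sin (b - a) := Real.sin_pos_of_pos_of_lt_pi (by linarith) (by linarith)
  have e1 : ‖v‖ * Real.sin φ = q * Real.sin (b - a) := by
    have : inner ℝ (B.dir (a + Real.pi / 2)) v = q * Real.sin (b - a) := by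
      rw [hv, inner_add_right, inner_smul_right, inner_smul_right, B.inner_dir, B.inner_dir,
        ← Real.cos_pi_div_two_sub, add_sub_cancel_left, Real.cos_pi_div_two]
      ring_nf
    rw [← this]
    nth_rw 2 [hφ]
    rw [inner_smul_right, B.inner_dir, ← Real.cos_pi_div_two_sub]
    ring_nf
  have e2 : ‖v‖ * Real.sin (b - a - φ) = p * Real.sin (b - a) := by
    have : inner ℝ (B.dir (b - Real.pi / 2)) v = p * Real.sin (b - a) := by
      rw [hv, inner_add_right, inner_smul_right, inner_smul_right, B.inner_dir, B.inner_dir,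
        ← Real.cos_pi_div_two_sub, ← Real.cos_neg, sub_sub_cancel_left,
        Real.cos_neg (Real.pi / 2), Real.cos_pi_div_two]
      ring_nf
    rw [← this]
    nth_rw 2 [hφ]
    rw [inner_smul_right, B.inner_dir, ← Real.cos_pi_div_two_sub, ← Real.cos_neg]
    ring_nf
  refine ⟨a + φ, ?_, ?_, hφ⟩
  · by_contra hc
    have := Real.sin_neg_of_neg_of_neg_pi_lt (x := φ) (by linarith) h1
    have := mul_neg_of_pos_of_neg hvn this
    have := mul_nonneg hq hs.le
    linarith
  · by_contra hc
    have := Real.sin_neg_of_neg_of_neg_pi_lt (x := b - a - φ) (by linarith) (by linarith)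
    have := mul_neg_of_pos_of_neg hvn this
    have := mul_nonneg hp hs.le
    linarith

theorem OFrame.dir_eq_comb_between (B : OFrame) (hab : a < b) (hb : b < a + Real.pi) (φ : ℝ) :
    B.dir φ = (Real.sin (b - φ) / Real.sin (b - a)) • B.dir a +
      (Real.sin (φ - a) / Real.sin (b - a)) • B.dir b := by
  have := (B.rot a).dir_eq_comb (α := b - a)
    (Real.sin_pos_of_pos_of_lt_pi (by linarith) (by linarith)).ne' (φ - a)
  simpa [OFrame.rot_dir] using this

theorem FreeDir.free (h : FreeDir S o B a b) (hab : a ≤ b) (hb : b < a + Real.pi) (hr : 0 < r)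
    (hs : 0 < s) : Free S o (r • B.dir a) (s • B.dir b) := by
  obtain ⟨R, hR, h⟩ := h
  refine ⟨R / (r + s), by positivity, fun p q hp hq h0 h1 => ?_⟩
  obtain ⟨φ, hφ1, hφ2, hφ⟩ := B.exists_polar_between hab hb (p := p * r) (q := q * s)
    (by positivity) (by positivity)
  rw [smul_smul, smul_smul, hφ]
  rw [lt_div_iff₀ (by positivity)] at h1
  refine h _ (norm_pos_iff.2 fun hz => ?_) ?_ φ hφ1 hφ2
  · have h2 := B.inner_dir a b
    have h3 : ‖(p * r) • B.dir a‖ ^ 2 = ‖-((q * s) • B.dir b)‖ ^ 2 := by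
      rw [eq_neg_of_add_eq_zero_left hz]
    have h4 : p * r = q * s := by
      rw [norm_neg, B.norm_smul_dir (by positivity), B.norm_smul_dir (by positivity)] at h3
      exact (pow_left_inj₀ (by positivity) (by positivity) two_ne_zero).1 h3
    have hpr : 0 < p * r := by
      rcases hp.eq_or_lt with h | h
      · have : 0 < q := by linarith
        rw [h4]; positivity
      · positivity
    rw [← h4] at hz
    have h5 : inner ℝ (B.dir a) ((p * r) • B.dir a + (p * r) • B.dir b) = 0 := by
      rw [hz, inner_zero_right]
    rw [inner_add_right, inner_smul_right, inner_smul_right, B.inner_dir, B.inner_dir, sub_self,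
      Real.cos_zero, ← mul_add] at h5
    have h6 : 1 + Real.cos (a - b) = 0 := by simpa [hpr.ne'] using h5
    have h7 := Real.cos_lt_cos_of_nonneg_of_le_pi (x := b - a) (y := Real.pi) (by linarith) le_rfl
      (by linarith)
    rw [Real.cos_pi, ← Real.cos_neg, neg_sub] at h7
    linarith
  · refine lt_of_le_of_lt (norm_add_le _ _) ?_
    rw [B.norm_smul_dir (by positivity), B.norm_smul_dir (by positivity)]
    nlinarith [mul_nonneg hp hs.le, mul_nonneg hq hr.le]

theorem Free.freeDir (h : Free S o (r • B.dir a) (s • B.dir b)) (hr : 0 < r)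
    (hs : 0 < s) (hab : a ≤ b) (hb : b < a + Real.pi) : FreeDir S o B a b := by
  obtain ⟨R, hR, h⟩ := h
  rcases hab.eq_or_lt with he | he
  · refine ⟨R * r, by positivity, fun t h0 h1 β hβ hβ' => ?_⟩
    have : β = a := by linarith
    subst this
    have := h (t / r) 0 (by positivity) le_rfl (by positivity) (by
      rw [add_zero, div_lt_iff₀ hr]; exact h1)
    rwa [smul_smul, div_mul_cancel₀ _ hr.ne', zero_smul, add_zero] at this
  have hsn : 0 < Real.sin (b - a) := Real.sin_pos_of_pos_of_lt_pi (by linarith) (by linarith)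
  set M := 1 / Real.sin (b - a) / r + 1 / Real.sin (b - a) / s with hM
  have hM0 : 0 < M := by positivity
  refine ⟨R / M, by positivity, fun t h0 h1 β hβ hβ' => ?_⟩
  rw [lt_div_iff₀ hM0] at h1
  have e1 : 0 ≤ Real.sin (b - β) := Real.sin_nonneg_of_nonneg_of_le_pi (by linarith) (by linarith)
  have e2 : 0 ≤ Real.sin (β - a) := Real.sin_nonneg_of_nonneg_of_le_pi (by linarith) (by linarith)
  have := h (t * (Real.sin (b - β) / Real.sin (b - a) / r))
    (t * (Real.sin (β - a) / Real.sin (b - a) / s)) (by positivity) (by positivity) ?_ ?_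
  · rw [B.dir_eq_comb_between he hb β, smul_add, smul_smul, smul_smul]
    rw [smul_smul, smul_smul] at this
    convert this using 4
    · field_simp
    · field_simp
  · rw [← mul_add]
    refine mul_pos h0 ?_
    rcases hβ.eq_or_lt with h | h
    · rw [← h, sub_self, Real.sin_zero]; positivity
    · have : 0 < Real.sin (β - a) := Real.sin_pos_of_pos_of_lt_pi (by linarith) (by linarith)
      positivity
  · refine lt_of_le_of_lt ?_ h1
    rw [← mul_add, hM]
    have := Real.sin_le_one (b - β)
    have := Real.sin_le_one (β - a)
    gcongr

theorem grid_induction {P : ℝ → Prop} {η ψ : ℝ} (hη : 0 < η) (hψ : 0 ≤ ψ) (h0 : P 0)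
    (h : ∀ β β', 0 ≤ β → P β → β ≤ β' → β' ≤ β + η → β' ≤ ψ → P β') : P ψ := by
  have key : ∀ k : ℕ, P (min (k * η) ψ) := by
    intro k
    induction k with
    | zero => simpa [hψ] using h0
    | succ k ih =>
      refine h _ _ (le_min (by positivity) hψ) ih ?_ ?_ (min_le_right _ _)
      · refine min_le_min_right _ ?_
        push_cast; nlinarith
      · rw [min_add_add_right ..|>.symm]
        refine min_le_min ?_ (by linarith)
        push_cast; linarith
  obtain ⟨k, hk⟩ := exists_nat_gt (ψ / η)
  have := key k
  rwa [min_eq_right ((div_le_iff₀ hη).1 hk.le)] at this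

end Polar

section Accumulation

variable {U V : Set (Euc 2)} {B : OFrame}

theorem OFrame.norm_dir_sub_le (B : OFrame) (a b : ℝ) : ‖B.dir a - B.dir b‖ ≤ |a - b| := by
  refine abs_le_of_sq_le_sq' ?_ (abs_nonneg _) |>.2
  rw [@norm_sub_sq_real, B.norm_dir, B.norm_dir, B.inner_dir, sq_abs]
  have := Real.one_sub_sq_div_two_le_cos (x := a - b)
  linarith

theorem Sees.ptLE_dir {y e : HausdorffBoundary U} (h : Sees y e) {L β η : ℝ}
    (hL : rel y e = L • B.dir 0) (hL0 : 0 < L) (hβ : 0 ≤ β) (hβ' : β < Real.pi)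
    (hF : FreeDir U (hbSupport y) B 0 β) (hη : 0 < η) :
    ∃ ρ > 0, ∀ t : ℝ, 0 < t → t < ρ →
      PtLE (hbSupport y + t • B.dir β) y t ∧
      PtLE (hbSupport y + t • B.dir β) e (L - t * Real.cos β + η * t) := by
  obtain ⟨R, hR, hf⟩ := hF.free hβ (by linarith) hL0 one_pos
  rw [← hL, one_smul] at hf
  set M := 1 + 1 / (2 * η) with hM
  have hM1 : 1 < M := by rw [hM]; linarith [show 0 < 1 / (2 * η) by positivity]
  set K := 1 + M / L with hK
  have hK1 : 1 < K := by rw [hK]; linarith [show 0 < M / L by positivity]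
  refine ⟨min (R / K) (L / M), by positivity, fun t h0 h1 => ?_⟩
  have h2 : t * K < R := (lt_div_iff₀ (by positivity)).1 (h1.trans_le (min_le_left _ _))
  have h3 : t * M < L := (lt_div_iff₀ (by positivity)).1 (h1.trans_le (min_le_right _ _))
  have htR : t < R := by nlinarith
  constructor
  · have := wedge_ptLE h hf le_rfl h0.le (by linarith) (by linarith)
    rwa [zero_smul, zero_add, B.norm_smul_dir h0.le] at this
  have hseg : segment ℝ (hbSupport y + t • B.dir β) (hbSupport y + (t * M / L) • rel y e) ⊆ U := by
    refine segment_subset_of_smul fun r hr hr' => ?_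
    have := hf (r * (t * M / L)) ((1 - r) * t) (by positivity)
      (mul_nonneg (by linarith) h0.le) ?_ ?_
    · convert this using 2
      module
    · rcases hr.eq_or_lt with h | h
      · subst h; simpa using h0
      · have : 0 < r * (t * M / L) := by positivity
        have := mul_nonneg (sub_nonneg.2 hr') h0.le
        linarith
    · refine lt_of_le_of_lt ?_ h2
      have e : t * K = t + t * M / L := by rw [hK]; ring
      rw [e]
      have : 0 ≤ t * M / L := by positivity
      nlinarith
  have h4 := (IntLE.of_segment hseg).trans_pt
    (h.smul_ptLE_right (t := t * M / L) (by positivity) ((div_lt_one hL0).2 h3))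
  refine h4.mono ?_
  rw [dist_add_left, hL, B.norm_smul_dir hL0.le, smul_smul, div_mul_cancel₀ _ hL0.ne',
    dist_eq_norm]
  have h5 : ‖t • B.dir β - (t * M) • B.dir 0‖ ≤ t * (M - Real.cos β + η) := by
    have hc : 0 < M - Real.cos β := by linarith [Real.cos_le_one β]
    refine abs_le_of_sq_le_sq' ?_ (by positivity) |>.2
    rw [@norm_sub_sq_real, B.norm_smul_dir h0.le, B.norm_smul_dir (by positivity),
      inner_smul_left, inner_smul_right, B.inner_dir, sub_zero, conj_trivial]
    have h6 : 1 = 2 * η * (M - 1) := by rw [hM]; field_simp; ring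
    have h7 : 2 * η * (M - 1) ≤ 2 * η * (M - Real.cos β) := by
      have := Real.cos_le_one β
      gcongr
    have h8 : t ^ 2 * 1 ≤ t ^ 2 * (2 * η * (M - Real.cos β)) := by
      gcongr; linarith
    have h9 : 0 ≤ t ^ 2 * η ^ 2 := by positivity
    have h10 : 0 ≤ t ^ 2 * Real.cos β ^ 2 := by positivity
    nlinarith
  have h6 : (1 - t * M / L) * L = L - t * M := by field_simp
  rw [h6]
  nlinarith

theorem Sees.freeDir_map (I : HBIso U V) {y e : HausdorffBoundary U} (h : Sees y e) {L φ ψ : ℝ}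
    {B' : OFrame} (hL0 : 0 < L) (hL : rel y e = L • B.dir 0) (hL' : rel (I y) (I e) = L • B'.dir 0)
    (hF : FreeDir U (hbSupport y) B (-φ) φ) (hφ : φ ≤ Real.pi) (h0 : 0 ≤ ψ) (hψ : ψ < φ)
    (hψ' : ψ < Real.pi / 2) : FreeDir V (hbSupport (I y)) B' 0 ψ := by
  set c := max (Real.cos φ) 0 with hc
  have hcψ : c < Real.cos ψ := max_lt (Real.cos_lt_cos_of_nonneg_of_le_pi h0 hφ hψ)
    (Real.cos_pos_of_mem_Ioo ⟨by linarith, hψ'⟩)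
  have hc0 : 0 ≤ c := le_max_right _ _
  set η := (Real.cos ψ - c) / 4 with hη
  have hη0 : 0 < η := by rw [hη]; linarith
  have hI := h.map I
  obtain ⟨R, hR, hf⟩ := hF
  refine grid_induction (P := fun β => FreeDir V (hbSupport (I y)) B' 0 β) hη0 h0 ?_ ?_
  · refine ⟨L, hL0, fun t ht ht' β hβ hβ' => ?_⟩
    have : β = 0 := le_antisymm hβ' hβ
    have h2 := hI.smul_mem (t := t / L) (by positivity) ((div_lt_one hL0).2 ht')
    rwa [hL', smul_smul, div_mul_cancel₀ _ hL0.ne', ← this] at h2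
  intro β β' hβ0 hβ hββ' hβ'1 hβ'ψ
  refine hβ.union (c := β) ?_ le_rfl
  obtain ⟨ρ, hρ, hN⟩ := hI.ptLE_dir hL' hL0 hβ0 (by linarith [Real.pi_pos]) hβ hη0
  obtain ⟨R', hR', hβf⟩ := hβ
  refine ⟨min (min ρ R') (R / (1 + η)), by positivity, fun t ht ht' γ hγ hγ' => ?_⟩
  have ht1 : t < ρ := ht'.trans_le ((min_le_left _ _).trans (min_le_left _ _))
  have ht2 : t < R' := ht'.trans_le ((min_le_left _ _).trans (min_le_right _ _))
  have ht3 : t * (1 + η) < R := (lt_div_iff₀ (by positivity)).1 (ht'.trans_le (min_le_right _ _))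
  by_contra hq
  have hw : hbSupport (I y) + t • B'.dir β ∈ V := hβf t ht ht2 β hβ0 le_rfl
  obtain ⟨τ, g, hτ0, hτ1, -, hg⟩ := exists_first_hit_elem I.isOpen_right hw hq
  have hg0 := (hg 0 le_rfl hτ0).2
  rw [AffineMap.lineMap_apply_zero] at hg0
  have hd : dist (hbSupport (I y) + t • B'.dir β) (hbSupport (I y) + t • B'.dir γ) ≤ t * η := by
    rw [dist_add_left, dist_eq_norm, ← smul_sub, norm_smul, Real.norm_of_nonneg ht.le]
    have := B'.norm_dir_sub_le β γ
    have h5 : |β - γ| ≤ η := abs_le.2 ⟨by linarith, by linarith⟩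
    gcongr; linarith
  have hg1 : PtLE (hbSupport (I y) + t • B'.dir β) g (t * η) := hg0.mono (by
      nlinarith [dist_nonneg (x := hbSupport (I y) + t • B'.dir β)
        (y := hbSupport (I y) + t • B'.dir γ)])
  obtain ⟨hNy, hNe⟩ := hN t ht ht1
  have b1 := I.bdLE_symm_iff.2 (hNy.add_pt hg1)
  have b2 := I.bdLE_symm_iff.2 (hNe.add_pt hg1)
  set g' := I.symm g
  have d1 := b1.dist_le
  have d2 := b2.dist_le
  rw [← norm_rel] at d1
  have d3 : ‖L • B.dir 0 - rel y g'‖ ≤ L - t * Real.cos β + η * t + t * η := by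
    rw [← hL]; rw [dist_eq_norm] at d2
    simpa [rel] using d2
  have d4 : L - inner ℝ (B.dir 0) (rel y g') ≤ ‖L • B.dir 0 - rel y g'‖ := by
    have := real_inner_le_norm (B.dir 0) (L • B.dir 0 - rel y g')
    rwa [inner_sub_right, inner_smul_right, B.inner_dir, B.norm_dir, sub_self, Real.cos_zero,
      one_mul, mul_one] at this
  have hcos : Real.cos ψ ≤ Real.cos β :=
    Real.cos_le_cos_of_nonneg_of_le_pi hβ0 (by linarith) (by linarith)
  have d5 : t * (c + 2 * η) ≤ inner ℝ (B.dir 0) (rel y g') := by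
    have : t * Real.cos ψ ≤ t * Real.cos β := by gcongr
    have e : Real.cos ψ = c + 4 * η := by rw [hη]; ring
    rw [e] at this
    linarith
  obtain ⟨χ, hχ1, hχ2, hχ⟩ := B.exists_polar (rel y g')
  have hpos : 0 < ‖rel y g'‖ := by
    refine norm_pos_iff.2 fun hz => ?_
    rw [hz, inner_zero_right] at d5
    have : 0 < t * (c + 2 * η) := by positivity
    linarith
  have d6 : φ < |χ| := by
    by_contra hcon
    rw [not_lt, abs_le] at hcon
    have := hf ‖rel y g'‖ hpos (by linarith) χ hcon.1 hcon.2
    rw [← hχ, add_rel] at this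
    exact hbSupport_notMem I.isOpen_left _ this
  have d7 : Real.cos χ ≤ c := by
    rw [← Real.cos_abs]
    exact (Real.cos_le_cos_of_nonneg_of_le_pi (h0.trans hψ.le) (abs_le.2 ⟨hχ1.le, hχ2⟩) d6.le).trans
      (le_max_left _ _)
  have d8 : inner ℝ (B.dir 0) (rel y g') ≤ (t + t * η) * c := by
    rw [hχ, inner_smul_right, B.inner_dir, zero_sub, Real.cos_neg]
    exact (mul_le_mul_of_nonneg_left d7 hpos.le).trans (mul_le_mul_of_nonneg_right d1 hc0)
  have hc1 : c ≤ 1 := hcψ.le.trans (Real.cos_le_one _)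
  have : t * η * c ≤ t * η * 1 := by gcongr
  nlinarith [mul_pos ht hη0]

end Accumulation

section Opening

variable {U V : Set (Euc 2)} {B : OFrame}

theorem min_sin_le_sin {a b s : ℝ} (ha : 0 ≤ a) (hb : b ≤ Real.pi) (has : a ≤ s) (hsb : s ≤ b) :
    min (Real.sin a) (Real.sin b) ≤ Real.sin s :=
  strictConcaveOn_sin_Icc.concaveOn.min_le_of_mem_Icc ⟨ha, has.trans (hsb.trans hb)⟩
    ⟨ha.trans (has.trans hsb), hb⟩ ⟨has, hsb⟩

set_option maxHeartbeats 4000000 in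
theorem exists_hit_beyond (hU : IsOpen U) {x y e : HausdorffBoundary U} (hx : Sees y x)
    (he : Sees y e) {L r a ω M : ℝ} (hL : rel y x = L • B.dir 0) (hL0 : 0 < L)
    (hr : rel y e = r • B.dir a) (hr0 : 0 < r) (ha : 0 < a) (hω0 : 0 ≤ ω) (hω : a + ω < Real.pi)
    (hM : 0 < M)
    (hrob : ∀ s t : ℝ, 0 ≤ s → 0 ≤ t → 0 < s + t → s < M * (1 - t) →
      hbSupport y + (s • B.dir 0 + t • rel y e) ∈ U) :
    ∃ C > 0, ∀ η : ℝ, 0 < η → η ≤ 1 → ∀ β : ℝ, 0 ≤ β → FreeDir U (hbSupport y) B (-β) a →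
      ∃ ρ > 0, ∀ t : ℝ, 0 < t → t < ρ → ∀ γ : ℝ, β ≤ γ → γ ≤ β + η → γ ≤ ω →
        hbSupport y + t • B.dir (-γ) ∉ U →
        ∃ g, Sees e g ∧ BdLE g y (t * (1 + C * η)) ∧
          BdLE g x (L - t * (Real.cos β - C * η)) ∧
          r - t * (Real.cos (a + β) + C * η) ≤ ‖rel e g‖ := by
  set c := min (Real.sin a) (Real.sin (a + ω)) with hc
  have hsa : 0 < Real.sin a := Real.sin_pos_of_pos_of_lt_pi ha (by linarith)
  have hc0 : 0 < c := lt_min hsa (Real.sin_pos_of_pos_of_lt_pi (by linarith) hω)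
  have hc1 : c ≤ 1 := (min_le_left _ _).trans (Real.sin_le_one _)
  have hcs : ∀ s, 0 ≤ s → s ≤ ω → c ≤ Real.sin (a + s) := fun s h0 h1 =>
    min_sin_le_sin ha.le hω.le (by linarith) (by linarith)
  set K := (r + 1) / (r * c) with hK
  have hK0 : 0 < K := by positivity
  refine ⟨3 * K + 3, by positivity, fun η hη hη1 β hβ hF => ?_⟩
  rcases lt_or_ge ω β with hβω | hβω
  · exact ⟨1, one_pos, fun t _ _ γ h1 _ h2 => absurd (h1.trans h2) (not_le.2 hβω)⟩
  have hFN : FreeDir U (hbSupport y) B.flip 0 β := by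
    rw [freeDir_flip_iff]; exact hF.mono le_rfl (by linarith)
  obtain ⟨ρ, hρ, hN⟩ := hx.ptLE_dir (B := B.flip) (by rwa [OFrame.flip_dir, neg_zero]) hL0 hβ
    (by linarith) hFN hη
  obtain ⟨R, hR, hf⟩ := hF
  refine ⟨min (min 1 (M * Real.sin a)) (min (R / (1 / Real.sin a + 1)) (ρ * c)), by positivity,
    fun t ht htρ γ hβγ hγη hγω hq => ?_⟩
  have ht1 : t < 1 := htρ.trans_le ((min_le_left _ _).trans (min_le_left _ _))
  have htM : t < M * Real.sin a := htρ.trans_le ((min_le_left _ _).trans (min_le_right _ _))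
  have htR : t * (1 / Real.sin a + 1) < R := (lt_div_iff₀ (by positivity)).1
    (htρ.trans_le ((min_le_right _ _).trans (min_le_left _ _)))
  have htc : t < ρ * c := htρ.trans_le ((min_le_right _ _).trans (min_le_right _ _))
  set E := rel y e with hE
  set q := t • B.dir (-γ) with hqdef
  have hsaβ : 0 < Real.sin (a + β) := hc0.trans_le (hcs β hβ hβω)
  have hsaγ : 0 < Real.sin (a + γ) := hc0.trans_le (hcs γ (by linarith) hγω)
  have hsγ : 0 ≤ Real.sin γ := Real.sin_nonneg_of_nonneg_of_le_pi (by linarith) (by linarith)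
  -- coordinates of `q` in the basis `dir 0`, `E`
  set sq := t * (Real.sin (a + γ) / Real.sin a) with hsq
  set k := t * (Real.sin γ / Real.sin a) / r with hk
  have hsq0 : 0 < sq := by positivity
  have hk0 : 0 ≤ k := by positivity
  have hsqM : sq < M := by
    have : t / Real.sin a < M := (div_lt_iff₀ hsa).2 htM
    refine lt_of_le_of_lt ?_ this
    rw [hsq, mul_div_assoc', div_le_div_iff_of_pos_right hsa]
    exact mul_le_of_le_one_right ht.le (Real.sin_le_one _)
  have hkr : k * r ≤ t / Real.sin a := by
    rw [hk, div_mul_cancel₀ _ hr0.ne', mul_div_assoc', div_le_div_iff_of_pos_right hsa]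
    exact mul_le_of_le_one_right ht.le (Real.sin_le_one _)
  have hqc : q = sq • B.dir 0 - k • E := by
    have := B.dir_eq_comb_between (a := 0) (b := a) ha (by linarith) (-γ)
    rw [sub_zero, sub_zero, sub_neg_eq_add, Real.sin_neg] at this
    rw [hqdef, this, hr, smul_smul, smul_add, smul_smul, smul_smul, hk,
      div_mul_cancel₀ _ hr0.ne', sub_eq_add_neg, ← neg_smul]
    congr 2
    ring
  -- coordinates of `q` in the basis `dir (-β)`, `dir a`
  set A := Real.sin (a + γ) / Real.sin (a + β) with hA
  set D := Real.sin (γ - β) / Real.sin (a + β) with hD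
  have hA0 : 0 < A := by positivity
  have hD0 : 0 ≤ D := div_nonneg
    (Real.sin_nonneg_of_nonneg_of_le_pi (by linarith) (by linarith)) hsaβ.le
  have hqd : q = (t * A) • B.dir (-β) - (t * D) • B.dir a := by
    have := B.dir_eq_comb_between (a := -β) (b := a) (by linarith) (by linarith) (-γ)
    have e1 : Real.sin (-γ - -β) = - Real.sin (γ - β) := by rw [← Real.sin_neg]; ring_nf
    rw [e1, sub_neg_eq_add, sub_neg_eq_add] at this
    rw [hqdef, this, hA, hD]
    module
  set W := q - E with hW
  have hWn : ‖W‖ ≤ r + 1 := by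
    refine (norm_sub_le _ _).trans ?_
    rw [hr, hqdef, B.norm_smul_dir ht.le, B.norm_smul_dir hr0.le]; linarith
  have hFe : Free U (hbSupport e) (rel e y) W := by
    refine ⟨1 / (1 + k), by positivity, fun s u hs hu h0 h1 => ?_⟩
    rw [lt_div_iff₀ (by positivity)] at h1
    have hsk : 0 ≤ s * k := by positivity
    have := hrob (u * sq) (1 - s - u - u * k) (by positivity) (by linarith) ?_ ?_
    · convert this using 1
      rw [← add_rel y e, hW, hqc, ← hE]
      have : rel e y = -E := by rw [hE, rel, rel, neg_sub]
      rw [this]; module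
    · have : 0 ≤ u * sq := by positivity
      rcases hu.eq_or_lt with h | h
      · subst h
        linarith
      · have : 0 < u * sq := by positivity
        linarith
    · rcases hu.eq_or_lt with h | h
      · subst h
        have : 0 < M * s := mul_pos hM (by linarith)
        linarith
      · have : u * sq < u * M := by gcongr
        have : 0 ≤ M * s := by positivity
        have : 0 ≤ M * (u * k) := by positivity
        linarith
  have hW0 : (0 : ℝ) • rel e y + (1 : ℝ) • W ≠ 0 := by
    rw [zero_smul, zero_add, one_smul, hW, sub_ne_zero]
    intro h
    have : inner ℝ (B.dir (a + Real.pi / 2)) q = inner ℝ (B.dir (a + Real.pi / 2)) E := by rw [h]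
    rw [hr, hqdef, inner_smul_right, inner_smul_right, B.inner_dir, B.inner_dir, add_sub_cancel_left,
      Real.cos_pi_div_two, mul_zero, sub_neg_eq_add, add_right_comm, Real.cos_add_pi_div_two] at this
    have := mul_pos ht hsaγ
    linarith
  obtain ⟨g, τ, hτ0, hτ1, hg, hseg⟩ := sees_first_hit hU he.symm hFe (s := 0) (t := 1) le_rfl
    zero_le_one (by
      rw [zero_smul, zero_add, one_smul, hW, ← add_rel y e, ← hE, add_add_sub_cancel]
      exact hq) hW0
  rw [zero_smul, zero_add, one_smul] at hg
  set τ₂ := r / (r + t * D) with hτ₂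
  have htD : 0 ≤ t * D := by positivity
  have hτ₂0 : 0 < τ₂ := by positivity
  have hτ₂1 : τ₂ ≤ 1 := (div_le_one (by positivity)).2 (by linarith)
  have hw2 : E + τ₂ • W = (τ₂ * (t * A)) • B.dir (-β) := by
    have : (1 - τ₂) * r = τ₂ * (t * D) := by rw [hτ₂]; field_simp; ring
    have e : E + τ₂ • W = ((1 - τ₂) * r - τ₂ * (t * D)) • B.dir a + (τ₂ * (t * A)) • B.dir (-β) := by
      rw [hW, hqd, hr]; module
    rw [e, this, sub_self, zero_smul, zero_add]
  have hpg : hbSupport g = hbSupport y + (E + τ • W) := by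
    rw [← add_rel e g, hg, ← add_rel y e, add_assoc]
  have hτ : τ₂ < τ := by
    by_contra hcon
    rw [not_lt] at hcon
    refine hbSupport_notMem hU g ?_
    have hco : E + τ • W = (τ * sq) • B.dir 0 + (1 - τ - τ * k) • E := by
      rw [hW, hqc]; module
    rcases le_or_gt 0 (1 - τ - τ * k) with h | h
    · rw [hpg, hco]
      refine hrob _ _ (by positivity) h (by positivity) ?_
      have : τ * sq < τ * M := by gcongr
      have : 0 ≤ M * (τ * k) := by positivity
      linarith
    have hnz : E + τ • W ≠ 0 := by
      intro hz
      rw [hco] at hz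
      have : inner ℝ (B.dir (a - Real.pi / 2)) ((τ * sq) • B.dir 0 + (1 - τ - τ * k) • E) = 0 := by
        rw [hz, inner_zero_right]
      rw [hr, inner_add_right, inner_smul_right, inner_smul_right, inner_smul_right, B.inner_dir,
        B.inner_dir, sub_sub_cancel_left, Real.cos_neg, Real.cos_pi_div_two, sub_zero,
        Real.cos_sub_pi_div_two] at this
      have : 0 < τ * sq * Real.sin a := by positivity
      linarith
    have hcv : E + τ • W = (τ / τ₂ * (τ₂ * (t * A))) • B.dir (-β) + ((1 - τ / τ₂) * r) • B.dir a := by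
      rw [← smul_smul, ← hw2, hr, smul_add, smul_smul, smul_smul, div_mul_cancel₀ _ hτ₂0.ne']
      module
    obtain ⟨φ, hφ1, hφ2, hφ⟩ := B.exists_polar_between (a := -β) (b := a) (by linarith)
      (by linarith) (p := τ / τ₂ * (τ₂ * (t * A))) (q := (1 - τ / τ₂) * r) (by positivity)
      (mul_nonneg (sub_nonneg.2 ((div_le_one hτ₂0).2 hcon)) hr0.le)
    rw [← hcv] at hφ
    rw [hpg, hφ]
    refine hf _ (norm_pos_iff.2 hnz) (lt_of_le_of_lt ?_ htR) φ hφ1 hφ2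
    have : E + τ • W = (1 - τ) • E + τ • q := by rw [hW]; module
    rw [this]
    refine (norm_add_le _ _).trans ?_
    rw [norm_smul, norm_smul, hr, hqdef, B.norm_smul_dir ht.le, B.norm_smul_dir hr0.le,
      Real.norm_of_nonneg hτ0.le, Real.norm_of_nonneg (by linarith)]
    have e1 : (1 - τ) * r ≤ k * r := by
      refine mul_le_mul_of_nonneg_right ?_ hr0.le
      have := mul_le_of_le_one_left hk0 hτ1
      linarith
    have e2 : τ * t ≤ t := mul_le_of_le_one_left ht.le hτ1
    have e3 : t * (1 / Real.sin a + 1) = t / Real.sin a + t := by ring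
    linarith
  have hgn : ‖rel e g‖ = τ * ‖W‖ := by rw [hg, norm_smul, Real.norm_of_nonneg hτ0.le]
  have hw2pt : PtLE (hbSupport y + (τ₂ * (t * A)) • B.flip.dir β) g ((τ - τ₂) * ‖W‖) := by
    have := hseg.smul_ptLE_right (t := τ₂ / τ) (by positivity) ((div_lt_one hτ0).2 hτ)
    rw [hgn, hg, smul_smul, div_mul_cancel₀ _ hτ0.ne', ← add_rel y e, add_assoc, ← hE, hw2] at this
    rw [OFrame.flip_dir]
    convert this using 1
    field_simp
  have hDc : D ≤ η / c := by
    rw [hD]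
    refine div_le_div₀ hη.le ?_ hc0 (hcs β hβ hβω)
    exact (Real.sin_le (by linarith)).trans (by linarith)
  have hgap : (1 - τ₂) * ‖W‖ ≤ K * η * t := by
    have h1 : 1 - τ₂ ≤ t * (η / c) / r := by
      have : 1 - τ₂ = t * D / (r + t * D) := by rw [hτ₂]; field_simp; ring
      rw [this]
      refine div_le_div₀ (by positivity) (by gcongr) hr0 (by linarith)
    calc (1 - τ₂) * ‖W‖ ≤ t * (η / c) / r * (r + 1) := by gcongr
      _ = K * η * t := by rw [hK]; field_simp
  have hgap' : (τ - τ₂) * ‖W‖ ≤ K * η * t := by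
    refine le_trans ?_ hgap
    gcongr
  set t₂ := τ₂ * (t * A) with ht₂
  have ht₂0 : 0 < t₂ := by positivity
  have ht₂ρ : t₂ < ρ := by
    have : t * A ≤ t * (1 / c) := by
      gcongr
      exact div_le_div₀ zero_le_one (Real.sin_le_one _) hc0 (hcs β hβ hβω)
    have h2 : t * (1 / c) < ρ := by rw [mul_one_div]; exact (div_lt_iff₀ hc0).2 htc
    have h3 : t₂ ≤ t * A := mul_le_of_le_one_left (by positivity) hτ₂1
    linarith
  have htt : |t₂ - t| ≤ K * η * t + t * η := by
    have h1 : t₂ • B.dir (-β) - t • B.dir (-β) = (-(1 - τ₂)) • W + t • (B.dir (-γ) - B.dir (-β)) := by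
      rw [ht₂, ← hw2, smul_sub t, ← hqdef, hW]; module
    have h2 : ‖t₂ • B.dir (-β) - t • B.dir (-β)‖ = |t₂ - t| := by
      rw [← sub_smul, norm_smul, B.norm_dir, mul_one, Real.norm_eq_abs]
    rw [← h2, h1]
    refine (norm_add_le _ _).trans ?_
    rw [norm_smul, norm_smul, Real.norm_of_nonneg ht.le, norm_neg,
      Real.norm_of_nonneg (by linarith)]
    have h3 := B.norm_dir_sub_le (-γ) (-β)
    have h4 : |-γ - -β| ≤ η := abs_le.2 ⟨by linarith, by linarith⟩
    have h5 : t * ‖B.dir (-γ) - B.dir (-β)‖ ≤ t * η := by gcongr; linarith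
    linarith
  rw [abs_le] at htt
  obtain ⟨hNy, hNx⟩ := hN t₂ ht₂0 ht₂ρ
  have hKηt : 0 ≤ K * η * t := by positivity
  have hηt : 0 ≤ η * t := by positivity
  refine ⟨g, hseg, (hw2pt.add_pt hNy).mono ?_, (hw2pt.add_pt hNx).mono ?_, ?_⟩
  · linarith
  · have h1 : t * Real.cos β - t₂ * Real.cos β ≤ K * η * t + t * η := by
      have h2 := Real.cos_le_one β
      have h3 := Real.neg_one_le_cos β
      rcases le_total t₂ t with h | h
      · have := mul_le_mul_of_nonneg_left h2 (sub_nonneg.2 h)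
        linarith
      · have := mul_le_mul_of_nonneg_left h3 (sub_nonneg.2 h)
        linarith
    have h4 : η * t₂ ≤ η * t + K * η * t + t * η := by
      have e1 : η * t₂ ≤ η * (t + (K * η * t + t * η)) := by gcongr; linarith
      have e2 : η * (K * η * t) ≤ 1 * (K * η * t) := by gcongr
      have e3 : η * (t * η) ≤ 1 * (t * η) := by gcongr
      linarith
    linarith
  · rw [hgn]
    have h1 : r - t * Real.cos (a + γ) ≤ ‖W‖ := by
      have := real_inner_le_norm (B.dir a) (-W)
      rw [norm_neg, B.norm_dir, one_mul] at this
      refine le_trans (le_of_eq ?_) this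
      rw [hW, neg_sub, inner_sub_right, hr, hqdef, inner_smul_right, inner_smul_right, B.inner_dir,
        B.inner_dir, sub_self, Real.cos_zero, mul_one, sub_neg_eq_add]
    have h2 : Real.cos (a + γ) ≤ Real.cos (a + β) :=
      Real.cos_le_cos_of_nonneg_of_le_pi (by linarith) (by linarith) (by linarith)
    have h3 : t * Real.cos (a + γ) ≤ t * Real.cos (a + β) := by gcongr
    have h4 : τ₂ * ‖W‖ ≤ τ * ‖W‖ := by gcongr
    linarith

end Opening

section Opening

variable {U V : Set (Euc 2)} {B : OFrame}

theorem inner_ge_of_cap_exact {X E v : Euc 2} {β : ℝ} (hX : X ≠ 0) (hE : E ≠ 0) (hv : ‖v‖ ≤ 1)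
    (hXv : ‖X‖ * Real.cos β ≤ inner ℝ X v) (h0 : 0 < β) (hβ : β < Real.pi)
    (h1 : β + angle X E ≤ Real.pi) : ‖E‖ * Real.cos (β + angle X E) ≤ inner ℝ E v := by
  obtain ⟨B, hBX, hBE⟩ := OFrame.exists_adapted hX hE
  set θ := angle X E
  have hθ : 0 ≤ θ := InnerProductGeometry.angle_nonneg _ _
  have hEn : 0 < ‖E‖ := norm_pos_iff.2 hE
  have hXn : 0 < ‖X‖ := norm_pos_iff.2 hX
  rw [hBX, inner_smul_left, conj_trivial, norm_smul, norm_norm, B.norm_dir, mul_one] at hXv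
  have a1 : Real.cos β ≤ inner ℝ (B.dir 0) v := le_of_mul_le_mul_left hXv hXn
  have a2 : inner ℝ (B.dir (-β)) v ≤ 1 := by
    have := real_inner_le_norm (B.dir (-β)) v
    rw [B.norm_dir, one_mul] at this
    exact this.trans hv
  have hs : 0 < Real.sin β := Real.sin_pos_of_pos_of_lt_pi h0 hβ
  have hc := B.dir_eq_comb_between (a := -β) (b := 0) (by linarith) (by linarith) θ
  rw [zero_sub, zero_sub, neg_neg, sub_neg_eq_add, Real.sin_neg] at hc
  have a3 : inner ℝ (B.dir θ) v * Real.sin β =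
      Real.sin (θ + β) * inner ℝ (B.dir 0) v - Real.sin θ * inner ℝ (B.dir (-β)) v := by
    rw [hc, inner_add_left, inner_smul_left, inner_smul_left, conj_trivial, conj_trivial]
    field_simp
    ring
  have a4 : Real.sin θ = Real.sin (θ + β) * Real.cos β - Real.cos (β + θ) * Real.sin β := by
    have := Real.sin_sub (θ + β) β
    rw [add_sub_cancel_right] at this
    rw [this, add_comm β θ]
  have a5 : 0 ≤ Real.sin (θ + β) :=
    Real.sin_nonneg_of_nonneg_of_le_pi (by linarith) (by linarith)
  have a6 : 0 ≤ Real.sin θ := Real.sin_nonneg_of_nonneg_of_le_pi hθ (by linarith)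
  have a7 : Real.cos (β + θ) * Real.sin β ≤ inner ℝ (B.dir θ) v * Real.sin β := by
    have := mul_le_mul_of_nonneg_left a1 a5
    have := mul_le_mul_of_nonneg_left a2 a6
    linarith
  have a8 := le_of_mul_le_mul_right a7 hs
  have : inner ℝ E v = ‖E‖ * inner ℝ (B.dir θ) v := by
    rw [hBE, inner_smul_left, conj_trivial, norm_smul, norm_norm, B.norm_dir, mul_one]
  rw [this]
  gcongr

theorem cos_sub_cos_ge {s δ : ℝ} (h0 : 0 ≤ s) (hδ : 0 ≤ δ) (h1 : s + δ ≤ Real.pi) :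
    1 - Real.cos δ ≤ Real.cos s - Real.cos (s + δ) := by
  have e1 : Real.cos s - Real.cos (s + δ) = 2 * Real.sin (s + δ / 2) * Real.sin (δ / 2) := by
    have h1 := Real.cos_sub (s + δ / 2) (δ / 2)
    have h2 := Real.cos_add (s + δ / 2) (δ / 2)
    rw [add_sub_cancel_right] at h1
    rw [show s + δ / 2 + δ / 2 = s + δ by ring] at h2
    rw [h1, h2]; ring
  have e2 : 1 - Real.cos δ = 2 * Real.sin (δ / 2) * Real.sin (δ / 2) := by
    have : δ = 2 * (δ / 2) := by ring
    rw [this, Real.cos_two_mul, Real.cos_sq']; ring_nf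
  rw [e1, e2]
  have h2 : 0 ≤ Real.sin (δ / 2) :=
    Real.sin_nonneg_of_nonneg_of_le_pi (by linarith) (by linarith)
  have h3 := min_sin_le_sin (a := δ / 2) (b := Real.pi - δ / 2) (s := s + δ / 2) (by linarith)
    (by linarith) (by linarith) (by linarith)
  rw [Real.sin_pi_sub, min_self] at h3
  gcongr

theorem inner_gt_of_cap {X E v : Euc 2} {β a a₁ ε : ℝ} (hX : X ≠ 0) (hE : E ≠ 0)
    (hβ : 0 ≤ β) (hE1 : angle X E ≤ a₁) (ha : a₁ < a) (hβa : β + a ≤ Real.pi) (hε : 0 ≤ ε)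
    (hε' : 2 * ε < 1 - Real.cos ((a - a₁) / 2)) (hv : ‖v‖ ≤ 1 + ε)
    (hXv : ‖X‖ * (Real.cos β - ε) ≤ inner ℝ X v) :
    ‖E‖ * (Real.cos (a + β) + ε) < inner ℝ E v := by
  set δ := (a - a₁) / 2 with hδ
  have hδ0 : 0 < δ := by rw [hδ]; linarith
  have hθ := InnerProductGeometry.angle_nonneg X E
  have hEn : 0 < ‖E‖ := norm_pos_iff.2 hE
  have c1 := cos_sub_cos_ge (s := β) (δ := δ) hβ hδ0.le (by linarith)
  have c2 := cos_sub_cos_ge (s := β + δ + a₁) (δ := δ) (by linarith) hδ0.le (by linarith)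
  have c3 : β + δ + a₁ + δ = a + β := by rw [hδ]; ring
  rw [c3] at c2
  have c4 : Real.cos (β + δ + a₁) ≤ Real.cos (β + δ + angle X E) :=
    Real.cos_le_cos_of_nonneg_of_le_pi (by linarith) (by linarith) (by linarith)
  have k1 := Real.cos_le_one (β + δ)
  have k2 := Real.neg_one_le_cos (β + δ + angle X E)
  have hp : (0:ℝ) < 1 + ε := by linarith
  have := inner_ge_of_cap_exact (v := (1 + ε)⁻¹ • v) (β := β + δ) hX hE ?_ ?_ (by linarith)
    (by linarith) (by linarith)
  · rw [inner_smul_right, ← div_eq_inv_mul, le_div_iff₀ hp] at this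
    refine lt_of_lt_of_le ?_ this
    rw [mul_assoc]
    refine mul_lt_mul_of_pos_left ?_ hEn
    have := mul_le_mul_of_nonneg_right k2 hε
    linarith
  · rw [norm_smul, Real.norm_of_nonneg (by positivity), ← div_eq_inv_mul, div_le_one hp]
    exact hv
  · rw [inner_smul_right, ← div_eq_inv_mul, le_div_iff₀ hp]
    refine le_trans ?_ hXv
    rw [mul_assoc]
    refine mul_le_mul_of_nonneg_left ?_ (norm_nonneg _)
    have := mul_le_mul_of_nonneg_right k1 hε
    linarith

theorem freeDir_of_angle_map_lt (I : HBIso U V) {x y e : HausdorffBoundary U} (hx : Sees y x)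
    (he : Sees y e) {L r a ω M : ℝ} (hL : rel y x = L • B.dir 0) (hL0 : 0 < L)
    (hr : rel y e = r • B.dir a) (hr0 : 0 < r) (ha : 0 < a) (hω0 : 0 ≤ ω) (hω : a + ω < Real.pi)
    (hM : 0 < M)
    (hrob : ∀ s t : ℝ, 0 ≤ s → 0 ≤ t → 0 < s + t → s < M * (1 - t) →
      hbSupport y + (s • B.dir 0 + t • rel y e) ∈ U) (h0 : FreeDir U (hbSupport y) B 0 a)
    (hangle : angle (rel (I y) (I x)) (rel (I y) (I e)) < a) :
    FreeDir U (hbSupport y) B (-ω) a := by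
  set a₁ := angle (rel (I y) (I x)) (rel (I y) (I e)) with ha₁
  have ha₁0 : 0 ≤ a₁ := InnerProductGeometry.angle_nonneg _ _
  obtain ⟨C, hC, hstep⟩ := exists_hit_beyond I.isOpen_left hx he hL hL0 hr hr0 ha hω0 hω hM hrob
  set m := 1 - Real.cos ((a - a₁) / 2) with hm
  have hm0 : 0 < m := by
    have := Real.cos_lt_cos_of_nonneg_of_le_pi (x := 0) (y := (a - a₁) / 2) le_rfl (by linarith)
      (by linarith)
    rw [Real.cos_zero] at this
    rw [hm]; linarith
  set η := min 1 (min 1 (m / 3) / (C + 1)) with hη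
  have hη0 : 0 < η := by positivity
  have hη1 : η ≤ 1 := min_le_left _ _
  have hη2 : η * (C + 1) ≤ min 1 (m / 3) := (le_div_iff₀ (by positivity)).1 (min_le_right _ _)
  set ε := η * (C + 1) with hε
  have hε0 : 0 < ε := by positivity
  have hε1 : ε ≤ 1 := hη2.trans (min_le_left _ _)
  have hεm : ε ≤ m / 3 := hη2.trans (min_le_right _ _)
  refine grid_induction (P := fun β => FreeDir U (hbSupport y) B (-β) a) hη0 hω0 (by simpa using h0)
    ?_
  intro β β' hβ0 hβ hββ' hβ'1 hβ'ω
  refine FreeDir.union (b := -β) ?_ hβ le_rfl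
  obtain ⟨ρ, hρ, hst⟩ := hstep η hη0 hη1 β hβ0 hβ
  refine ⟨min ρ (r * η / 2), by positivity, fun t ht htρ γ hγ hγ' => ?_⟩
  have ht1 : t < ρ := htρ.trans_le (min_le_left _ _)
  have ht2 : t < r * η / 2 := htρ.trans_le (min_le_right _ _)
  by_contra hq
  rw [← neg_neg γ] at hq
  obtain ⟨g, hge, hgy, hgx, hgn⟩ := hst t ht ht1 (-γ) (by linarith) (by linarith) (by linarith) hq
  have hIx := (hx.map I).norm_rel_pos
  have hIe := (he.map I).norm_rel_pos
  have nx : ‖rel (I y) (I x)‖ = L := by rw [hx.norm_rel_map I, hL, B.norm_smul_dir hL0.le]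
  have ne : ‖rel (I y) (I e)‖ = r := by rw [he.norm_rel_map I, hr, B.norm_smul_dir hr0.le]
  have dy := (I.bdLE_iff.2 hgy).dist_le
  have dx := (I.bdLE_iff.2 hgx).dist_le
  rw [← hge.norm_rel_map I] at hgn
  set w := rel (I y) (I g) with hw
  rw [dist_comm, ← norm_rel, ← hw] at dy
  have dx' : ‖rel (I y) (I x) - w‖ ≤ L - t * (Real.cos β - C * η) := by
    rw [dist_comm, dist_eq_norm] at dx
    simpa [hw, rel] using dx
  have de' : r - t * (Real.cos (a + β) + C * η) ≤ ‖w - rel (I y) (I e)‖ := by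
    simpa [hw, rel] using hgn
  have hεC : C * η ≤ ε := by rw [hε]; linarith
  have k1 : ‖t⁻¹ • w‖ ≤ 1 + ε := by
    rw [norm_smul, Real.norm_of_nonneg (by positivity), ← div_eq_inv_mul, div_le_iff₀ ht]
    have : t * (C * η) ≤ t * ε := by gcongr
    linarith
  have k2 : ‖rel (I y) (I x)‖ * (Real.cos β - ε) ≤ inner ℝ (rel (I y) (I x)) (t⁻¹ • w) := by
    rw [inner_smul_right, ← div_eq_inv_mul, le_div_iff₀ ht]
    have h1 := real_inner_le_norm (rel (I y) (I x)) (rel (I y) (I x) - w)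
    rw [inner_sub_right, real_inner_self_eq_norm_sq, nx] at h1
    have h2 := mul_le_mul_of_nonneg_left dx' hL0.le
    have h3 : L * (t * (C * η)) ≤ L * (t * ε) := by gcongr
    rw [nx]
    linarith
  have k3 := inner_gt_of_cap (norm_pos_iff.1 hIx) (norm_pos_iff.1 hIe) hβ0 le_rfl hangle
    (by linarith) hε0.le (by linarith) k1 k2
  rw [inner_smul_right, ← div_eq_inv_mul, lt_div_iff₀ ht, ne] at k3
  have k4 := @norm_sub_sq_real _ _ _ w (rel (I y) (I e))
  rw [ne, real_inner_comm] at k4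
  have k5 : ‖w‖ ^ 2 ≤ (2 * t) ^ 2 := by
    have : t * (1 + C * η) ≤ 2 * t := by
      have : t * (C * η) ≤ t * 1 := by gcongr; linarith
      linarith
    gcongr
    exact dy.trans this
  have k6 : 0 ≤ r - t * (Real.cos (a + β) + C * η) := by
    have h1 : t * (Real.cos (a + β) + C * η) ≤ t * 2 := by
      gcongr
      linarith [Real.cos_le_one (a + β)]
    have : r * η ≤ r * 1 := by gcongr
    linarith
  have k7 := pow_le_pow_left₀ k6 de' 2
  rw [k4] at k7
  have k8 : t * t ≤ t * (r * η / 2) := by gcongr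
  have k9 : 0 ≤ (t * (Real.cos (a + β) + C * η)) ^ 2 := by positivity
  have k10 : r * (Real.cos (a + β) + ε) * t = r * t * (Real.cos (a + β) + C * η) + r * t * η := by
    rw [hε]; ring
  nlinarith

end Opening

section Rigid

variable {U V : Set (Euc 2)} {B : OFrame} {x y z e e₁ e₂ : HausdorffBoundary U} {a b r s : ℝ}

theorem OFrame.cross_dir_ne_zero (B : OFrame) (hr : 0 < r) (hs : 0 < s) (hab : a < b)
    (hb : b < a + Real.pi) : cross (r • B.dir a) (s • B.dir b) ≠ 0 := by
  intro h
  have h1 := cross_sq (r • B.dir a) (s • B.dir b)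
  rw [h, B.norm_smul_dir hr.le, B.norm_smul_dir hs.le, inner_smul_left, inner_smul_right,
    B.inner_dir] at h1
  simp only [conj_trivial] at h1
  have h2 := Real.sin_sq_add_cos_sq (a - b)
  have h3 : Real.sin (a - b) < 0 := Real.sin_neg_of_neg_of_neg_pi_lt (by linarith) (by linarith)
  have h4 : (r * s) ^ 2 * Real.sin (a - b) ^ 2 = 0 := by
    have : Real.sin (a - b) ^ 2 = 1 - Real.cos (a - b) ^ 2 := by linarith
    rw [this]; linarith
  have : 0 < (r * s) ^ 2 * Real.sin (a - b) ^ 2 := mul_pos (by positivity) (sq_pos_of_neg h3)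
  linarith

theorem BA.of_freeDir (h₁ : Sees y e₁) (h₂ : Sees y e₂) (hr : rel y e₁ = r • B.dir a)
    (hr0 : 0 < r) (hs : rel y e₂ = s • B.dir b) (hs0 : 0 < s) (hab : a < b) (hb : b < a + Real.pi)
    (hF : FreeDir U (hbSupport y) B a b) : BA e₁ y e₂ :=
  ⟨h₁, h₂, by rw [hr, hs]; exact B.cross_dir_ne_zero hr0 hs0 hab hb,
    by rw [hr, hs]; exact hF.free hab.le hb hr0 hs0⟩

theorem BA.freeDir (h : BA e₁ y e₂) (hr : rel y e₁ = r • B.dir a)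
    (hr0 : 0 < r) (hs : rel y e₂ = s • B.dir b) (hs0 : 0 < s) (hab : a ≤ b)
    (hb : b < a + Real.pi) : FreeDir U (hbSupport y) B a b := by
  have := h.free
  rw [hr, hs] at this
  exact this.freeDir hr0 hs0 hab hb

theorem Sees.eq_of_dir (hU : IsOpen U) (h₁ : Sees y e₁) (h₂ : Sees y e₂)
    (hr : rel y e₁ = r • B.dir a) (hr0 : 0 < r) (hs : rel y e₂ = s • B.dir a) (hs0 : 0 < s) :
    e₁ = e₂ := by
  refine h₁.eq_of_ray hU h₂ (div_pos hs0 hr0) ?_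
  change rel y e₂ = (s / r) • rel y e₁
  rw [hr, hs, smul_smul, div_mul_cancel₀ _ hr0.ne']

theorem angle_map_le_of_freeDir (I : HBIso U V) (h₁ : Sees y e₁) (h₂ : Sees y e₂)
    (hr : rel y e₁ = r • B.dir a) (hr0 : 0 < r) (hs : rel y e₂ = s • B.dir b) (hs0 : 0 < s)
    (hab : a ≤ b) (hb : b < a + Real.pi) (hF : FreeDir U (hbSupport y) B a b) :
    angle (rel (I y) (I e₁)) (rel (I y) (I e₂)) ≤ b - a := by
  rcases hab.eq_or_lt with rfl | h
  · rw [h₁.eq_of_dir I.isOpen_left h₂ hr hr0 hs hs0,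
      InnerProductGeometry.angle_self (h₂.map I).rel_ne_zero, sub_self]
  · refine ((BA.of_freeDir h₁ h₂ hr hr0 hs hs0 h hb hF).angle_map_le I).trans_eq ?_
    rw [hr, hs, B.angle_eq_abs hr0 hs0 (by linarith) (by linarith), abs_sub_comm,
      abs_of_nonneg (by linarith)]

theorem BA.exists_pos_le_norm_rel (hU : IsOpen U) (h : BA x y z) : ∃ r > 0,
    ∀ (e : HausdorffBoundary U) (s t : ℝ), 0 ≤ s → 0 ≤ t → 0 < s + t →
      rel y e = s • rel y x + t • rel y z → r ≤ ‖rel y e‖ := by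
  obtain ⟨R, hR, hf⟩ := h.free
  have hXn := h.left.norm_rel_pos
  have hZn := h.right.norm_rel_pos
  have hcr : 0 < |cross (rel y x) (rel y z)| := abs_pos.2 h.indep
  refine ⟨R * |cross (rel y x) (rel y z)| / (‖rel y x‖ + ‖rel y z‖), by positivity, ?_⟩
  intro e s t hs ht h0 he
  rw [div_le_iff₀ (by positivity), he]
  refine norm_ge_of_coords hs ht ?_
  by_contra hc
  have := hf s t hs ht h0 (not_le.1 hc)
  rw [← he, add_rel] at this
  exact hbSupport_notMem hU e this

/-- If a boundary angle shrinks, then the domain is free on the outer side of its edges. -/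
theorem BA.freeDir_extend (I : HBIso U V) (h : BA x y z) {lx lz α ω : ℝ}
    (hx : rel y x = lx • B.dir 0) (hx0 : 0 < lx) (hz : rel y z = lz • B.dir α) (hz0 : 0 < lz)
    (hα : 0 < α) (hlt : angle (rel (I y) (I x)) (rel (I y) (I z)) < α) (hω : 0 ≤ ω)
    (hαω : α + ω < Real.pi) : FreeDir U (hbSupport y) B (-ω) α := by
  have hF := h.freeDir hx hx0 hz hz0 hα.le (by linarith)
  obtain ⟨R, hR, hRe⟩ := h.exists_pos_le_norm_rel I.isOpen_left
  set α' := angle (rel (I y) (I x)) (rel (I y) (I z)) with hα'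
  have hα'0 : 0 ≤ α' := InnerProductGeometry.angle_nonneg _ _
  set μ := min (Real.sin ((α - α') / 2)) (Real.sin ((Real.pi + α) / 2)) with hμ
  have hμ0 : 0 < μ := lt_min (Real.sin_pos_of_pos_of_lt_pi (by linarith) (by linarith))
    (Real.sin_pos_of_pos_of_lt_pi (by linarith) (by linarith))
  obtain ⟨κ, hκ0, hκ1, hκ2⟩ : ∃ κ : ℝ, 0 < κ ∧ κ ≤ (Real.pi - α) / 2 ∧ lz * κ < R * μ := by
    refine ⟨min ((Real.pi - α) / 2) (R * μ / (2 * lz)), lt_min (by linarith) (by positivity),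
      min_le_left _ _, ?_⟩
    have : lz * min ((Real.pi - α) / 2) (R * μ / (2 * lz)) ≤ lz * (R * μ / (2 * lz)) := by
      gcongr; exact min_le_right _ _
    have h2 : lz * (R * μ / (2 * lz)) = R * μ / 2 := by field_simp
    have : 0 < R * μ := by positivity
    linarith
  set n := B.dir (α - Real.pi / 2 + κ) with hn
  have hnd : ∀ φ, inner ℝ n (B.dir φ) = Real.sin (α - φ + κ) := by
    intro φ
    rw [hn, B.inner_dir, ← Real.cos_sub_pi_div_two]
    congr 1; ring
  have hn0 : 0 < inner ℝ n (B.dir 0) := by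
    rw [hnd]; exact Real.sin_pos_of_pos_of_lt_pi (by linarith) (by linarith)
  have hnα : inner ℝ n (B.dir α) = Real.sin κ := by rw [hnd]; congr 1; ring
  have hsκ : 0 < Real.sin κ := Real.sin_pos_of_pos_of_lt_pi hκ0 (by linarith)
  obtain ⟨e, p, q, hp, hq, hpq, heq, hse, hne, hmin⟩ := h.exists_argmin I.isOpen_left (n := n)
    (by rw [hx, inner_smul_right]; positivity) (by rw [hz, inner_smul_right, hnα]; positivity)
  have hpq0 : 0 < p + q := by
    by_contra hc
    have h1 : p = 0 := by linarith
    have h2 : q = 0 := by linarith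
    rw [heq, h1, h2] at hne
    simp at hne
  obtain ⟨a, ha0, haα, ha⟩ := B.exists_polar_between hα.le (by linarith) (p := p * lx)
    (q := q * lz) (by positivity) (by positivity)
  have heq' : rel y e = (p * lx) • B.dir 0 + (q * lz) • B.dir α := by
    rw [heq, hx, hz, smul_smul, smul_smul]
  rw [← heq'] at ha
  have hr0 := hse.norm_rel_pos
  set r := ‖rel y e‖ with hr
  have hrR : R ≤ r := hRe e p q hp hq hpq0 heq
  have hle : inner ℝ n (rel y e) ≤ lz * Real.sin κ := by
    by_contra hc
    refine hbSupport_notMem I.isOpen_left z ?_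
    have := hmin 0 1 le_rfl zero_le_one (by norm_num) ?_
    · rwa [zero_smul, zero_add, one_smul, add_rel] at this
    · rw [zero_smul, zero_add, one_smul, hz, inner_smul_right, hnα]; exact not_le.1 hc
  have ha₁ : (α + α') / 2 < a := by
    by_contra hc
    rw [ha, inner_smul_right, hnd] at hle
    have h1 := min_sin_le_sin (a := (α - α') / 2) (b := (Real.pi + α) / 2) (s := α - a + κ)
      (by linarith) (by linarith) (by linarith) (by linarith)
    have h2 : R * μ ≤ r * Real.sin (α - a + κ) := mul_le_mul hrR h1 hμ0.le hr0.le
    have h3 := mul_le_mul_of_nonneg_left (Real.sin_le hκ0.le) hz0.le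
    linarith
  have hang : angle (rel (I y) (I x)) (rel (I y) (I e)) < a := by
    have h1 := angle_map_le_of_freeDir I hse h.right ha hr0 hz hz0 haα (by linarith)
      (hF.mono ha0 le_rfl)
    have h2 := InnerProductGeometry.angle_le_angle_add_angle (rel (I y) (I x)) (rel (I y) (I z))
      (rel (I y) (I e))
    rw [InnerProductGeometry.angle_comm] at h1
    linarith
  refine (freeDir_of_angle_map_lt I h.left hse hx hx0 ha hr0 (by linarith) hω (by linarith)
    (M := inner ℝ n (rel y e) / inner ℝ n (B.dir 0)) (div_pos hne hn0) ?_
    (hF.mono le_rfl haα) hang).union hF ha0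
  intro s t hs ht hst hlt'
  have key : s • B.dir 0 + t • rel y e = (s / lx + t * p) • rel y x + (t * q) • rel y z := by
    rw [heq, smul_add, smul_smul, smul_smul, add_smul, ← add_assoc]
    congr 2
    rw [hx, smul_smul, div_mul_cancel₀ _ hx0.ne']
  rw [key]
  refine hmin _ _ (by positivity) (by positivity) ?_ ?_
  · rcases hs.eq_or_lt with h0 | h0
    · have : 0 < t * (p + q) := mul_pos (by linarith) hpq0
      rw [← h0, zero_div]; linarith
    · have : 0 < s / lx := by positivity
      have := mul_nonneg ht hp
      have := mul_nonneg ht hq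
      linarith
  · rw [← key, inner_add_right, inner_smul_right, inner_smul_right]
    rw [div_mul_eq_mul_div, lt_div_iff₀ hn0] at hlt'
    linarith

end Rigid

section Cap

variable {S : Set (Euc 2)} {x y z e g : HausdorffBoundary S} {l m s t s₁ t₁ s₂ t₂ : ℝ}

/-- The open cap cut from the sector at `o` spanned by `X`, `Z` by the line `l s + m t = 1`
(in the coordinates with respect to `X`, `Z`) is contained in `S`. -/
def Cap (S : Set (Euc 2)) (o X Z : Euc 2) (l m : ℝ) : Prop :=
  ∀ s t : ℝ, 0 ≤ s → 0 ≤ t → 0 < s + t → l * s + m * t < 1 → o + (s • X + t • Z) ∈ S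

theorem BA.exists_bad (hS : IsOpen S) (h : BA x y z) : ∃ K : Set (ℝ × ℝ), IsCompact K ∧
    ((1:ℝ), (0:ℝ)) ∈ K ∧ ((0:ℝ), (1:ℝ)) ∈ K ∧
    (∀ s t, (s, t) ∈ K → 0 ≤ s ∧ 0 ≤ t ∧ 0 < s + t ∧ s + t ≤ 1 ∧
      hbSupport y + (s • rel y x + t • rel y z) ∉ S) ∧
    ∀ s t : ℝ, 0 ≤ s → 0 ≤ t → 0 < s + t → s + t ≤ 1 →
      hbSupport y + (s • rel y x + t • rel y z) ∉ S → (s, t) ∈ K := by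
  obtain ⟨R, hR, hf⟩ := h.free
  have hxS : hbSupport y + ((1:ℝ) • rel y x + (0:ℝ) • rel y z) ∉ S := by
    rw [one_smul, zero_smul, add_zero, add_rel]; exact hbSupport_notMem hS x
  have hzS : hbSupport y + ((0:ℝ) • rel y x + (1:ℝ) • rel y z) ∉ S := by
    rw [one_smul, zero_smul, zero_add, add_rel]; exact hbSupport_notMem hS z
  have hR1 : R ≤ 1 := by
    by_contra hc
    exact hxS (hf 1 0 zero_le_one le_rfl (by norm_num) (by linarith))
  refine ⟨{q | (0 ≤ q.1 ∧ 0 ≤ q.2 ∧ R ≤ q.1 + q.2 ∧ q.1 + q.2 ≤ 1) ∧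
    hbSupport y + (q.1 • rel y x + q.2 • rel y z) ∉ S}, ?_, ⟨⟨zero_le_one, le_rfl, by simpa,
    by norm_num⟩, hxS⟩, ⟨⟨le_rfl, zero_le_one, by simpa, by norm_num⟩, hzS⟩, ?_, ?_⟩
  · refine (isCompact_Icc (a := ((0:ℝ), (0:ℝ))) (b := (1, 1))).of_isClosed_subset ?_ ?_
    · refine IsClosed.inter ?_ ?_
      · refine (isClosed_le continuous_const continuous_fst).inter
          ((isClosed_le continuous_const continuous_snd).inter
          ((isClosed_le continuous_const (continuous_fst.add continuous_snd)).inter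
          (isClosed_le (continuous_fst.add continuous_snd) continuous_const)))
      · exact (hS.isClosed_compl).preimage
          (f := fun q : ℝ × ℝ => hbSupport y + (q.1 • rel y x + q.2 • rel y z)) (by fun_prop)
    · rintro ⟨s, t⟩ ⟨⟨h1, h2, h3, h4⟩, -⟩
      simp only at h1 h2 h3 h4
      exact ⟨⟨h1, h2⟩, ⟨by simp only; linarith, by simp only; linarith⟩⟩
  · rintro s t ⟨⟨h1, h2, h3, h4⟩, h5⟩
    exact ⟨h1, h2, by simp only at h3; linarith, h4, h5⟩
  · intro s t h1 h2 h3 h4 h5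
    refine ⟨⟨h1, h2, ?_, h4⟩, h5⟩
    by_contra hc
    exact h5 (hf s t h1 h2 h3 (not_le.1 hc))

theorem Cap.one_le_left (hS : IsOpen S) (hc : Cap S (hbSupport y) (rel y x) (rel y z) l m) :
    1 ≤ l := by
  by_contra h
  have := hc 1 0 zero_le_one le_rfl (by norm_num) (by linarith)
  rw [one_smul, zero_smul, add_zero, add_rel] at this
  exact hbSupport_notMem hS x this

theorem Cap.one_le_right (hS : IsOpen S) (hc : Cap S (hbSupport y) (rel y x) (rel y z) l m) :
    1 ≤ m := by
  by_contra h
  have := hc 0 1 le_rfl zero_le_one (by norm_num) (by linarith)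
  rw [one_smul, zero_smul, zero_add, add_rel] at this
  exact hbSupport_notMem hS z this

/-- A boundary point on the line bounding a free cap is visible from the apex. -/
theorem Cap.exists_sees (hS : IsOpen S) (h : BA x y z)
    (hc : Cap S (hbSupport y) (rel y x) (rel y z) l m) (hs : 0 ≤ s) (ht : 0 ≤ t)
    (h1 : l * s + m * t = 1) (hq : hbSupport y + (s • rel y x + t • rel y z) ∉ S) :
    ∃ e, rel y e = s • rel y x + t • rel y z ∧ Sees y e := by
  obtain ⟨e, τ, hτ0, hτ1, he, hsee⟩ := sees_first_hit hS h.left h.free hs ht hq (by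
    intro h0
    obtain ⟨rfl, rfl⟩ := (comb_eq_zero_iff h.indep).1 h0
    norm_num at h1)
  have hst : 0 < s + t := by
    by_contra hn
    have h3 : s = 0 := by linarith
    have h4 : t = 0 := by linarith
    rw [h3, h4] at h1; norm_num at h1
  have hτ : τ = 1 := by
    refine le_antisymm hτ1 (not_lt.1 fun hlt => ?_)
    have h2 := hc (τ * s) (τ * t) (by positivity) (by positivity)
      (by rw [← mul_add]; positivity) (by
        have : l * (τ * s) + m * (τ * t) = τ * (l * s + m * t) := by ring
        rw [this, h1]; linarith)
    rw [show (τ * s) • rel y x + (τ * t) • rel y z = τ • (s • rel y x + t • rel y z) by module,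
      ← he, add_rel] at h2
    exact hbSupport_notMem hS e h2
  exact ⟨e, by rw [he, hτ, one_smul], hsee⟩

/-- Two boundary points on the line bounding a free cap see each other
if the open segment between them is free. -/
theorem Cap.sees (hS : IsOpen S)
    (hc : Cap S (hbSupport y) (rel y x) (rel y z) l m) (he : Sees y e) (hg : Sees y g)
    (hs₁ : 0 ≤ s₁) (ht₁ : 0 ≤ t₁) (hs₂ : 0 ≤ s₂) (ht₂ : 0 ≤ t₂)
    (he' : rel y e = s₁ • rel y x + t₁ • rel y z) (hg' : rel y g = s₂ • rel y x + t₂ • rel y z)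
    (h₁ : l * s₁ + m * t₁ = 1) (h₂ : l * s₂ + m * t₂ = 1) (hne : hbSupport e ≠ hbSupport g)
    (hm : ∀ k : ℝ, 0 < k → k < 1 →
      hbSupport y + ((1 - k) • rel y e + k • rel y g) ∈ S) : Sees e g := by
  have hpos : ∀ {s t : ℝ}, 0 ≤ s → 0 ≤ t → l * s + m * t = 1 → 0 < s + t := by
    intro s t hs ht h
    by_contra hn
    have h3 : s = 0 := by linarith
    have h4 : t = 0 := by linarith
    rw [h3, h4] at h; norm_num at h
  refine Sees.of_bdLE hS hne ?_ (BdLE.of_forall_pos fun ε hε => ?_)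
  · intro w hw
    rw [openSegment_eq_image_lineMap] at hw
    obtain ⟨k, ⟨hk0, hk1⟩, rfl⟩ := hw
    have := hm k hk0 hk1
    convert this using 1
    rw [AffineMap.lineMap_apply, vsub_eq_sub, vadd_eq_add, rel, rel]; module
  · set A := ‖rel y e‖ + ‖rel y g‖ with hA
    have hA0 : 0 < A := add_pos he.norm_rel_pos hg.norm_rel_pos
    set δ := min (1 / 2) (ε / A) with hδ
    have hδ0 : 0 < δ := by positivity
    have hδ1 : δ ≤ 1 / 2 := min_le_left _ _
    have hδ2 : δ * A ≤ ε := (le_div_iff₀ hA0).1 (min_le_right _ _)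
    have p1 := he.smul_ptLE_right (t := 1 - δ) (by linarith) (by linarith)
    have p2 := hg.smul_ptLE_right (t := 1 - δ) (by linarith) (by linarith)
    have hseg : segment ℝ (hbSupport y + (1 - δ) • rel y e) (hbSupport y + (1 - δ) • rel y g) ⊆ S := by
      refine segment_subset_of_smul fun k hk0 hk1 => ?_
      have := hc ((1 - δ) * ((1 - k) * s₁ + k * s₂)) ((1 - δ) * ((1 - k) * t₁ + k * t₂))
        (mul_nonneg (by linarith) (add_nonneg (mul_nonneg (by linarith) hs₁) (by positivity)))
        (mul_nonneg (by linarith) (add_nonneg (mul_nonneg (by linarith) ht₁) (by positivity)))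
        ?_ ?_
      · convert this using 2
        rw [he', hg']; module
      · have e1 : (1 - δ) * ((1 - k) * s₁ + k * s₂) + (1 - δ) * ((1 - k) * t₁ + k * t₂) =
          (1 - δ) * ((1 - k) * (s₁ + t₁) + k * (s₂ + t₂)) := by ring
        rw [e1]
        have q1 := hpos hs₁ ht₁ h₁
        have q2 := hpos hs₂ ht₂ h₂
        refine mul_pos (by linarith) ?_
        rcases hk1.eq_or_lt with rfl | h
        · linarith
        · have := mul_pos (sub_pos.2 h) q1
          have := mul_nonneg hk0 q2.le
          linarith
      · have e1 : l * ((1 - δ) * ((1 - k) * s₁ + k * s₂)) + m * ((1 - δ) * ((1 - k) * t₁ + k * t₂)) =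
          (1 - δ) * ((1 - k) * (l * s₁ + m * t₁) + k * (l * s₂ + m * t₂)) := by ring
        rw [e1, h₁, h₂]; linarith
    have p3 := IntLE.of_segment hseg
    refine ((p1.add_pt (p3.trans_pt p2)).mono ?_)
    have : dist (hbSupport y + (1 - δ) • rel y e) (hbSupport y + (1 - δ) • rel y g) =
        (1 - δ) * dist (hbSupport e) (hbSupport g) := by
      rw [dist_add_left, dist_eq_norm, ← smul_sub, norm_smul, Real.norm_of_nonneg (by linarith),
        dist_eq_norm, rel, rel, sub_sub_sub_cancel_right]
    rw [this]
    have h3 : 0 ≤ δ * dist (hbSupport e) (hbSupport g) := by positivity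
    rw [hA] at hδ2
    linarith

theorem cap_of_bad {K : Set (ℝ × ℝ)} (h1 : ((1:ℝ), (0:ℝ)) ∈ K)
    (h2 : ((0:ℝ), (1:ℝ)) ∈ K)
    (hK : ∀ s t : ℝ, 0 ≤ s → 0 ≤ t → 0 < s + t → s + t ≤ 1 →
      hbSupport y + (s • rel y x + t • rel y z) ∉ S → (s, t) ∈ K)
    (hf : ∀ s t, (s, t) ∈ K → 1 ≤ l * s + m * t) :
    Cap S (hbSupport y) (rel y x) (rel y z) l m := by
  intro s t hs ht h0 hlt
  by_contra hc
  have hl : 1 ≤ l := by simpa using hf _ _ h1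
  have hm : 1 ≤ m := by simpa using hf _ _ h2
  have := mul_le_mul_of_nonneg_right hl hs
  have := mul_le_mul_of_nonneg_right hm ht
  have := hf s t (hK s t hs ht h0 (by linarith) hc)
  linarith

/-- Either some boundary point is visible from the vertex in a given direction, or that direction
passes through a gap between two boundary points that bounds a free cap. -/
theorem BA.exists_gap (hS : IsOpen S) (h : BA x y z) {p q : ℝ} (hp : 0 < p) (hq : 0 < q) :
    (∃ (e : HausdorffBoundary S) (ρ : ℝ), 0 < ρ ∧ Sees y e ∧ rel y e = ρ • (p • rel y x + q • rel y z)) ∨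
    ∃ (e g : HausdorffBoundary S) (l m s₁ t₁ s₂ t₂ : ℝ), Sees y e ∧ Sees y g ∧ Sees e g ∧
      rel y e = s₁ • rel y x + t₁ • rel y z ∧ rel y g = s₂ • rel y x + t₂ • rel y z ∧
      0 ≤ s₁ ∧ 0 ≤ t₁ ∧ 0 ≤ s₂ ∧ 0 ≤ t₂ ∧ p * t₁ < q * s₁ ∧ q * s₂ < p * t₂ ∧
      l * s₁ + m * t₁ = 1 ∧ l * s₂ + m * t₂ = 1 ∧
      Cap S (hbSupport y) (rel y x) (rel y z) l m := by
  by_cases hA : ∃ ρ : ℝ, 0 < ρ ∧ hbSupport y + ((ρ * p) • rel y x + (ρ * q) • rel y z) ∉ S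
  · obtain ⟨ρ, hρ, hn⟩ := hA
    obtain ⟨e, τ, hτ0, hτ1, he, hsee⟩ := sees_first_hit hS h.left h.free (by positivity)
      (by positivity) hn (by
        intro h0
        have := ((comb_eq_zero_iff h.indep).1 h0).1
        have : 0 < ρ * p := by positivity
        linarith)
    refine Or.inl ⟨e, τ * ρ, by positivity, hsee, ?_⟩
    rw [he]; module
  right
  push Not at hA
  obtain ⟨K, hKc, hKx, hKz, hK1, hK2⟩ := h.exists_bad hS
  have hD0 : ∀ s t, (s, t) ∈ K → q * s ≠ p * t := by
    intro s t hst heq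
    obtain ⟨h1, h2, h3, h4, h5⟩ := hK1 s t hst
    have hs : 0 < s := by
      rcases h1.eq_or_lt with h1 | h1
      · rw [← h1, mul_zero] at heq
        have : t = 0 := by
          rcases mul_eq_zero.1 heq.symm with h | h
          · exact absurd h hp.ne'
          · exact h
        linarith
      · exact h1
    have := hA (s / p) (by positivity)
    rw [div_mul_cancel₀ _ hp.ne', show s / p * q = t by field_simp; linarith] at this
    exact h5 this
  set K₁ := K ∩ {k | p * k.2 ≤ q * k.1} with hK₁
  set K₂ := K ∩ {k | q * k.1 ≤ p * k.2} with hK₂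
  have hc₁ : IsCompact K₁ := hKc.inter_right (isClosed_le (by fun_prop) (by fun_prop))
  have hc₂ : IsCompact K₂ := hKc.inter_right (isClosed_le (by fun_prop) (by fun_prop))
  have hx₁ : ((1:ℝ), (0:ℝ)) ∈ K₁ := ⟨hKx, by simpa using hq.le⟩
  have hz₂ : ((0:ℝ), (1:ℝ)) ∈ K₂ := ⟨hKz, by simpa using hp.le⟩
  have hD₁ : ∀ s t, (s, t) ∈ K₁ → 0 < q * s - p * t := fun s t hst =>
    sub_pos.2 (lt_of_le_of_ne hst.2 (hD0 s t hst.1).symm)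
  have hD₂ : ∀ s t, (s, t) ∈ K₂ → 0 < p * t - q * s := fun s t hst =>
    sub_pos.2 (lt_of_le_of_ne hst.2 (hD0 s t hst.1))
  obtain ⟨⟨⟨a, b⟩, ⟨c, d⟩⟩, ⟨hk₁, hk₂⟩, hmin⟩ := (hc₁.prod hc₂).exists_isMinOn
    ⟨(((1:ℝ), (0:ℝ)), ((0:ℝ), (1:ℝ))), hx₁, hz₂⟩
    (f := fun k : (ℝ × ℝ) × (ℝ × ℝ) => (k.1.1 * k.2.2 - k.1.2 * k.2.1) /
      ((q * k.1.1 - p * k.1.2) + (p * k.2.2 - q * k.2.1))) (by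
      refine ContinuousOn.div (by fun_prop) (by fun_prop) ?_
      rintro ⟨⟨a, b⟩, ⟨c, d⟩⟩ ⟨h1, h2⟩
      exact (add_pos (hD₁ a b h1) (hD₂ c d h2)).ne')
  simp only at hk₁ hk₂
  have hmin' : ∀ a' b' c' d', (a', b') ∈ K₁ → (c', d') ∈ K₂ →
      (a * d - b * c) / ((q * a - p * b) + (p * d - q * c)) ≤
      (a' * d' - b' * c') / ((q * a' - p * b') + (p * d' - q * c')) := fun a' b' c' d' h1 h2 =>
    hmin (show ((a', b'), (c', d')) ∈ K₁ ×ˢ K₂ from ⟨h1, h2⟩)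
  have d1 := hD₁ a b hk₁
  have d2 := hD₂ c d hk₂
  obtain ⟨ha, hb, hab, -, -⟩ := hK1 a b hk₁.1
  obtain ⟨hc, hd, hcd, -, -⟩ := hK1 c d hk₂.1
  set Δ := a * d - b * c with hΔ
  have hΔ0 : 0 < Δ := by
    have e1 : p * Δ = c * (q * a - p * b) + a * (p * d - q * c) := by rw [hΔ]; ring
    have ha0 : 0 < a := by
      have := mul_nonneg hp.le hb
      exact pos_of_mul_pos_right (by linarith : 0 < q * a) hq.le
    have := mul_pos ha0 d2
    have := mul_nonneg hc d1.le
    exact pos_of_mul_pos_right (by linarith : 0 < p * Δ) hp.le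
  have hf : ∀ s t, (s, t) ∈ K → 1 ≤ (d - b) / Δ * s + (a - c) / Δ * t := by
    intro s t hst
    have e1 : (d - b) / Δ * s + (a - c) / Δ * t = ((d - b) * s + (a - c) * t) / Δ := by ring
    rw [e1, le_div_iff₀ hΔ0, one_mul]
    rcases le_total (p * t) (q * s) with hle | hle
    · have hk : (s, t) ∈ K₁ := ⟨hst, hle⟩
      have d3 := hD₁ s t hk
      have := hmin' s t c d hk hk₂
      rw [div_le_div_iff₀ (add_pos d1 d2) (add_pos d3 d2)] at this
      have e2 : (s * d - t * c) * ((q * a - p * b) + (p * d - q * c)) -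
        Δ * ((q * s - p * t) + (p * d - q * c)) =
          (((d - b) * s + (a - c) * t) - Δ) * (p * d - q * c) := by rw [hΔ]; ring
      have := nonneg_of_mul_nonneg_left (by linarith : 0 ≤ (((d - b) * s + (a - c) * t) - Δ) *
        (p * d - q * c)) d2
      linarith
    · have hk : (s, t) ∈ K₂ := ⟨hst, hle⟩
      have d3 := hD₂ s t hk
      have := hmin' a b s t hk₁ hk
      rw [div_le_div_iff₀ (add_pos d1 d2) (add_pos d1 d3)] at this
      have e2 : (a * t - b * s) * ((q * a - p * b) + (p * d - q * c)) -
        Δ * ((q * a - p * b) + (p * t - q * s)) =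
          (((d - b) * s + (a - c) * t) - Δ) * (q * a - p * b) := by rw [hΔ]; ring
      have := nonneg_of_mul_nonneg_left (by linarith : 0 ≤ (((d - b) * s + (a - c) * t) - Δ) *
        (q * a - p * b)) d1
      linarith
  set l := (d - b) / Δ with hl
  set m := (a - c) / Δ with hm
  have f1 : l * a + m * b = 1 := by rw [hl, hm]; field_simp; rw [hΔ]; ring
  have f2 : l * c + m * d = 1 := by rw [hl, hm]; field_simp; rw [hΔ]; ring
  have hcap : Cap S (hbSupport y) (rel y x) (rel y z) l m := cap_of_bad hKx hKz hK2 hf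
  have hl1 := hcap.one_le_left hS
  have hm1 := hcap.one_le_right hS
  have hcl : IsClosed {k : ℝ × ℝ | l * k.1 + m * k.2 = 1} :=
    isClosed_eq (by fun_prop) (by fun_prop)
  obtain ⟨⟨s₁, t₁⟩, ⟨he₁, he₁'⟩, hemin⟩ := (hc₁.inter_right hcl).exists_isMinOn
    ⟨(a, b), hk₁, f1⟩ (f := fun k : ℝ × ℝ => q * k.1 - p * k.2) (by fun_prop)
  obtain ⟨⟨s₂, t₂⟩, ⟨he₂, he₂'⟩, hgmin⟩ := (hc₂.inter_right hcl).exists_isMinOn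
    ⟨(c, d), hk₂, f2⟩ (f := fun k : ℝ × ℝ => p * k.2 - q * k.1) (by fun_prop)
  replace he₁' : l * s₁ + m * t₁ = 1 := he₁'
  replace he₂' : l * s₂ + m * t₂ = 1 := he₂'
  have D1 := hD₁ _ _ he₁
  have D2 := hD₂ _ _ he₂
  obtain ⟨hs₁, ht₁, hst₁, -, hn₁⟩ := hK1 _ _ he₁.1
  obtain ⟨hs₂, ht₂, hst₂, -, hn₂⟩ := hK1 _ _ he₂.1
  obtain ⟨e, he, hse⟩ := hcap.exists_sees hS h hs₁ ht₁ he₁' hn₁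
  obtain ⟨g, hg, hsg⟩ := hcap.exists_sees hS h hs₂ ht₂ he₂' hn₂
  have hne : hbSupport e ≠ hbSupport g := by
    intro heq
    have h1 : rel y e = rel y g := by rw [rel, rel, heq]
    rw [he, hg] at h1
    have h2 : (s₁ - s₂) • rel y x + (t₁ - t₂) • rel y z = 0 := by
      have : (s₁ - s₂) • rel y x + (t₁ - t₂) • rel y z =
        (s₁ • rel y x + t₁ • rel y z) - (s₂ • rel y x + t₂ • rel y z) := by module
      rw [this, h1, sub_self]
    obtain ⟨h3, h4⟩ := (comb_eq_zero_iff h.indep).1 h2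
    rw [sub_eq_zero.1 h3, sub_eq_zero.1 h4] at D1
    linarith
  refine ⟨e, g, l, m, s₁, t₁, s₂, t₂, hse, hsg, hcap.sees hS hse hsg hs₁ ht₁ hs₂ ht₂ he hg he₁' he₂'
    hne ?_, he, hg, hs₁, ht₁, hs₂, ht₂, by linarith, by linarith, he₁', he₂', hcap⟩
  intro k hk0 hk1
  by_contra hcon
  set s := (1 - k) * s₁ + k * s₂ with hs
  set t := (1 - k) * t₁ + k * t₂ with ht
  have hk1' : 0 < 1 - k := by linarith
  have hs0 : 0 ≤ s := by positivity
  have ht0 : 0 ≤ t := by positivity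
  have hst0 : 0 < s + t := by
    have : s + t = (1 - k) * (s₁ + t₁) + k * (s₂ + t₂) := by rw [hs, ht]; ring
    rw [this]; positivity
  have hfst : l * s + m * t = 1 := by
    have : l * s + m * t = (1 - k) * (l * s₁ + m * t₁) + k * (l * s₂ + m * t₂) := by
      rw [hs, ht]; ring
    rw [this, he₁', he₂']; ring
  have hst1 : s + t ≤ 1 := by
    have := mul_le_mul_of_nonneg_right hl1 hs0
    have := mul_le_mul_of_nonneg_right hm1 ht0
    linarith
  have hKst : (s, t) ∈ K := by
    refine hK2 s t hs0 ht0 hst0 hst1 fun hin => hcon ?_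
    convert hin using 2
    rw [he, hg, hs, ht]; module
  have hDst : q * s - p * t = (1 - k) * (q * s₁ - p * t₁) - k * (p * t₂ - q * s₂) := by
    rw [hs, ht]; ring
  have r1 := mul_pos hk0 D1
  have r2 := mul_pos hk0 D2
  have r3 := mul_pos hk1' D1
  have r4 := mul_pos hk1' D2
  rcases le_total (p * t) (q * s) with hle | hle
  · have : q * s₁ - p * t₁ ≤ q * s - p * t := hemin ⟨⟨hKst, hle⟩, hfst⟩
    linarith
  · have : p * t₂ - q * s₂ ≤ p * t - q * s := hgmin ⟨⟨hKst, hle⟩, hfst⟩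
    linarith

end Cap

section Fold

variable {U V : Set (Euc 2)} {x y z e g : HausdorffBoundary U}

theorem inner_rel_map (I : HBIso U V) (hye : Sees y e) (hyg : Sees y g) (heg : Sees e g) :
    inner ℝ (rel (I y) (I e)) (rel (I y) (I g)) = inner ℝ (rel y e) (rel y g) := by
  have h1 : ∀ {S : Set (Euc 2)} (y e g : HausdorffBoundary S), inner ℝ (rel y e) (rel y g) =
      (‖rel y e‖ * ‖rel y e‖ + ‖rel y g‖ * ‖rel y g‖ - ‖rel e g‖ * ‖rel e g‖) / 2 := by
    intro S y e g
    rw [real_inner_comm, real_inner_eq_norm_mul_self_add_norm_mul_self_sub_norm_sub_mul_self_div_two,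
      show rel y g - rel y e = rel e g by unfold rel; abel]
    ring
  rw [h1, h1, hye.norm_rel_map I, hyg.norm_rel_map I, heg.norm_rel_map I]

theorem angle_rel_map (I : HBIso U V) (hye : Sees y e) (hyg : Sees y g) (heg : Sees e g) :
    angle (rel (I y) (I e)) (rel (I y) (I g)) = angle (rel y e) (rel y g) := by
  unfold InnerProductGeometry.angle
  rw [inner_rel_map I hye hyg heg, hye.norm_rel_map I, hyg.norm_rel_map I]

/-- A vector whose angles with two directions add up to at most the angle between them lies
between these directions. -/
theorem OFrame.dir_pin (B : OFrame) {θ γ : ℝ} (hθ : θ < Real.pi) (hγ : 0 ≤ γ) (hγθ : γ ≤ θ)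
    (hθ0 : 0 < θ) {v : Euc 2} (h1 : angle (B.dir 0) v ≤ γ) (h2 : angle v (B.dir θ) ≤ θ - γ) :
    v = ‖v‖ • B.dir γ := by
  have hsin : 0 < Real.sin θ := Real.sin_pos_of_pos_of_lt_pi hθ0 hθ
  have e1 : inner ℝ (B.dir 0) v = Real.cos (angle (B.dir 0) v) * ‖v‖ := by
    rw [← InnerProductGeometry.cos_angle_mul_norm_mul_norm, B.norm_dir, one_mul]
  have e2 : inner ℝ (B.dir θ) v = Real.cos (angle v (B.dir θ)) * ‖v‖ := by
    rw [real_inner_comm, ← InnerProductGeometry.cos_angle_mul_norm_mul_norm, B.norm_dir, mul_one]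
  have c1 : Real.cos γ ≤ Real.cos (angle (B.dir 0) v) :=
    Real.cos_le_cos_of_nonneg_of_le_pi (InnerProductGeometry.angle_nonneg _ _) (by linarith) h1
  have c2 : Real.cos (θ - γ) ≤ Real.cos (angle v (B.dir θ)) :=
    Real.cos_le_cos_of_nonneg_of_le_pi (InnerProductGeometry.angle_nonneg _ _) (by linarith) h2
  have hd := B.dir_eq_comb_between hθ0 (by linarith : θ < 0 + Real.pi) γ
  have e3 : Real.sin θ * inner ℝ (B.dir γ) v =
      Real.sin (θ - γ) * inner ℝ (B.dir 0) v + Real.sin γ * inner ℝ (B.dir θ) v := by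
    rw [hd, inner_add_left, inner_smul_left, inner_smul_left, sub_zero, sub_zero]
    simp only [conj_trivial]
    field_simp
  have s1 : 0 ≤ Real.sin (θ - γ) :=
    Real.sin_nonneg_of_nonneg_of_le_pi (by linarith) (by linarith)
  have s2 : 0 ≤ Real.sin γ := Real.sin_nonneg_of_nonneg_of_le_pi (by linarith) (by linarith)
  have e4 : Real.sin θ * ‖v‖ ≤ Real.sin θ * inner ℝ (B.dir γ) v := by
    have i1 : Real.sin (θ - γ) * (Real.cos γ * ‖v‖) ≤ Real.sin (θ - γ) * inner ℝ (B.dir 0) v := by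
      rw [e1]; gcongr
    have i2 : Real.sin γ * (Real.cos (θ - γ) * ‖v‖) ≤ Real.sin γ * inner ℝ (B.dir θ) v := by
      rw [e2]; gcongr
    have i3 : Real.sin θ = Real.sin (θ - γ) * Real.cos γ + Real.cos (θ - γ) * Real.sin γ := by
      rw [← Real.sin_add]; congr 1; ring
    rw [e3]
    calc _ = Real.sin (θ - γ) * (Real.cos γ * ‖v‖) + Real.sin γ * (Real.cos (θ - γ) * ‖v‖) := by
          rw [i3]; ring
      _ ≤ _ := add_le_add i1 i2
  have e5 : ‖v‖ ≤ inner ℝ (B.dir γ) v := le_of_mul_le_mul_left e4 hsin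
  have e6 : ‖v - ‖v‖ • B.dir γ‖ ^ 2 ≤ 0 := by
    rw [norm_sub_sq_real, inner_smul_right, B.norm_smul_dir (norm_nonneg v), real_inner_comm]
    have := mul_le_mul_of_nonneg_left e5 (norm_nonneg v)
    linarith
  rw [← sub_eq_zero, ← norm_eq_zero]
  exact pow_eq_zero_iff two_ne_zero |>.1 (le_antisymm e6 (sq_nonneg _))

theorem OFrame.transfer (B B' : OFrame) {ρ γ a φ₁ b φ₂ : ℝ}
    (h : ρ • B'.dir γ = a • B'.dir φ₁ + b • B'.dir φ₂) :
    ρ • B.dir γ = a • B.dir φ₁ + b • B.dir φ₂ := by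
  have key : ∀ ψ, ρ * Real.cos (ψ - γ) = a * Real.cos (ψ - φ₁) + b * Real.cos (ψ - φ₂) := by
    intro ψ
    have := congrArg (inner ℝ (B'.dir ψ)) h
    simpa only [inner_add_right, inner_smul_right, B'.inner_dir] using this
  have hu : B.u = B.dir 0 := by simp [OFrame.dir]
  have hv : B.v = B.dir (Real.pi / 2) := by simp [OFrame.dir]
  refine B.ext_inner ?_ ?_
  · rw [hu]; simpa only [inner_add_right, inner_smul_right, B.inner_dir] using key 0
  · rw [hv]; simpa only [inner_add_right, inner_smul_right, B.inner_dir] using key (Real.pi / 2)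

/-- A boundary element of the image seen in a free sector comes from the corresponding
direction, provided the edges of the sector are not spread apart by `I`. -/
theorem HBIso.rel_symm_eq (I : HBIso U V) (hye : Sees y e) (hyg : Sees y g) {B B' : OFrame}
    {k : HausdorffBoundary V} {le lg θ r γ : ℝ} (hk : Sees (I y) k)
    (he : rel y e = le • B.dir 0) (he' : rel (I y) (I e) = le • B'.dir 0) (hle : 0 < le)
    (hg : rel y g = lg • B.dir θ) (hg' : rel (I y) (I g) = lg • B'.dir θ) (hlg : 0 < lg)
    (hk' : rel (I y) k = r • B'.dir γ) (hr : 0 < r) (hγ : 0 ≤ γ) (hγθ : γ ≤ θ) (hθ0 : 0 < θ)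
    (hθ : θ < Real.pi)
    (hF : FreeDir V (hbSupport (I y)) B' 0 θ) : rel y (I.symm k) = r • B.dir γ := by
  have h1 := angle_map_le_of_freeDir I.symm (hye.map I) hk he' hle hk' hr hγ (by linarith)
    (hF.mono le_rfl hγθ)
  have h2 := angle_map_le_of_freeDir I.symm hk (hyg.map I) hk' hr hg' hlg hγθ (by linarith)
    (hF.mono hγ le_rfl)
  have h3 := hk.norm_rel_map I.symm
  simp only [HBIso.symm_apply_apply] at h1 h2 h3
  rw [he, InnerProductGeometry.angle_smul_left_of_pos _ _ hle, sub_zero] at h1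
  rw [hg, InnerProductGeometry.angle_smul_right_of_pos _ _ hlg] at h2
  have := B.dir_pin hθ hγ hγθ hθ0 h1 h2
  rw [this, h3, hk', B'.norm_smul_dir hr.le]

theorem Sees.triangle_map (I : HBIso U V) (hey : Sees e y) (heg : Sees e g) (hyg : Sees y g)
    (hc : cross (rel e y) (rel e g) ≠ 0)
    (hT : ∀ s t : ℝ, 0 < s → 0 < t → s + t < 1 → hbSupport e + (s • rel e y + t • rel e g) ∈ U)
    (hF : Free V (hbSupport (I e)) (rel (I e) (I y)) (rel (I e) (I g))) :
    ∀ s t : ℝ, 0 < s → 0 < t → s + t < 1 →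
      hbSupport (I e) + (s • rel (I e) (I y) + t • rel (I e) (I g)) ∈ V := by
  intro s t hs ht hst
  by_contra hq
  have hθ0 := angle_pos_of_cross hc
  have hθ := angle_lt_pi_of_cross hc
  obtain ⟨B, hX, hZ⟩ := OFrame.exists_adapted hey.rel_ne_zero heg.rel_ne_zero
  obtain ⟨B', hX', hZ'⟩ := OFrame.exists_adapted (hey.map I).rel_ne_zero (heg.map I).rel_ne_zero
  rw [angle_rel_map I hey heg hyg, heg.norm_rel_map I] at hZ'
  rw [hey.norm_rel_map I] at hX'
  have hl1 := hey.norm_rel_pos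
  have hl2 := heg.norm_rel_pos
  set θ := angle (rel e y) (rel e g)
  set l1 := ‖rel e y‖
  set l2 := ‖rel e g‖
  have hF' : FreeDir V (hbSupport (I e)) B' 0 θ := by
    rw [hX', hZ'] at hF
    exact hF.freeDir hl1 hl2 hθ0.le (by linarith)
  have hne : s • rel (I e) (I y) + t • rel (I e) (I g) ≠ 0 := by
    rw [hX', hZ', smul_smul, smul_smul]
    intro h0
    have hcr := B'.cross_dir_ne_zero (mul_pos hs hl1) (mul_pos ht hl2) hθ0 (by linarith)
    have := (comb_eq_zero_iff (s := 1) (t := 1) hcr).1 (by rw [one_smul, one_smul]; exact h0)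
    exact one_ne_zero this.1
  obtain ⟨k, τ, hτ0, hτ1, hk, hsk⟩ := sees_first_hit I.isOpen_right (hey.map I) hF hs.le ht.le hq hne
  obtain ⟨γ, hγ0, hγθ, hγ⟩ := B'.exists_polar_between hθ0.le (by linarith)
    (p := τ * (s * l1)) (q := τ * (t * l2)) (by positivity) (by positivity)
  have hk2 : rel (I e) k = (τ * (s * l1)) • B'.dir 0 + (τ * (t * l2)) • B'.dir θ := by
    rw [hk, hX', hZ']; module
  rw [← hk2] at hγ
  have hrel := I.rel_symm_eq hey heg hsk hX hX' hl1 hZ hZ' hl2 hγ hsk.norm_rel_pos hγ0 hγθ hθ0 hθ hF'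
  rw [B.transfer B' (hγ.symm.trans hk2)] at hrel
  have hmem := hT (τ * s) (τ * t) (by positivity) (by positivity) (by
    have := mul_le_of_le_one_left (by positivity : 0 ≤ s + t) hτ1
    linarith)
  refine hbSupport_notMem I.isOpen_left (I.symm k) ?_
  rw [← add_rel e (I.symm k), hrel]
  convert hmem using 2
  rw [hX, hZ]; module

theorem OFrame.eval_comb (B : OFrame) {r φ a α b β : ℝ} (n₁ n₂ : ℝ)
    (h : a • B.dir α + b • B.dir β = r • B.dir φ) :
    a * (n₁ * Real.cos α + n₂ * Real.sin α) + b * (n₁ * Real.cos β + n₂ * Real.sin β) =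
      r * (n₁ * Real.cos φ + n₂ * Real.sin φ) := by
  have h1 := congrArg (inner ℝ (B.dir 0)) h
  have h2 := congrArg (inner ℝ (B.dir (Real.pi / 2))) h
  simp only [inner_add_right, inner_smul_right, B.inner_dir, zero_sub, Real.cos_neg,
    Real.cos_pi_div_two_sub] at h1 h2
  linear_combination n₁ * h1 + n₂ * h2

/-- If the image folds the edge towards `x` over the segment towards `e`, then the image of
an obtuse empty triangle spanned at `y` by `e` and `g` is free near `y`. -/
theorem freeDir_of_fold (I : HBIso U V) (hyx : Sees y x) (hye : Sees y e) (hyg : Sees y g)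
    (heg : Sees e g) {B B' : OFrame} {lx le lg τ θ n₁ n₂ : ℝ}
    (hx : rel y x = lx • B.dir (-τ)) (hx' : rel (I y) (I x) = lx • B'.dir τ) (hlx : 0 < lx)
    (he : rel y e = le • B.dir 0) (he' : rel (I y) (I e) = le • B'.dir 0) (hle : 0 < le)
    (hg : rel y g = lg • B.dir θ) (hg' : rel (I y) (I g) = lg • B'.dir θ) (hlg : 0 < lg)
    (hτ : 0 < τ) (hθ : Real.pi / 2 < θ) (hτθ : τ + θ < Real.pi) (hn₁ : le * n₁ = 1)
    (hn₂ : lg * (n₁ * Real.cos θ + n₂ * Real.sin θ) = 1)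
    (hcap : ∀ t β : ℝ, 0 < t → -τ ≤ β → β ≤ θ →
      t * (n₁ * Real.cos β + n₂ * Real.sin β) < 1 → hbSupport y + t • B.dir β ∈ U)
    (hF : FreeDir V (hbSupport (I y)) B' 0 τ) : FreeDir V (hbSupport (I y)) B' 0 θ := by
  have hn₁0 : 0 < n₁ := pos_of_mul_pos_right (by rw [hn₁]; exact one_pos) hle.le
  have hsθ : 0 < Real.sin θ := Real.sin_pos_of_pos_of_lt_pi (by linarith) (by linarith)
  have hcθ : Real.cos θ < 0 := Real.cos_neg_of_pi_div_two_lt_of_lt hθ (by linarith)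
  have hn₂0 : 0 < n₂ := by
    have h1 : 0 < n₁ * Real.cos θ + n₂ * Real.sin θ :=
      pos_of_mul_pos_right (by rw [hn₂]; exact one_pos) hlg.le
    have h2 := mul_neg_of_pos_of_neg hn₁0 hcθ
    exact pos_of_mul_pos_left (by linarith : 0 < n₂ * Real.sin θ) hsθ.le
  have hsτ : 0 < Real.sin τ := Real.sin_pos_of_pos_of_lt_pi hτ (by linarith)
  have hA : ∀ t γ : ℝ, 0 < t → 0 < γ → γ ≤ τ →
      t * (n₁ * Real.cos γ + n₂ * Real.sin γ) ≤ 1 → hbSupport (I y) + t • B'.dir γ ∈ V := by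
    intro t γ ht hγ hγτ htN
    by_contra hq
    have hsγ : 0 < Real.sin γ := Real.sin_pos_of_pos_of_lt_pi hγ (by linarith)
    have hfr : Free V (hbSupport (I y)) (rel (I y) (I e)) (rel (I y) (I x)) := by
      rw [he', hx']; exact hF.free hτ.le (by linarith) hle hlx
    have hcomb : (t * Real.sin (τ - γ) / Real.sin τ / le) • rel (I y) (I e) +
        (t * Real.sin γ / Real.sin τ / lx) • rel (I y) (I x) = t • B'.dir γ := by
      rw [he', hx', smul_smul, smul_smul, div_mul_cancel₀ _ hle.ne', div_mul_cancel₀ _ hlx.ne',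
        B'.dir_eq_comb_between hτ (by linarith : τ < 0 + Real.pi) γ, sub_zero, sub_zero]
      module
    have hs1 : 0 ≤ Real.sin (τ - γ) :=
      Real.sin_nonneg_of_nonneg_of_le_pi (by linarith) (by linarith)
    obtain ⟨k, σ, hσ0, hσ1, hk, hsk⟩ := sees_first_hit I.isOpen_right (hye.map I) hfr
      (s := t * Real.sin (τ - γ) / Real.sin τ / le) (t := t * Real.sin γ / Real.sin τ / lx)
      (by positivity) (by positivity) (by rw [hcomb]; exact hq)
      (by rw [hcomb]; exact smul_ne_zero ht.ne' (B'.dir_ne_zero _))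
    rw [hcomb, smul_smul] at hk
    have hr0 : 0 < σ * t := mul_pos hσ0 ht
    have hrel := I.rel_symm_eq hye hyx (B := B.flip) hsk (by rw [he, B.flip_dir, neg_zero]) he' hle
      (by rw [hx, B.flip_dir]) hx' hlx hk hr0 hγ.le hγτ hτ (by linarith) hF
    rw [B.flip_dir] at hrel
    have hge : 1 ≤ σ * t * (n₁ * Real.cos (-γ) + n₂ * Real.sin (-γ)) := by
      by_contra hlt
      have := hcap _ _ hr0 (by linarith) (by linarith) (not_le.1 hlt)
      rw [← hrel, add_rel] at this
      exact hbSupport_notMem I.isOpen_left _ this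
    rw [Real.cos_neg, Real.sin_neg] at hge
    have hle1 : σ * t * (n₁ * Real.cos γ + n₂ * Real.sin γ) ≤ 1 := by
      rw [mul_assoc]
      calc _ ≤ σ * 1 := by gcongr
        _ ≤ 1 := by linarith
    have : 0 < σ * t * (n₂ * Real.sin γ) := mul_pos hr0 (mul_pos hn₂0 hsγ)
    linarith
  have hbase : ∀ {S : Set (Euc 2)} (y e g : HausdorffBoundary S) (s t : ℝ),
      hbSupport e + (s • rel e y + t • rel e g) =
        hbSupport y + ((1 - s - t) • rel y e + t • rel y g) := by
    intro S y e g s t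
    unfold rel; module
  have hpos : ∀ {s t r φ : ℝ} (D : OFrame), 0 < t → 
      (s * le) • D.dir 0 + (t * lg) • D.dir θ = r • D.dir φ → 0 < r * Real.sin φ := by
    intro s t r φ D ht h
    have := D.eval_comb 0 1 h
    simp only [Real.sin_zero, zero_mul, one_mul, zero_add, mul_zero] at this
    rw [← this]; positivity
  have heval : ∀ {s t r φ : ℝ} (D : OFrame),
      (s * le) • D.dir 0 + (t * lg) • D.dir θ = r • D.dir φ →
      r * (n₁ * Real.cos φ + n₂ * Real.sin φ) = s + t := by
    intro s t r φ D h
    rw [← D.eval_comb n₁ n₂ h, Real.cos_zero, Real.sin_zero]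
    linear_combination s * hn₁ + t * hn₂
  have hT := Sees.triangle_map I hye.symm heg hyg ?_ ?_ ?_
  · have hfr : Free V (hbSupport (I y)) (rel (I y) (I e)) (rel (I y) (I g)) := by
      refine ⟨1, one_pos, fun s t hs ht h0 h1 => ?_⟩
      rcases ht.eq_or_lt with rfl | ht
      · rw [zero_smul, add_zero]
        exact (hye.map I).smul_mem (by linarith) (by linarith)
      rcases hs.eq_or_lt with rfl | hs
      · rw [zero_smul, zero_add]
        exact (hyg.map I).smul_mem (by linarith) (by linarith)
      have := hT (1 - s - t) t (by linarith) ht (by linarith)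
      rw [hbase] at this
      convert this using 3
      ring_nf
    rw [he', hg'] at hfr
    exact hfr.freeDir hle hlg (by linarith) (by linarith)
  · have h1 := B.cross_dir_ne_zero hle hlg (a := 0) (b := θ) (by linarith) (by linarith)
    rw [← he, ← hg] at h1
    rw [show rel e y = (-1 : ℝ) • rel y e by unfold rel; module,
      show rel e g = rel y g + (-1 : ℝ) • rel y e by unfold rel; module]
    rw [cross_smul_left, cross_add_right, cross_smul_right, cross_self_eq]
    simpa using h1
  · intro s t hs ht hst
    rw [hbase]
    obtain ⟨φ, hφ0, hφθ, hφ⟩ := B.exists_polar_between (a := 0) (b := θ) (by linarith)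
      (by linarith) (p := (1 - s - t) * le) (q := t * lg)
      (mul_nonneg (by linarith) hle.le) (by positivity)
    have hv : (1 - s - t) • rel y e + t • rel y g =
      ((1 - s - t) * le) • B.dir 0 + (t * lg) • B.dir θ := by rw [he, hg]; module
    rw [hv, hφ]
    have h1 := hpos B ht hφ
    refine hcap _ _ ?_ (by linarith) hφθ (by rw [heval B hφ]; linarith)
    exact pos_of_mul_pos_left h1 (Real.sin_nonneg_of_nonneg_of_le_pi hφ0 (by linarith))
  · have hd : 0 < le * Real.sin τ + lg := by positivity
    refine ⟨le * Real.sin τ / (le * Real.sin τ + lg), by positivity, ?_⟩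
    intro s t hs ht h0 hR
    rw [lt_div_iff₀ hd] at hR
    have hst : s + t < 1 := by
      by_contra hc
      have := mul_le_mul_of_nonneg_right (not_lt.1 hc) hd.le
      linarith
    rw [hbase]
    rcases ht.eq_or_lt with rfl | ht
    · rw [zero_smul, add_zero]
      exact (hye.map I).smul_mem (by linarith) (by linarith)
    obtain ⟨φ, hφ0, hφθ, hφ⟩ := B'.exists_polar_between (a := 0) (b := θ) (by linarith)
      (by linarith) (p := (1 - s - t) * le) (q := t * lg)
      (mul_nonneg (by linarith) hle.le) (by positivity)
    have hv : (1 - s - t) • rel (I y) (I e) + t • rel (I y) (I g) =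
      ((1 - s - t) * le) • B'.dir 0 + (t * lg) • B'.dir θ := by rw [he', hg']; module
    rw [hv, hφ]
    have h1 := hpos B' ht hφ
    have h2 := heval B' hφ
    have h3 := B'.eval_comb (-Real.sin τ) (Real.cos τ) hφ
    set r := ‖((1 - s - t) * le) • B'.dir 0 + (t * lg) • B'.dir θ‖
    have hr : 0 < r :=
      pos_of_mul_pos_left h1 (Real.sin_nonneg_of_nonneg_of_le_pi hφ0 (by linarith))
    have hφ1 : 0 < φ := hφ0.lt_of_ne fun h => by rw [← h] at h1; simp at h1
    refine hA _ _ hr hφ1 ?_ (by rw [h2]; linarith)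
    by_contra hc
    have h4 : 0 < r * Real.sin (φ - τ) :=
      mul_pos hr (Real.sin_pos_of_pos_of_lt_pi (by linarith) (by linarith))
    have h5 : t * lg * Real.sin (θ - τ) ≤ (s + t) * lg := by
      calc _ ≤ t * lg * 1 := by gcongr; exact Real.sin_le_one _
        _ ≤ _ := by rw [mul_one]; gcongr; linarith
    rw [Real.sin_sub] at h4 h5
    rw [Real.cos_zero, Real.sin_zero] at h3
    linarith

end Fold

section AngleEq

variable {U V : Set (Euc 2)} {x y z e g : HausdorffBoundary U} {B B' : OFrame}

theorem Sees.freeDir_map_sector (I : HBIso U V) (h : Sees y e) {L φ ψ c c' : ℝ} (hL0 : 0 < L)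
    (hL : rel y e = L • B.dir c) (hL' : rel (I y) (I e) = L • B'.dir c')
    (hF : FreeDir U (hbSupport y) B (c - φ) (c + φ)) (hφ : φ ≤ Real.pi) (h0 : 0 ≤ ψ) (hψ : ψ < φ)
    (hψ' : ψ < Real.pi / 2) : FreeDir V (hbSupport (I y)) B' (c' - ψ) (c' + ψ) := by
  have hF' : FreeDir U (hbSupport y) (B.rot c) (-φ) φ := freeDir_rot_iff.2 hF
  have hL1 : rel y e = L • (B.rot c).dir 0 := by rw [OFrame.rot_dir, add_zero, hL]
  have h1 := h.freeDir_map I (B' := B'.rot c') hL0 hL1 (by rw [OFrame.rot_dir, add_zero, hL'])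
    hF' hφ h0 hψ hψ'
  have h2 := h.freeDir_map I (B' := (B'.rot c').flip) hL0 hL1
    (by rw [OFrame.flip_dir, OFrame.rot_dir, neg_zero, add_zero, hL']) hF' hφ h0 hψ hψ'
  rw [freeDir_flip_iff, neg_zero] at h2
  exact freeDir_rot_iff.1 (h2.union h1 le_rfl)

theorem angle_le_of_freeDir_map (I : HBIso U V) (hyx : Sees y x) (hyz : Sees y z)
    {r s a b c d : ℝ} (hx : rel (I y) (I x) = r • B'.dir a) (hr : 0 < r)
    (hz : rel (I y) (I z) = s • B'.dir b) (hs : 0 < s) (hab : |a - b| < Real.pi)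
    (hca : c ≤ a) (had : a ≤ d) (hcb : c ≤ b) (hbd : b ≤ d)
    (hF : FreeDir V (hbSupport (I y)) B' c d) : angle (rel y x) (rel y z) ≤ |a - b| := by
  rw [abs_lt] at hab
  rcases le_total a b with h | h
  · have := angle_map_le_of_freeDir I.symm (hyx.map I) (hyz.map I) hx hr hz hs h (by linarith)
      (hF.mono hca hbd)
    simp only [HBIso.symm_apply_apply] at this
    rwa [abs_sub_comm, abs_of_nonneg (sub_nonneg.2 h)]
  · have := angle_map_le_of_freeDir I.symm (hyz.map I) (hyx.map I) hz hs hx hr h (by linarith)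
      (hF.mono hcb had)
    simp only [HBIso.symm_apply_apply] at this
    rwa [InnerProductGeometry.angle_comm, abs_of_nonneg (sub_nonneg.2 h)]

theorem OFrame.exists_polar_of_angle_le (B : OFrame) {v w : Euc 2} {r c δ : ℝ}
    (hv : v = r • B.dir c) (hr : 0 < r) (hw : w ≠ 0) (h : angle v w ≤ δ) :
    ∃ a, |a| ≤ δ ∧ w = ‖w‖ • B.dir (c + a) := by
  obtain ⟨a, h1, h2, ha⟩ := (B.rot c).exists_polar w
  have hwn := norm_pos_iff.2 hw
  refine ⟨a, ?_, by rwa [OFrame.rot_dir] at ha⟩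
  rw [hv, ha, OFrame.rot_dir, B.angle_eq_abs hr hwn (by linarith) (by linarith)] at h
  rwa [sub_add_cancel_left, abs_neg] at h

theorem BA.freeDir_extend_both (I : HBIso U V) (h : BA x y z) {lx lz α ω : ℝ}
    (hx : rel y x = lx • B.dir 0) (hx0 : 0 < lx) (hz : rel y z = lz • B.dir α) (hz0 : 0 < lz)
    (hα : 0 < α) (hlt : angle (rel (I y) (I x)) (rel (I y) (I z)) < α) (hω : 0 ≤ ω)
    (hαω : α + ω < Real.pi) : FreeDir U (hbSupport y) B (-ω) (α + ω) := by
  have h1 := h.freeDir_extend I hx hx0 hz hz0 hα hlt hω hαω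
  have h2 := h.symm.freeDir_extend I (B := (B.rot α).flip) (lx := lz) (lz := lx) (α := α)
    (by rw [OFrame.flip_dir, OFrame.rot_dir, neg_zero, add_zero, hz]) hz0
    (by rw [OFrame.flip_dir, OFrame.rot_dir, add_neg_cancel, hx]) hx0 hα
    (by rwa [InnerProductGeometry.angle_comm]) hω hαω
  rw [freeDir_flip_iff, freeDir_rot_iff, neg_neg] at h2
  exact h1.union (h2.mono (by linarith : α + -α ≤ 0) le_rfl) hα.le

theorem not_fold (I : HBIso U V) (hyx : Sees y x) (hye : Sees y e) (hyg : Sees y g)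
    (hyz : Sees y z) (heg : Sees e g) {lx le lg lz τ ρ θ b n₁ n₂ : ℝ}
    (hx : rel y x = lx • B.dir (-τ)) (hx' : rel (I y) (I x) = lx • B'.dir τ) (hlx : 0 < lx)
    (he : rel y e = le • B.dir 0) (he' : rel (I y) (I e) = le • B'.dir 0) (hle : 0 < le)
    (hg : rel y g = lg • B.dir θ) (hg' : rel (I y) (I g) = lg • B'.dir θ) (hlg : 0 < lg)
    (hz : rel y z = lz • B.dir (θ + ρ)) (hz' : rel (I y) (I z) = lz • B'.dir (θ + b))
    (hlz : 0 < lz) (hτ : 0 < τ) (hb : |b| ≤ ρ) (hθ : Real.pi / 2 < θ)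
    (hsum : τ + θ + ρ < Real.pi) (hn₁ : le * n₁ = 1)
    (hn₂ : lg * (n₁ * Real.cos θ + n₂ * Real.sin θ) = 1)
    (hcap : ∀ t β : ℝ, 0 < t → -τ ≤ β → β ≤ θ →
      t * (n₁ * Real.cos β + n₂ * Real.sin β) < 1 → hbSupport y + t • B.dir β ∈ U)
    (hF₁ : FreeDir V (hbSupport (I y)) B' 0 τ)
    (hF₂ : FreeDir V (hbSupport (I y)) B' (θ - ρ) (θ + ρ)) : False := by
  have hb' := abs_le.1 hb
  have h1 := freeDir_of_fold I hyx hye hyg heg hx hx' hlx he he' hle hg hg' hlg hτ hθ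
    (by linarith) hn₁ hn₂ hcap hF₁
  have h2 := h1.union hF₂ (by linarith)
  have h3 : |τ - (θ + b)| ≤ θ - τ + ρ := abs_le.2 ⟨by linarith, by linarith⟩
  have h4 := angle_le_of_freeDir_map I hyx hyz hx' hlx hz' hlz (h3.trans_lt (by linarith))
    hτ.le (by linarith) (by linarith) (by linarith) h2
  rw [hx, hz, B.angle_eq_abs hlx hlz (by linarith) (by linarith), abs_sub_comm,
    abs_of_nonneg (by linarith)] at h4
  linarith

/-- The case of the angle rigidity argument in which the bisector of the angle leaves the
domain through a gap between `e` and `g`. -/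
theorem angle_map_not_lt_of_gap (I : HBIso U V) (hyx : Sees y x) (hye : Sees y e) (hyg : Sees y g)
    (hyz : Sees y z) (heg : Sees e g) {lx le lg lz τ ρ θ n₁ n₂ : ℝ}
    (hx : rel y x = lx • B.dir (-τ)) (hlx : 0 < lx) (he : rel y e = le • B.dir 0) (hle : 0 < le)
    (hg : rel y g = lg • B.dir θ) (hlg : 0 < lg) (hz : rel y z = lz • B.dir (θ + ρ)) (hlz : 0 < lz)
    (hτ0 : 0 ≤ τ) (hρ0 : 0 ≤ ρ) (hθ0 : 0 < θ) (hsum : τ + θ + ρ < Real.pi)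
    (hτ : τ < θ + ρ) (hρ : ρ < τ + θ) (hn₁ : le * n₁ = 1)
    (hn₂ : lg * (n₁ * Real.cos θ + n₂ * Real.sin θ) = 1)
    (hcap : ∀ t β : ℝ, 0 < t → -τ ≤ β → β ≤ θ + ρ →
      t * (n₁ * Real.cos β + n₂ * Real.sin β) < 1 → hbSupport y + t • B.dir β ∈ U)
    (hW : ∀ ω : ℝ, 0 ≤ ω → τ + θ + ρ + ω < Real.pi →
      FreeDir U (hbSupport y) B (-τ - ω) (θ + ρ + ω))
    (hlt : angle (rel (I y) (I x)) (rel (I y) (I z)) < τ + θ + ρ) : False := by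
  have hFU := hW 0 le_rfl (by linarith)
  rw [sub_zero, add_zero] at hFU
  obtain ⟨B', he', hg'⟩ := OFrame.exists_adapted (hye.map I).rel_ne_zero (hyg.map I).rel_ne_zero
  rw [angle_rel_map I hye hyg heg, hyg.norm_rel_map I, he, hg, B.norm_smul_dir hlg.le,
    B.angle_eq_abs hle hlg (by linarith) (by linarith), zero_sub, abs_neg, abs_of_pos hθ0] at hg'
  rw [hye.norm_rel_map I, he, B.norm_smul_dir hle.le] at he'
  obtain ⟨a, ha, hx'⟩ := B'.exists_polar_of_angle_le he' hle (hyx.map I).rel_ne_zero (δ := τ) (by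
    have := angle_map_le_of_freeDir I hyx hye hx hlx he hle (by linarith) (by linarith)
      (hFU.mono le_rfl (by linarith))
    rw [InnerProductGeometry.angle_comm]
    linarith)
  rw [hyx.norm_rel_map I, hx, B.norm_smul_dir hlx.le, zero_add] at hx'
  obtain ⟨b, hb, hz'⟩ := B'.exists_polar_of_angle_le hg' hlg (hyz.map I).rel_ne_zero (δ := ρ) (by
    have := angle_map_le_of_freeDir I hyg hyz hg hlg hz hlz (by linarith) (by linarith)
      (hFU.mono (by linarith) le_rfl)
    linarith)
  rw [hyz.norm_rel_map I, hz, B.norm_smul_dir hlz.le] at hz'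
  have ha' := abs_le.1 ha
  have hb' := abs_le.1 hb
  have hab : |a - (θ + b)| ≤ τ + θ + ρ := abs_le.2 ⟨by linarith, by linarith⟩
  rw [hx', hz', B'.angle_eq_abs hlx hlz (by linarith) (by linarith)] at hlt
  have hα : angle (rel y x) (rel y z) = τ + θ + ρ := by
    rw [hx, hz, B.angle_eq_abs hlx hlz (by linarith) (by linarith), abs_sub_comm,
      abs_of_nonneg (by linarith)]
    ring
  have hπ := Real.pi_pos
  have hV₁ : ∀ ψ, 0 ≤ ψ → ψ < Real.pi / 2 → ψ < Real.pi - θ - ρ →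
      FreeDir V (hbSupport (I y)) B' (-ψ) ψ := by
    intro ψ h0 h1 h2
    obtain ⟨φ, hφ1, hφ2⟩ := exists_between (lt_min h1 h2)
    rw [lt_min_iff] at hφ2
    have hω : τ + θ + ρ + max 0 (φ - τ) < Real.pi := by
      rcases max_cases 0 (φ - τ) with ⟨h, _⟩ | ⟨h, _⟩ <;> rw [h] <;> linarith
    have h3 := le_max_right 0 (φ - τ)
    have := hye.freeDir_map_sector I (c := 0) (c' := 0) hle he he'
      ((hW _ (le_max_left _ _) hω).mono (by linarith) (by linarith)) (by linarith) h0 hφ1 h1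
    rwa [zero_sub, zero_add] at this
  have hV₂ : ∀ ψ, 0 ≤ ψ → ψ < Real.pi / 2 → ψ < Real.pi - θ - τ →
      FreeDir V (hbSupport (I y)) B' (θ - ψ) (θ + ψ) := by
    intro ψ h0 h1 h2
    obtain ⟨φ, hφ1, hφ2⟩ := exists_between (lt_min h1 h2)
    rw [lt_min_iff] at hφ2
    have hω : τ + θ + ρ + max 0 (φ - ρ) < Real.pi := by
      rcases max_cases 0 (φ - ρ) with ⟨h, _⟩ | ⟨h, _⟩ <;> rw [h] <;> linarith
    have h3 := le_max_right 0 (φ - ρ)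
    exact hyg.freeDir_map_sector I hlg hg hg'
      ((hW _ (le_max_left _ _) hω).mono (by linarith) (by linarith)) (by linarith) h0 hφ1 h1
  have hVτ := hV₁ τ hτ0 (by linarith) (by linarith)
  have hVρ := hV₂ ρ hρ0 (by linarith) (by linarith)
  have hθ : Real.pi / 2 < θ := by
    by_contra hc
    obtain ⟨ψ₁, ψ₂, h1, h2, h3, h4, h5, h6, h7⟩ : ∃ ψ₁ ψ₂ : ℝ, τ ≤ ψ₁ ∧ ρ ≤ ψ₂ ∧
        ψ₁ < Real.pi / 2 ∧ ψ₁ < Real.pi - θ - ρ ∧ ψ₂ < Real.pi / 2 ∧ ψ₂ < Real.pi - θ - τ ∧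
        θ ≤ ψ₁ + ψ₂ := by
      set M₁ := min (Real.pi / 2) (Real.pi - θ - ρ) with hM₁
      set M₂ := min (Real.pi / 2) (Real.pi - θ - τ) with hM₂
      have h1 : τ < M₁ := lt_min (by linarith) (by linarith)
      have h2 : ρ < M₂ := lt_min (by linarith) (by linarith)
      have h3 : θ < M₁ + M₂ := by
        rcases min_cases (Real.pi / 2) (Real.pi - θ - ρ) with ⟨h, _⟩ | ⟨h, _⟩ <;>
        rcases min_cases (Real.pi / 2) (Real.pi - θ - τ) with ⟨h', _⟩ | ⟨h', _⟩ <;>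
        rw [hM₁, hM₂, h, h'] <;> linarith
      have h4 : max τ (M₁ - (M₁ + M₂ - θ) / 2) < M₁ := max_lt h1 (by linarith)
      have h5 : max ρ (M₂ - (M₁ + M₂ - θ) / 2) < M₂ := max_lt h2 (by linarith)
      refine ⟨_, _, le_max_left _ _, le_max_left _ _, (lt_min_iff.1 h4).1, (lt_min_iff.1 h4).2,
        (lt_min_iff.1 h5).1, (lt_min_iff.1 h5).2, ?_⟩
      have := le_max_right τ (M₁ - (M₁ + M₂ - θ) / 2)
      have := le_max_right ρ (M₂ - (M₁ + M₂ - θ) / 2)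
      linarith
    have := angle_le_of_freeDir_map I hyx hyz hx' hlx hz' hlz (hab.trans_lt hsum)
      (c := -τ) (d := θ + ρ) (by linarith) (by linarith) (by linarith) (by linarith)
      (((hV₁ ψ₁ (by linarith) h3 h4).union (hV₂ ψ₂ (by linarith) h5 h6) (by linarith)).mono
        (by linarith) (by linarith))
    linarith
  have haτ : τ ≤ |a| := by
    have := angle_le_of_freeDir_map I hyx hye hx' hlx he' hle
      (by rw [sub_zero]; linarith) ha'.1 ha'.2 (by linarith) hτ0 hVτ
    rwa [sub_zero, hx, he, B.angle_eq_abs hlx hle (by linarith) (by linarith), sub_zero, abs_neg,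
      abs_of_nonneg hτ0] at this
  have hbρ : ρ ≤ |b| := by
    have := angle_le_of_freeDir_map I hyg hyz hg' hlg hz' hlz
      (by rw [sub_add_cancel_left, abs_neg]; linarith) (by linarith) (by linarith) (by linarith)
      (by linarith) hVρ
    rwa [sub_add_cancel_left, abs_neg, hg, hz, B.angle_eq_abs hlg hlz (by linarith) (by linarith),
      sub_add_cancel_left, abs_neg, abs_of_nonneg hρ0] at this
  by_cases h1 : 0 ≤ a ∧ 0 < τ
  · rw [abs_of_nonneg h1.1] at haτ ha
    obtain rfl : a = τ := le_antisymm ha haτ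
    exact not_fold I hyx hye hyg hyz heg hx hx' hlx he he' hle hg hg' hlg hz hz' hlz h1.2 hb hθ
      hsum hn₁ hn₂ (fun t β h h' h'' => hcap t β h h' (by linarith)) (hVτ.mono (by linarith) le_rfl)
      hVρ
  by_cases h2 : b ≤ 0 ∧ 0 < ρ
  · rw [abs_of_nonpos h2.1] at hbρ hb
    have hfd : ∀ (D : OFrame) φ, (D.rot θ).flip.dir φ = D.dir (θ - φ) := fun D φ => by
      rw [OFrame.flip_dir, OFrame.rot_dir, sub_eq_add_neg]
    have hcs : ∀ β, (n₁ * Real.cos θ + n₂ * Real.sin θ) * Real.cos β +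
        (n₁ * Real.sin θ - n₂ * Real.cos θ) * Real.sin β =
        n₁ * Real.cos (θ - β) + n₂ * Real.sin (θ - β) := by
      intro β; rw [Real.cos_sub, Real.sin_sub]; ring
    refine not_fold I hyz hyg hye hyx heg.symm (B := (B.rot θ).flip) (B' := (B'.rot θ).flip)
      (τ := ρ) (ρ := τ) (θ := θ) (b := -a)
      (n₁ := n₁ * Real.cos θ + n₂ * Real.sin θ) (n₂ := n₁ * Real.sin θ - n₂ * Real.cos θ)
      (by rw [hfd, sub_neg_eq_add, hz]) ?_ hlz (by rw [hfd, sub_zero, hg]) (by rw [hfd, sub_zero, hg'])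
      hlg (by rw [hfd, sub_self, he]) (by rw [hfd, sub_self, he']) hle
      (by rw [hfd, sub_add_cancel_left, hx]) (by rw [hfd, sub_add_cancel_left, neg_neg, hx']) hlx
      h2.2 (by rwa [abs_neg]) hθ (by linarith) hn₂ ?_ ?_ ?_ ?_
    · rw [hfd, hz', show θ + b = θ - ρ by linarith]
    · rw [hcs, sub_self, Real.cos_zero, Real.sin_zero, mul_one, mul_zero, add_zero, hn₁]
    · intro t β h h' h'' h3
      rw [hcs] at h3
      rw [hfd]
      exact hcap t _ h (by linarith) (by linarith) h3
    · rw [freeDir_flip_iff, freeDir_rot_iff]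
      exact hVρ.mono (by linarith) (by linarith)
    · rw [freeDir_flip_iff, freeDir_rot_iff]
      exact hVτ.mono (by linarith) (by linarith)
  · have hae : a = -τ := by
      rcases le_total 0 a with h | h
      · rw [not_and] at h1
        have := h1 h
        linarith
      · rw [abs_of_nonpos h] at haτ; linarith
    have hbe : b = ρ := by
      rcases le_total b 0 with h | h
      · rw [not_and] at h2
        have := h2 h
        linarith
      · rw [abs_of_nonneg h] at hbρ; linarith
    rw [hae, hbe, abs_of_neg (by linarith)] at hlt
    linarith

theorem BA.angle_map_eq (I : HBIso U V) (h : BA x y z) :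
    angle (rel (I y) (I x)) (rel (I y) (I z)) = angle (rel y x) (rel y z) := by
  refine (h.angle_map_le I).antisymm (not_lt.1 fun hlt => ?_)
  have hα0 := angle_pos_of_cross h.indep
  have hαπ := angle_lt_pi_of_cross h.indep
  obtain ⟨B, hX, hZ⟩ := OFrame.exists_adapted h.left.rel_ne_zero h.right.rel_ne_zero
  have hlx := h.left.norm_rel_pos
  have hlz := h.right.norm_rel_pos
  have hxn := h.left.norm_rel_map I
  have hzn := h.right.norm_rel_map I
  set α := angle (rel y x) (rel y z)
  set lx := ‖rel y x‖
  set lz := ‖rel y z‖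
  have hW : ∀ ω : ℝ, 0 ≤ ω → α + ω < Real.pi → FreeDir U (hbSupport y) B (-ω) (α + ω) :=
    fun ω => h.freeDir_extend_both I hX hlx hZ hlz hα0 hlt
  have hsα : 0 < Real.sin α := Real.sin_pos_of_pos_of_lt_pi hα0 hαπ
  have hsα2 : 0 < Real.sin (α / 2) := Real.sin_pos_of_pos_of_lt_pi (by linarith) (by linarith)
  have hbis : ∀ {p q r φ : ℝ}, p • B.dir 0 + q • B.dir α = r • B.dir φ →
      (q - p) * Real.sin (α / 2) = r * Real.sin (φ - α / 2) := by
    intro p q r φ hpq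
    have := B.eval_comb (-Real.sin (α / 2)) (Real.cos (α / 2)) hpq
    have e : Real.sin (α / 2) = Real.sin (α - α / 2) := by congr 1; ring
    rw [Real.sin_sub] at e
    rw [Real.cos_zero, Real.sin_zero] at this
    rw [Real.sin_sub]
    linear_combination this + q * e
  have hsc : ∀ s t : ℝ, s • rel y x + t • rel y z = (s * lx) • B.dir 0 + (t * lz) • B.dir α := by
    intro s t; rw [hX, hZ, smul_smul, smul_smul]
  have hpolar : ∀ {s t : ℝ} {k : HausdorffBoundary U}, 0 ≤ s → 0 ≤ t → Sees y k →
      rel y k = s • rel y x + t • rel y z → ∃ φ, 0 ≤ φ ∧ φ ≤ α ∧ rel y k = ‖rel y k‖ • B.dir φ ∧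
        (s * lx) • B.dir 0 + (t * lz) • B.dir α = ‖rel y k‖ • B.dir φ := by
    intro s t k hs ht _ hk
    obtain ⟨φ, h1, h2, h3⟩ := B.exists_polar_between hα0.le (by linarith)
      (p := s * lx) (q := t * lz) (by positivity) (by positivity)
    rw [hk, hsc]
    exact ⟨φ, h1, h2, h3, h3⟩
  rcases h.exists_gap I.isOpen_left (p := 1 / lx) (q := 1 / lz) (by positivity) (by positivity) with
    ⟨e, ρ, hρ, hse, he⟩ | ⟨e, g, l, m, s₁, t₁, s₂, t₂, hse, hsg, hseg, he, hg, hs₁, ht₁, hs₂, ht₂,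
      h1, h2, h3, h4, hcap⟩
  · rw [smul_add, smul_smul, smul_smul] at he
    obtain ⟨φ, hφ0, hφ1, hφ, hφ'⟩ := hpolar (by positivity) (by positivity) hse he
    have hle := hse.norm_rel_pos
    have hφα : φ = α / 2 := by
      have := hbis hφ'
      rw [mul_assoc, mul_assoc, one_div_mul_cancel hlx.ne', one_div_mul_cancel hlz.ne', sub_self,
        zero_mul, eq_comm, mul_eq_zero, or_iff_right hle.ne',
        Real.sin_eq_zero_iff_of_lt_of_lt (by linarith) (by linarith)] at this
      linarith
    rw [hφα] at hφ
    obtain ⟨B', he'⟩ := OFrame.exists_of_ne_zero (hse.map I).rel_ne_zero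
    rw [hse.norm_rel_map I] at he'
    have hF0 := hW 0 le_rfl (by linarith)
    obtain ⟨a, ha, hx'⟩ := B'.exists_polar_of_angle_le he' hle (h.left.map I).rel_ne_zero
      (δ := α / 2) (by
        have := angle_map_le_of_freeDir I h.left hse hX hlx hφ hle (by linarith) (by linarith)
          (hF0.mono (by linarith) (by linarith))
        rw [InnerProductGeometry.angle_comm]
        linarith)
    obtain ⟨b, hb, hz'⟩ := B'.exists_polar_of_angle_le he' hle (h.right.map I).rel_ne_zero
      (δ := α / 2) (by
        have := angle_map_le_of_freeDir I hse h.right hφ hle hZ hlz (by linarith) (by linarith)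
          (hF0.mono (by linarith) (by linarith))
        linarith)
    have ha' := abs_le.1 ha
    have hb' := abs_le.1 hb
    rw [zero_add, hxn] at hx'
    rw [zero_add, hzn] at hz'
    have hV := hse.freeDir_map_sector I (φ := Real.pi / 2) (ψ := α / 2) (c' := 0) hle hφ he'
      ((hW ((Real.pi - α) / 2) (by linarith) (by linarith)).mono (by linarith) (by linarith))
      (by linarith) (by linarith) (by linarith) (by linarith)
    have hab : |a - b| ≤ α := abs_le.2 ⟨by linarith, by linarith⟩
    have := angle_le_of_freeDir_map I h.left h.right hx' hlx hz' hlz (by linarith)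
      (by linarith) (by linarith) (by linarith) (by linarith) hV
    rw [hx', hz', B'.angle_eq_abs hlx hlz (by linarith) (by linarith)] at hlt
    linarith
  · obtain ⟨τ, hτ0, hτα, hτ, hτ'⟩ := hpolar hs₁ ht₁ hse he
    obtain ⟨η, hη0, hηα, hη, hη'⟩ := hpolar hs₂ ht₂ hsg hg
    have hle := hse.norm_rel_pos
    have hlg := hsg.norm_rel_pos
    set le := ‖rel y e‖
    set lg := ‖rel y g‖
    have hτ1 : τ < α / 2 := by
      by_contra hc
      have h5 : 0 ≤ le * Real.sin (τ - α / 2) := mul_nonneg hle.le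
        (Real.sin_nonneg_of_nonneg_of_le_pi (by linarith) (by linarith))
      rw [← hbis hτ'] at h5
      have h6 : t₁ * lz < s₁ * lx := by
        rw [one_div_mul_eq_div, one_div_mul_eq_div, div_lt_div_iff₀ hlx hlz] at h1
        exact h1
      have := mul_pos (sub_pos.2 h6) hsα2
      linarith
    have hη1 : α / 2 < η := by
      by_contra hc
      have h5 : 0 ≤ lg * Real.sin (α / 2 - η) := mul_nonneg hlg.le
        (Real.sin_nonneg_of_nonneg_of_le_pi (by linarith) (by linarith))
      rw [← neg_sub η, Real.sin_neg, mul_neg, ← hbis hη'] at h5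
      have h6 : s₂ * lx < t₂ * lz := by
        rw [one_div_mul_eq_div, one_div_mul_eq_div, div_lt_div_iff₀ hlz hlx] at h2
        exact h2
      have := mul_pos (sub_pos.2 h6) hsα2
      linarith
    set N₁ := l / lx with hN₁
    set N₂ := (m / lz - N₁ * Real.cos α) / Real.sin α with hN₂
    have hNα : N₁ * Real.cos α + N₂ * Real.sin α = m / lz := by rw [hN₂]; field_simp; ring
    have hev : ∀ {s t r φ : ℝ}, (s * lx) • B.dir 0 + (t * lz) • B.dir α = r • B.dir φ →
        r * (N₁ * Real.cos φ + N₂ * Real.sin φ) = l * s + m * t := by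
      intro s t r φ hst
      rw [← B.eval_comb N₁ N₂ hst, hNα, Real.cos_zero, Real.sin_zero, hN₁]
      field_simp
      ring
    have hrd : ∀ φ, (B.rot τ).dir φ = B.dir (τ + φ) := fun φ => B.rot_dir τ φ
    have hcs : ∀ β, (N₁ * Real.cos τ + N₂ * Real.sin τ) * Real.cos β +
        (N₂ * Real.cos τ - N₁ * Real.sin τ) * Real.sin β =
        N₁ * Real.cos (τ + β) + N₂ * Real.sin (τ + β) := by
      intro β; rw [Real.cos_add, Real.sin_add]; ring
    refine angle_map_not_lt_of_gap I h.left hse hsg h.right hseg (B := B.rot τ) (τ := τ)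
      (θ := η - τ) (ρ := α - η) (n₁ := N₁ * Real.cos τ + N₂ * Real.sin τ)
      (n₂ := N₂ * Real.cos τ - N₁ * Real.sin τ)
      (by rw [hrd, add_neg_cancel]; exact hX) hlx (by rw [hrd, add_zero]; exact hτ) hle
      (by rw [hrd, add_sub_cancel]; exact hη) hlg
      (by rw [hrd, show τ + (η - τ + (α - η)) = α by ring]; exact hZ) hlz hτ0 (by linarith)
      (by linarith) (by linarith) (by linarith) (by linarith) (by rw [hev hτ', h3])
      (by rw [hcs, add_sub_cancel, hev hη', h4]) ?_ ?_ (by linarith)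
    · intro t β ht hβ hβ' hlt1
      rw [hcs] at hlt1
      rw [hrd]
      have hd := B.dir_eq_comb_between hα0 (by linarith : α < 0 + Real.pi) (τ + β)
      rw [sub_zero, sub_zero] at hd
      have s1 : 0 ≤ Real.sin (α - (τ + β)) :=
        Real.sin_nonneg_of_nonneg_of_le_pi (by linarith) (by linarith)
      have s2 : 0 ≤ Real.sin (τ + β) :=
        Real.sin_nonneg_of_nonneg_of_le_pi (by linarith) (by linarith)
      set s := t * Real.sin (α - (τ + β)) / Real.sin α / lx with hs
      set u := t * Real.sin (τ + β) / Real.sin α / lz with hu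
      have hd' : (s * lx) • B.dir 0 + (u * lz) • B.dir α = t • B.dir (τ + β) := by
        rw [hd, hs, hu, div_mul_cancel₀ _ hlx.ne', div_mul_cancel₀ _ hlz.ne']; module
      have hs0 : 0 ≤ s := by positivity
      have hu0 : 0 ≤ u := by positivity
      rw [← hd', ← hsc]
      refine hcap s u hs0 hu0 ?_ (by rw [← hev hd']; exact hlt1)
      refine (add_nonneg hs0 hu0).lt_of_ne fun h0 => ?_
      have e1 : s = 0 := by linarith
      have e2 : u = 0 := by linarith
      rw [e1, e2, zero_mul, zero_mul, zero_smul, zero_smul, add_zero] at hd'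
      exact smul_ne_zero ht.ne' (B.dir_ne_zero _) hd'.symm
    · intro ω h0 h1
      rw [freeDir_rot_iff]
      exact (hW ω h0 (by linarith)).mono (by linarith) (by linarith)

end AngleEq

section Gap

variable {S : Set (Euc 2)} {a b c e : HausdorffBoundary S} {l m s t : ℝ}

/-- A boundary point inside a boundary angle that is joined to the endpoint `b` of one of the sides
by a free segment, which bounds a free cap, spans boundary angles at both ends of the side. -/
theorem BA.of_cap_right (h : BA c a b)
    (hcap : Cap S (hbSupport a) (rel a c) (rel a b) l 1) (hs : 0 < s) (ht : 0 ≤ t)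
    (he : rel a e = s • rel a c + t • rel a b) (hf : l * s + t = 1) (hae : Sees a e)
    (heb : Sees e b) : BA e a b ∧ BA e b a := by
  have hcr : cross (rel a e) (rel a b) = s * cross (rel a c) (rel a b) := by
    rw [he, cross_add_left, cross_smul_left, cross_smul_left, cross_self_eq]; ring
  have hcr0 : cross (rel a e) (rel a b) ≠ 0 := by
    rw [hcr]; exact mul_ne_zero hs.ne' h.indep
  have hbe : rel b e = rel a e - rel a b := by rw [rel, rel, rel]; abel
  have hba : rel b a = (-1 : ℝ) • rel a b := by rw [rel, rel]; module
  refine ⟨⟨hae, h.right, hcr0, ?_⟩, ⟨heb.symm, h.right.symm, ?_, 1, one_pos, ?_⟩⟩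
  · have := h.free.mono hs.le ht le_rfl zero_le_one (by linarith) (by norm_num)
    rwa [← he, zero_smul, one_smul, zero_add] at this
  · rw [hbe, hba, cross_smul_right, sub_eq_add_neg, cross_add_left, ← neg_one_smul ℝ (rel a b),
      cross_smul_left, cross_self_eq]
    intro h0; apply hcr0; linarith
  · intro p q hp hq hpq0 hpq1
    rcases hq.eq_or_lt with rfl | hq
    · rw [zero_smul, add_zero]
      exact heb.symm.smul_mem (by linarith) (by linarith)
    · have hpt := mul_nonneg hp ht
      have := hcap (p * s) (1 - p - q + p * t) (by positivity) (by linarith)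
        (by have := mul_nonneg hp hs.le; linarith) (by
          have : l * (p * s) + 1 * (1 - p - q + p * t) = p * (l * s + t) + 1 - p - q := by ring
          rw [this, hf]; linarith)
      convert this using 1
      rw [hbe, hba, he, ← add_rel a b]; module

/-- Near the end of a side of a boundary angle, either visible boundary points on the lines bounding
free caps accumulate at the endpoint, or some boundary point spans boundary angles with
the side at both of its ends. -/
theorem BA.gap_or_acc (hS : IsOpen S) (h : BA c a b) :
    (∀ ε : ℝ, 0 < ε → ∃ (k : HausdorffBoundary S) (s t l m : ℝ),
      rel a k = s • rel a c + t • rel a b ∧ 0 < s ∧ 0 ≤ t ∧ s < ε ∧ |t - 1| < ε ∧ Sees a k ∧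
      Cap S (hbSupport a) (rel a c) (rel a b) l m ∧ l * s + m * t = 1) ∨
    ∃ (e : HausdorffBoundary S) (s t : ℝ), 0 < s ∧ 0 ≤ t ∧
      rel a e = s • rel a c + t • rel a b ∧ BA e a b ∧ BA e b a := by
  rw [or_iff_not_imp_left]
  intro hacc
  push Not at hacc
  obtain ⟨ε₀, hε₀, hacc⟩ := hacc
  obtain ⟨ε, hε, hε1, hacc⟩ : ∃ ε : ℝ, 0 < ε ∧ ε ≤ 1 ∧ ∀ (s t l m : ℝ), 0 < s → 0 ≤ t →
      s < ε → |t - 1| < ε → Cap S (hbSupport a) (rel a c) (rel a b) l m → l * s + m * t = 1 →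
      hbSupport a + (s • rel a c + t • rel a b) ∈ S := by
    refine ⟨min ε₀ 1, by positivity, min_le_right _ _, fun s t l m hs ht hs1 ht1 hcap h1 => ?_⟩
    by_contra hbad
    obtain ⟨k, hk, hsk⟩ := hcap.exists_sees hS h hs.le ht h1 hbad
    exact hacc k s t l m hk hs ht (hs1.trans_le (min_le_left _ _))
      (ht1.trans_le (min_le_left _ _)) hsk hcap h1
  obtain ⟨K, hKc, hKx, hKz, hK1, hK2⟩ := h.exists_bad hS
  have hK0 : ∀ s t, (s, t) ∈ K → s = 0 → t = 1 := by
    intro s t hst hs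
    obtain ⟨h1, h2, h3, h4, h5⟩ := hK1 s t hst
    by_contra hne
    apply h5
    rw [hs, zero_smul, zero_add]
    refine h.right.smul_mem (by linarith) (lt_of_le_of_ne (by linarith) hne)
  set K' := K ∩ {k | ε ≤ k.1 ∨ ε ≤ |k.2 - 1|} with hK'
  have hKc' : IsCompact K' := by
    have h1 : IsClosed {k : ℝ × ℝ | ε ≤ k.1} := isClosed_le continuous_const continuous_fst
    have h2 : IsClosed {k : ℝ × ℝ | ε ≤ |k.2 - 1|} :=
      isClosed_le continuous_const (continuous_snd.sub continuous_const).abs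
    exact hKc.inter_right (h1.union h2)
  have hx' : ((1:ℝ), (0:ℝ)) ∈ K' := ⟨hKx, Or.inl hε1⟩
  have hpos : ∀ s t, (s, t) ∈ K' → 0 < s ∧ t < 1 := by
    rintro s t ⟨hst, hor⟩
    obtain ⟨h1, h2, h3, h4, h5⟩ := hK1 s t hst
    have hs : 0 < s := by
      refine lt_of_le_of_ne h1 fun h0 => ?_
      have h6 := hK0 s t hst h0.symm
      rw [← h0, h6] at hor
      simp only [mem_ofPred_eq, sub_self, abs_zero, or_self] at hor
      linarith
    exact ⟨hs, by linarith⟩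
  obtain ⟨⟨s₀, t₀⟩, hk₀, hmin⟩ := hKc'.exists_isMinOn ⟨_, hx'⟩
    (f := fun k : ℝ × ℝ => k.1 / (1 - k.2)) (by
      refine ContinuousOn.div (by fun_prop) (by fun_prop) ?_
      rintro ⟨s, t⟩ hst
      exact (sub_pos.2 (hpos s t hst).2).ne')
  have hd₀ : 0 < 1 - t₀ := sub_pos.2 (hpos _ _ hk₀).2
  set κ := s₀ / (1 - t₀) with hκ
  have hκ0 : 0 < κ := div_pos (hpos _ _ hk₀).1 hd₀
  have hmin' : ∀ s t, (s, t) ∈ K' → 1 ≤ κ⁻¹ * s + t := by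
    intro s t hst
    have h1 : κ ≤ s / (1 - t) := hmin hst
    rw [le_div_iff₀ (sub_pos.2 (hpos s t hst).2)] at h1
    have h2 := mul_le_mul_of_nonneg_left h1 (inv_pos.2 hκ0).le
    rw [← mul_assoc, inv_mul_cancel₀ hκ0.ne'] at h2
    linarith
  have hκ1 : 1 ≤ κ⁻¹ := by simpa using hmin' 1 0 hx'
  have hf : ∀ s t, (s, t) ∈ K → 1 ≤ κ⁻¹ * s + 1 * t := by
    by_contra! hcon
    obtain ⟨s₁, t₁, hst₁, hlt⟩ := hcon
    obtain ⟨⟨s₂, t₂⟩, hst₂, hmin₂⟩ := hKc.exists_isMinOn ⟨_, hst₁⟩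
      (f := fun k : ℝ × ℝ => κ⁻¹ * k.1 + 1 * k.2) (by fun_prop)
    have hle : ∀ s t, (s, t) ∈ K → κ⁻¹ * s₂ + 1 * t₂ ≤ κ⁻¹ * s + 1 * t := fun s t hst => hmin₂ hst
    set μ := κ⁻¹ * s₂ + 1 * t₂ with hμ
    have hμ1 : μ < 1 := (hle _ _ hst₁).trans_lt hlt
    obtain ⟨h1, h2, h3, h4, h5⟩ := hK1 s₂ t₂ hst₂
    have hs₂ : 0 < s₂ := by
      refine lt_of_le_of_ne h1 fun h0 => ?_
      have h6 := hK0 _ _ hst₂ h0.symm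
      rw [← h0, h6] at hμ
      linarith
    have hμ0 : 0 < μ := by have := mul_pos (inv_pos.2 hκ0) hs₂; linarith
    have hnb : ¬ (ε ≤ s₂ ∨ ε ≤ |t₂ - 1|) := fun hor => by
      have := hmin' _ _ ⟨hst₂, hor⟩
      linarith
    push Not at hnb
    have hsc : ∀ s t : ℝ, (κ⁻¹ / μ) * s + (1 / μ) * t = (κ⁻¹ * s + 1 * t) / μ := fun s t => by ring
    have hcap : Cap S (hbSupport a) (rel a c) (rel a b) (κ⁻¹ / μ) (1 / μ) :=
      cap_of_bad hKx hKz hK2 fun s t hst => by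
        rw [hsc, one_le_div hμ0]; exact hle s t hst
    exact h5 (hacc s₂ t₂ _ _ hs₂ h2 hnb.1 hnb.2 hcap (by rw [hsc, ← hμ, div_self hμ0.ne']))
  have hcap : Cap S (hbSupport a) (rel a c) (rel a b) κ⁻¹ 1 := cap_of_bad hKx hKz hK2 hf
  obtain ⟨⟨s, t⟩, ⟨hst, hst1⟩, hmax⟩ := (hKc'.inter_right
    (isClosed_eq (f := fun k : ℝ × ℝ => κ⁻¹ * k.1 + k.2) (g := fun _ => 1)
      (by fun_prop) (by fun_prop))).exists_isMaxOn ⟨(s₀, t₀), hk₀, by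
        have : κ⁻¹ * s₀ + t₀ = 1 := by
          have h0 := (hpos _ _ hk₀).1.ne'
          rw [hκ, inv_div, div_mul_cancel₀ _ h0]; ring
        exact this⟩ (f := fun k : ℝ × ℝ => k.2) (by fun_prop)
  replace hst1 : κ⁻¹ * s + t = 1 := hst1
  obtain ⟨hs, ht1⟩ := hpos s t hst
  obtain ⟨-, ht, -, -, hn⟩ := hK1 s t hst.1
  obtain ⟨e, he, hae⟩ := hcap.exists_sees hS h hs.le ht (by linarith) hn
  have hb : rel a b = (0:ℝ) • rel a c + (1:ℝ) • rel a b := by module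
  have hne : hbSupport e ≠ hbSupport b := by
    intro heq
    have h1 : rel a e = rel a b := by rw [rel, rel, heq]
    rw [he] at h1
    have h2 : s • rel a c + (t - 1) • rel a b = 0 := by
      rw [sub_smul, ← add_sub_assoc, h1]; simp
    exact hs.ne' ((comb_eq_zero_iff h.indep).1 h2).1
  refine ⟨e, s, t, hs, ht, he, h.of_cap_right hcap hs ht he hst1 hae ?_⟩
  refine hcap.sees hS hae h.right hs.le ht le_rfl zero_le_one he hb (by linarith) (by norm_num)
    hne fun k hk0 hk1 => ?_
  by_contra hbad
  have hk1' : 0 < 1 - k := by linarith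
  have hcoord : (1 - k) • rel a e + k • rel a b =
      ((1 - k) * s) • rel a c + ((1 - k) * t + k) • rel a b := by rw [he]; module
  rw [hcoord] at hbad
  have hs' : 0 < (1 - k) * s := mul_pos hk1' hs
  have ht' : 0 ≤ (1 - k) * t + k := add_nonneg (mul_nonneg hk1'.le ht) hk0.le
  have hf1 : κ⁻¹ * ((1 - k) * s) + ((1 - k) * t + k) = 1 := by
    have : κ⁻¹ * ((1 - k) * s) + ((1 - k) * t + k) = (1 - k) * (κ⁻¹ * s + t) + k := by ring
    rw [this, hst1]; ring
  have hKmem : ((1 - k) * s, (1 - k) * t + k) ∈ K := by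
    refine hK2 _ _ hs'.le ht' (by linarith) ?_ hbad
    have := mul_le_mul_of_nonneg_right hκ1 hs'.le
    linarith
  by_cases hor : ε ≤ (1 - k) * s ∨ ε ≤ |(1 - k) * t + k - 1|
  · have : (1 - k) * t + k ≤ t := hmax ⟨⟨hKmem, hor⟩, hf1⟩
    have := mul_pos hk0 (sub_pos.2 ht1)
    linarith
  · push Not at hor
    exact hbad (hacc _ _ _ _ hs' ht' hor.1 hor.2 hcap (by rw [one_mul]; exact hf1))

end Gap

section Orient

variable {U V S : Set (Euc 2)} {a b c d e j k : HausdorffBoundary U}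

theorem norm_sq_mul_inner (w x y : Euc 2) :
    ‖w‖ ^ 2 * inner ℝ x y = inner ℝ w x * inner ℝ w y + cross w x * cross w y := by
  rw [← real_inner_self_eq_norm_sq]
  simp only [inner_eq_coord, cross]
  ring

/-- The factor `±1` by which `I` changes the orientation of the triangle `a`, `b`, `k`
(when that triangle is mapped to a congruent one). -/
def orient (I : HBIso U V) (a b k : HausdorffBoundary U) : ℝ :=
  cross (rel (I a) (I b)) (rel (I a) (I k)) / cross (rel a b) (rel a k)

/-- The triangle `a`, `b`, `k` is nondegenerate and mapped by `I` to a congruent one. -/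
structure Rigid (I : HBIso U V) (a b k : HausdorffBoundary U) : Prop where
  indep : cross (rel a b) (rel a k) ≠ 0
  norm_left : ‖rel (I a) (I b)‖ = ‖rel a b‖
  norm_right : ‖rel (I a) (I k)‖ = ‖rel a k‖
  inner_eq : inner ℝ (rel (I a) (I b)) (rel (I a) (I k)) = inner ℝ (rel a b) (rel a k)

theorem rel_swap (a b : HausdorffBoundary S) : rel b a = -rel a b := by
  rw [rel, rel, neg_sub]

theorem rel_eq_sub (a b k : HausdorffBoundary S) : rel b k = rel a k - rel a b := by
  rw [rel, rel, rel, sub_sub_sub_cancel_right]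

theorem cross_rel_swap (a b k : HausdorffBoundary S) :
    cross (rel b a) (rel b k) = -cross (rel a b) (rel a k) := by
  rw [rel_swap a b, rel_eq_sub a b k, sub_eq_add_neg, cross_add_right, ← neg_one_smul ℝ (rel a b),
    cross_smul_right, cross_smul_left, cross_smul_left, cross_self_eq]
  ring

theorem BA.inner_map (I : HBIso U V) (h : BA k a j) :
    inner ℝ (rel (I a) (I k)) (rel (I a) (I j)) = inner ℝ (rel a k) (rel a j) := by
  rw [← InnerProductGeometry.cos_angle_mul_norm_mul_norm, h.angle_map_eq I,
    h.left.norm_rel_map I, h.right.norm_rel_map I,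
    InnerProductGeometry.cos_angle_mul_norm_mul_norm]

theorem BA.rigid (I : HBIso U V) (h : BA k a b) : Rigid I a b k :=
  ⟨h.symm.indep, h.right.norm_rel_map I, h.left.norm_rel_map I, h.symm.inner_map I⟩

theorem Rigid.symm {I : HBIso U V} (h : Rigid I a b k) : Rigid I b a k := by
  refine ⟨?_, ?_, ?_, ?_⟩
  · rw [cross_rel_swap]; exact neg_ne_zero.2 h.indep
  · rw [rel_swap a b, rel_swap (I a) (I b), norm_neg, norm_neg, h.norm_left]
  · rw [← sq_eq_sq₀ (norm_nonneg _) (norm_nonneg _), rel_eq_sub a b k, rel_eq_sub (I a) (I b) (I k),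
      norm_sub_sq_real, norm_sub_sq_real, h.norm_left, h.norm_right, real_inner_comm,
      h.inner_eq, real_inner_comm (rel a k)]
  · rw [rel_swap a b, rel_swap (I a) (I b), rel_eq_sub a b k, rel_eq_sub (I a) (I b) (I k),
      inner_neg_left, inner_neg_left, inner_sub_right, inner_sub_right, h.inner_eq,
      real_inner_self_eq_norm_sq, real_inner_self_eq_norm_sq, h.norm_left]

theorem orient_swap (I : HBIso U V) (a b k : HausdorffBoundary U) :
    orient I b a k = orient I a b k := by
  rw [orient, orient, cross_rel_swap a b, cross_rel_swap (I a) (I b), neg_div_neg_eq]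

theorem Rigid.orient_eq_iff_inner {I : HBIso U V} (hk : Rigid I a b k) (hj : Rigid I a b j) :
    orient I a b k = orient I a b j ↔
      inner ℝ (rel (I a) (I k)) (rel (I a) (I j)) = inner ℝ (rel a k) (rel a j) := by
  have g := norm_sq_mul_inner (rel a b) (rel a k) (rel a j)
  have g' := norm_sq_mul_inner (rel (I a) (I b)) (rel (I a) (I k)) (rel (I a) (I j))
  have sk := cross_sq (rel (I a) (I b)) (rel (I a) (I k))
  have sj := cross_sq (rel (I a) (I b)) (rel (I a) (I j))
  rw [hk.norm_left, hk.norm_right, hk.inner_eq, ← cross_sq] at sk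
  rw [hj.norm_left, hj.norm_right, hj.inner_eq, ← cross_sq] at sj
  rw [hk.norm_left, hk.inner_eq, hj.inner_eq] at g'
  have hw : ‖rel a b‖ ^ 2 ≠ 0 := by
    intro h0
    apply hk.indep
    rw [norm_eq_zero.1 (pow_eq_zero_iff two_ne_zero |>.1 h0)]
    simp [cross]
  have hP := hk.indep
  have hQ := hj.indep
  rw [orient, orient, div_eq_div_iff hP hQ]
  set P := cross (rel a b) (rel a k)
  set Q := cross (rel a b) (rel a j)
  set P' := cross (rel (I a) (I b)) (rel (I a) (I k))
  set Q' := cross (rel (I a) (I b)) (rel (I a) (I j))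
  constructor
  · intro h
    have : P' * Q' = P * Q := by
      apply mul_right_cancel₀ hQ
      linear_combination Q' * h + P * sj
    apply mul_left_cancel₀ hw
    linarith
  · intro h
    rw [h] at g'
    have h1 : P' * Q' = P * Q := by linarith
    have hQ' : Q' ≠ 0 := fun h0 => by
      rw [h0] at sj
      exact hQ (pow_eq_zero_iff two_ne_zero |>.1 (by linarith))
    apply mul_right_cancel₀ hQ'
    linear_combination Q * h1 - P * sj

theorem norm_rel_eq_iff_inner {I : HBIso U V} (hk : ‖rel (I a) (I k)‖ = ‖rel a k‖)
    (hj : ‖rel (I a) (I j)‖ = ‖rel a j‖) : ‖rel (I k) (I j)‖ = ‖rel k j‖ ↔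
      inner ℝ (rel (I a) (I k)) (rel (I a) (I j)) = inner ℝ (rel a k) (rel a j) := by
  rw [← sq_eq_sq₀ (norm_nonneg _) (norm_nonneg _), rel_eq_sub a k j, rel_eq_sub (I a) (I k) (I j),
      norm_sub_sq_real, norm_sub_sq_real, hk, hj, real_inner_comm, real_inner_comm (rel a k)]
  constructor <;> intro h <;> linarith

theorem Rigid.orient_eq_iff_norm {I : HBIso U V} (hk : Rigid I a b k) (hj : Rigid I a b j) :
    orient I a b k = orient I a b j ↔ ‖rel (I k) (I j)‖ = ‖rel k j‖ := by
  rw [hk.orient_eq_iff_inner hj, norm_rel_eq_iff_inner hk.norm_right hj.norm_right]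

theorem Rigid.orient_eq_of_sees {I : HBIso U V} (hk : Rigid I a b k) (hj : Rigid I a b j)
    (h : Sees k j) : orient I a b k = orient I a b j :=
  (hk.orient_eq_iff_norm hj).2 (h.norm_rel_map I)

theorem BA.orient_eq_of_ba {I : HBIso U V} (hk : BA k a b) (hj : BA j a b)
    (h : BA k a j) : orient I a b k = orient I a b j :=
  ((hk.rigid I).orient_eq_iff_inner (hj.rigid I)).2 (h.inner_map I)

/-- Two adjacent free wedges with total angle less than `π` form a free wedge. -/
theorem Free.union {o X W Z : Euc 2} (h₁ : Free S o X W) (h₂ : Free S o W Z) {α β : ℝ}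
    (hα : 0 < α) (hβ : 0 < β) (hW : W = α • X + β • Z) : Free S o X Z := by
  obtain ⟨R₁, hR₁, h₁⟩ := h₁
  obtain ⟨R₂, hR₂, h₂⟩ := h₂
  refine ⟨min (R₁ / (1 + 1 / β)) (R₂ / (1 + 1 / α)), by positivity, fun s t hs ht h0 hlt => ?_⟩
  rcases le_total (t * α) (s * β) with hle | hle
  · have hR := hlt.trans_le (min_le_left _ _)
    rw [lt_div_iff₀ (by positivity)] at hR
    have e1 : t / β * α ≤ s := by
      rw [div_mul_eq_mul_div, div_le_iff₀ hβ]; exact hle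
    have e2 : (s + t) * (1 + 1 / β) = s + t + s / β + t / β := by ring
    have e3 : 0 ≤ s / β := by positivity
    have e4 : 0 ≤ t / β * α := by positivity
    have hpos : 0 < s - t / β * α + t / β := by
      rcases ht.eq_or_lt with rfl | ht
      · rw [zero_div, zero_mul]; linarith
      · have : 0 < t / β := by positivity
        linarith
    have := h₁ (s - t / β * α) (t / β) (by linarith) (by positivity) hpos (by linarith)
    convert this using 2
    rw [hW]
    have : t / β * β = t := by field_simp
    rw [smul_add, smul_smul, smul_smul, this]; module
  · have hR := hlt.trans_le (min_le_right _ _)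
    rw [lt_div_iff₀ (by positivity)] at hR
    have e1 : s / α * β ≤ t := by
      rw [div_mul_eq_mul_div, div_le_iff₀ hα]; exact hle
    have e2 : (s + t) * (1 + 1 / α) = s + t + s / α + t / α := by ring
    have e3 : 0 ≤ t / α := by positivity
    have e4 : 0 ≤ s / α * β := by positivity
    have hpos : 0 < s / α + (t - s / α * β) := by
      rcases hs.eq_or_lt with rfl | hs
      · rw [zero_div, zero_mul]; linarith
      · have : 0 < s / α := by positivity
        linarith
    have := h₂ (s / α) (t - s / α * β) (by positivity) (by linarith) hpos (by linarith)
    convert this using 2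
    rw [hW]
    have : s / α * α = s := by field_simp
    rw [smul_add, smul_smul, smul_smul, this]; module

/-- Boundary angles on the same side of `ab` are mapped with the same orientation. -/
theorem BA.orient_eq_of_same_side {I : HBIso U V} (hk : BA k a b) (hj : BA j a b) {n : Euc 2}
    {u₁ h₁ u₂ h₂ : ℝ} (hk' : rel a k = u₁ • rel a b + h₁ • n)
    (hj' : rel a j = u₂ • rel a b + h₂ • n) (hh₁ : 0 < h₁) (hh₂ : 0 < h₂) :
    orient I a b k = orient I a b j := by
  wlog hle : u₁ / h₁ ≤ u₂ / h₂ generalizing k j u₁ h₁ u₂ h₂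
  · exact (this hj hk hj' hk' hh₂ hh₁ (le_of_not_ge hle)).symm
  rw [div_le_div_iff₀ hh₁ hh₂] at hle
  have hj'' : rel a j = (h₂ / h₁) • rel a k + ((u₂ * h₁ - u₁ * h₂) / h₁) • rel a b := by
    rw [hj', hk', smul_add, smul_smul, smul_smul, div_mul_cancel₀ _ hh₁.ne',
      show u₂ = h₂ / h₁ * u₁ + (u₂ * h₁ - u₁ * h₂) / h₁ by field_simp; ring]
    have : (h₂ / h₁ * u₁ + (u₂ * h₁ - u₁ * h₂) / h₁) * h₁ - u₁ * h₂ = u₂ * h₁ - u₁ * h₂ := by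
      field_simp; ring
    rw [this]; module
  rcases hle.eq_or_lt with heq | hlt
  · rw [heq, sub_self, zero_div, zero_smul, add_zero] at hj''
    rw [hk.left.eq_of_ray (I.isOpen_left) hj.left (div_pos hh₂ hh₁) hj'']
  · have hτ : 0 < (u₂ * h₁ - u₁ * h₂) / h₁ := div_pos (by linarith) hh₁
    refine hk.orient_eq_of_ba hj ⟨hk.left, hj.left, ?_, ?_⟩
    · rw [hj'', cross_add_right, cross_smul_right, cross_smul_right, cross_self_eq, mul_zero,
        zero_add]
      exact mul_ne_zero hτ.ne' hk.indep
    · have := hk.free.mono zero_le_one le_rfl (div_pos hh₂ hh₁).le hτ.le (by norm_num)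
        (add_pos (div_pos hh₂ hh₁) hτ)
      rwa [one_smul, zero_smul, add_zero, ← hj''] at this

/-- Boundary angles on opposite sides of `ab` with total angle less than `π` are mapped with
the same orientation. -/
theorem BA.orient_eq_of_opposite_side {I : HBIso U V} (hk : BA k a b) (hj : BA j a b) {n : Euc 2}
    {u₁ h₁ u₂ h₂ : ℝ} (hk' : rel a k = u₁ • rel a b + h₁ • n)
    (hj' : rel a j = u₂ • rel a b + h₂ • -n) (hh₁ : 0 < h₁) (hh₂ : 0 < h₂)
    (hpos : 0 < u₁ * h₂ + u₂ * h₁) :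
    orient I a b k = orient I a b j := by
  have hW : rel a b = (h₂ / (u₁ * h₂ + u₂ * h₁)) • rel a k +
      (h₁ / (u₁ * h₂ + u₂ * h₁)) • rel a j := by
    have e1 : h₂ / (u₁ * h₂ + u₂ * h₁) * u₁ + h₁ / (u₁ * h₂ + u₂ * h₁) * u₂ = 1 := by
      rw [div_mul_eq_mul_div, div_mul_eq_mul_div, ← add_div, div_eq_one_iff_eq hpos.ne']; ring
    have e2 : (h₂ / (u₁ * h₂ + u₂ * h₁)) • rel a k + (h₁ / (u₁ * h₂ + u₂ * h₁)) • rel a j =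
        (h₂ / (u₁ * h₂ + u₂ * h₁) * u₁ + h₁ / (u₁ * h₂ + u₂ * h₁) * u₂) • rel a b +
        (h₂ / (u₁ * h₂ + u₂ * h₁) * h₁ - h₁ / (u₁ * h₂ + u₂ * h₁) * h₂) • n := by
      rw [hk', hj']; module
    rw [e2, e1, show h₂ / (u₁ * h₂ + u₂ * h₁) * h₁ - h₁ / (u₁ * h₂ + u₂ * h₁) * h₂ = 0 by ring]
    module
  refine hk.orient_eq_of_ba hj ⟨hk.left, hj.left, ?_, hk.free.union hj.symm.free (div_pos hh₂ hpos)
    (div_pos hh₁ hpos) hW⟩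
  intro h0
  apply hk.indep
  rw [hW, cross_add_right, cross_smul_right, cross_smul_right, h0, cross_self_eq]
  ring

end Orient

section Bridge

variable {S : Set (Euc 2)} {a b c d e j k : HausdorffBoundary S}

theorem Sees.of_near (hS : IsOpen S)
    (hm : ∀ τ : ℝ, 0 < τ → τ < 1 → hbSupport j + τ • rel j k ∈ S)
    (hj : ∀ ε : ℝ, 0 < ε → ∃ τ : ℝ, 0 < τ ∧ τ < 1 ∧ PtLE (hbSupport j + τ • rel j k) j ε)
    (hk : ∀ ε : ℝ, 0 < ε → ∃ τ : ℝ, 0 < τ ∧ τ < 1 ∧ PtLE (hbSupport j + τ • rel j k) k ε) :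
    Sees j k := by
  have hne : hbSupport j ≠ hbSupport k := fun heq => by
    have := hm (1 / 2) (by norm_num) (by norm_num)
    rw [rel, ← heq, sub_self, smul_zero, add_zero] at this
    exact hbSupport_notMem hS j this
  refine Sees.of_bdLE hS hne ?_ (BdLE.of_forall_pos fun ε hε => ?_)
  · intro w hw
    rw [openSegment_eq_image_lineMap] at hw
    obtain ⟨τ, ⟨h0, h1⟩, rfl⟩ := hw
    convert hm τ h0 h1 using 1
    rw [AffineMap.lineMap_apply, vsub_eq_sub, vadd_eq_add, rel]; module
  · obtain ⟨σ, hσ0, hσ1, p1⟩ := hj (ε / 2) (by positivity)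
    obtain ⟨τ, hτ0, hτ1, p2⟩ := hk (ε / 2) (by positivity)
    have hseg : segment ℝ (hbSupport j + σ • rel j k) (hbSupport j + τ • rel j k) ⊆ S := by
      refine segment_subset_of_smul fun t h0 h1 => ?_
      have hp : 0 < (1 - t) * σ + t * τ := by
        rcases h0.eq_or_lt with rfl | h0
        · linarith
        · have := mul_pos h0 hτ0
          have := mul_nonneg (sub_nonneg.2 h1) hσ0.le
          linarith
      have hlt : (1 - t) * σ + t * τ < 1 := by
        rcases h0.eq_or_lt with rfl | h0
        · linarith
        · have := mul_pos h0 (sub_pos.2 hτ1)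
          have := mul_nonneg (sub_nonneg.2 h1) (sub_pos.2 hσ1).le
          linarith
      have := hm _ hp hlt
      rwa [add_smul, mul_smul, mul_smul] at this
    have p3 := IntLE.of_segment hseg
    refine (p1.add_pt (p3.trans_pt p2)).mono ?_
    have : dist (hbSupport j + σ • rel j k) (hbSupport j + τ • rel j k) ≤
        dist (hbSupport j) (hbSupport k) := by
      rw [dist_add_left, dist_eq_norm, ← sub_smul, norm_smul, norm_rel]
      refine mul_le_of_le_one_left dist_nonneg ?_
      rw [Real.norm_eq_abs, abs_le]
      constructor <;> linarith
    linarith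

theorem Cap.near {X W : Euc 2} {l m s t s₁ t₁ : ℝ} (hc : Cap S (hbSupport a) X W l m)
    (hk : Sees a k) (hk' : rel a k = s • X + t • W) (hs : 0 < s) (ht : 0 < t)
    (hf : l * s + m * t = 1) (hj' : rel a j = s₁ • X + t₁ • W) (hj : l * s₁ + m * t₁ < 1)
    {ε : ℝ} (hε : 0 < ε) :
    ∃ τ : ℝ, 0 < τ ∧ τ < 1 ∧ PtLE (hbSupport k + τ • rel k j) k ε := by
  have lim : ∀ x y : ℝ, Tendsto (fun δ : ℝ => (1 - δ) * x + δ * y) (nhdsWithin 0 (Ioi 0))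
      (nhds x) := fun x y => by
    have : ContinuousAt (fun δ : ℝ => (1 - δ) * x + δ * y) 0 := by fun_prop
    have h := this.tendsto.mono_left (nhdsWithin_le_nhds (s := Ioi 0))
    simpa using h
  obtain ⟨δ, hδs, hδt, hδε, hδ1, hδ0⟩ := (((lim s s₁).eventually_const_lt hs).and
    (((lim t t₁).eventually_const_lt ht).and
    (((lim 0 (‖rel a j‖ + ‖rel a k‖)).eventually_lt_const hε).and
    (((lim 0 1).eventually_lt_const one_pos).and
    (eventually_mem_nhdsWithin (a := (0:ℝ)) (s := Ioi 0)))))).exists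
  replace hδ0 : 0 < δ := hδ0
  replace hδ1 : δ < 1 := by linarith
  have hδ1' : 0 < 1 - δ := by linarith
  refine ⟨δ, hδ0, hδ1, ?_⟩
  have p1 := hk.smul_ptLE_right (t := 1 - δ) hδ1' (by linarith)
  have e1 : hbSupport k + δ • rel k j = hbSupport a + ((1 - δ) • rel a k + δ • rel a j) := by
    rw [rel, rel, rel]; module
  have hseg : segment ℝ (hbSupport a + ((1 - δ) • rel a k + δ • rel a j))
      (hbSupport a + (1 - δ) • rel a k) ⊆ S := by
    refine segment_subset_of_smul fun r h0 h1 => ?_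
    have hr : 0 ≤ 1 - r := by linarith
    have hs' : 0 < (1 - δ) * s + (1 - r) * δ * s₁ := by
      have e : (1 - δ) * s + (1 - r) * δ * s₁ =
        r * ((1 - δ) * s) + (1 - r) * ((1 - δ) * s + δ * s₁) := by ring
      rw [e]
      rcases h0.eq_or_lt with rfl | h0
      · linarith
      · have := mul_pos h0 (mul_pos hδ1' hs)
        have := mul_nonneg hr hδs.le
        linarith
    have ht' : 0 < (1 - δ) * t + (1 - r) * δ * t₁ := by
      have e : (1 - δ) * t + (1 - r) * δ * t₁ =
        r * ((1 - δ) * t) + (1 - r) * ((1 - δ) * t + δ * t₁) := by ring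
      rw [e]
      rcases h0.eq_or_lt with rfl | h0
      · linarith
      · have := mul_pos h0 (mul_pos hδ1' ht)
        have := mul_nonneg hr hδt.le
        linarith
    have hf' : l * ((1 - δ) * s + (1 - r) * δ * s₁) + m * ((1 - δ) * t + (1 - r) * δ * t₁) < 1 := by
      have e : l * ((1 - δ) * s + (1 - r) * δ * s₁) + m * ((1 - δ) * t + (1 - r) * δ * t₁) =
        (1 - δ) * (l * s + m * t) + δ * ((1 - r) * (l * s₁ + m * t₁)) := by ring
      rw [e, hf]
      have : (1 - r) * (l * s₁ + m * t₁) < 1 := by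
        rcases h0.eq_or_lt with rfl | h0
        · linarith
        · have := mul_nonneg hr (sub_nonneg.2 hj.le)
          linarith
      have := mul_lt_mul_of_pos_left this hδ0
      linarith
    convert hc _ _ hs'.le ht'.le (by linarith) hf' using 2
    rw [hk', hj']; module
  rw [e1]
  have p2 := IntLE.of_segment hseg
  refine (p2.trans_pt p1).mono ?_
  have : dist (hbSupport a + ((1 - δ) • rel a k + δ • rel a j)) (hbSupport a + (1 - δ) • rel a k) =
      δ * ‖rel a j‖ := by
    rw [dist_add_left, dist_eq_norm, add_sub_cancel_left, norm_smul, Real.norm_of_nonneg hδ0.le]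
  rw [this]
  linarith

/-- Two boundary points on lines bounding free caps at `a` and `b` see each other if each lies
strictly on the inner side of the line of the other and the segment between them is free. -/
theorem Cap.sees_of_caps (hS : IsOpen S) {X W X' W' : Euc 2}
    {l m s t s₁ t₁ l' m' s' t' s₁' t₁' : ℝ}
    (hc : Cap S (hbSupport a) X W l m) (hk : Sees a k) (hk' : rel a k = s • X + t • W)
    (hs : 0 < s) (ht : 0 < t) (hf : l * s + m * t = 1) (hj' : rel a j = s₁ • X + t₁ • W)
    (hlt : l * s₁ + m * t₁ < 1)
    (hcb : Cap S (hbSupport b) X' W' l' m') (hj : Sees b j) (hjb : rel b j = s' • X' + t' • W')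
    (hs' : 0 < s') (ht' : 0 < t') (hf' : l' * s' + m' * t' = 1)
    (hkb : rel b k = s₁' • X' + t₁' • W') (hlt' : l' * s₁' + m' * t₁' < 1)
    (hm : ∀ τ : ℝ, 0 < τ → τ < 1 → hbSupport j + τ • rel j k ∈ S) : Sees j k := by
  refine Sees.of_near hS hm (fun ε hε => hcb.near hj hjb hs' ht' hf' hkb hlt' hε)
    fun ε hε => ?_
  obtain ⟨τ, h0, h1, h⟩ := hc.near hk hk' hs ht hf hj' hlt hε
  refine ⟨1 - τ, by linarith, by linarith, ?_⟩
  convert h using 1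
  rw [rel, rel]; module

end Bridge

section Core

variable {S : Set (Euc 2)} {a b c d e j k : HausdorffBoundary S}

theorem add_coord_swap (a b : HausdorffBoundary S) (n : Euc 2) (u h : ℝ) :
    hbSupport b + ((1 - u) • rel b a + h • n) = hbSupport a + (u • rel a b + h • n) := by
  rw [rel, rel]; module

theorem rel_coord_swap {n : Euc 2} {u h : ℝ} (hk : rel a k = u • rel a b + h • n) :
    rel b k = (1 - u) • rel b a + h • n := by
  rw [rel_eq_sub a b k, rel_swap a b, hk]; module

theorem Cap.mem_coord {o w n : Euc 2} {l m κ u h : ℝ} (hc : Cap S o (κ • w + n) w l m)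
    (hh : 0 ≤ h) (hu : κ * h ≤ u) (hpos : 0 < h + (u - κ * h)) (hf : l * h + m * (u - κ * h) < 1) :
    o + (u • w + h • n) ∈ S := by
  convert hc h (u - κ * h) hh (by linarith) hpos hf using 2
  module

theorem coord_lt_of_small {l m u h κ κ' v g : ℝ} (hm : 1 ≤ m) (hf : l * h + m * (u - κ * h) = 1)
    (hu : κ * h < u) (hu' : 1 - u < κ' * h) (hh : 0 < h) (hg : 0 < g) (hv : v < κ * g)
    (hg1 : (κ + κ') * g ≤ 1) : l * g + m * (v - κ * g) < 1 := by
  have h1 := mul_le_mul_of_nonneg_right hm (sub_pos.2 hu).le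
  have h2 : l < κ + κ' := lt_of_mul_lt_mul_right (by linarith : l * h < (κ + κ') * h) hh.le
  have h3 := mul_lt_mul_of_pos_right h2 hg
  have h4 := mul_pos (by linarith : 0 < m) (sub_pos.2 hv)
  linarith

/-- Points on the lines bounding free caps at the two ends of `ab`, on the same side of `ab` and
close to the opposite ends of `ab`, see each other. -/
theorem Cap.sees_of_same_side (hS : IsOpen S) {n : Euc 2} {l m u h κ l' m' u' h' κ' : ℝ}
    (hc : Cap S (hbSupport a) (κ • rel a b + n) (rel a b) l m)
    (hk : Sees a k) (hk' : rel a k = u • rel a b + h • n) (hh : 0 < h) (hm : 1 ≤ m)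
    (hf : l * h + m * (u - κ * h) = 1) (hu₁ : κ * h < u) (hu₂ : 1 - u < κ' * h)
    (hκh : (κ + κ') * h ≤ 1)
    (hc' : Cap S (hbSupport b) (κ' • rel b a + n) (rel b a) l' m')
    (hj : Sees b j) (hj' : rel b j = u' • rel b a + h' • n) (hh' : 0 < h') (hm' : 1 ≤ m')
    (hf' : l' * h' + m' * (u' - κ' * h') = 1) (hu₁' : κ' * h' < u') (hu₂' : 1 - u' < κ * h')
    (hκh' : (κ + κ') * h' ≤ 1) : Sees j k := by
  have hfj : l * h' + m * ((1 - u') - κ * h') < 1 := coord_lt_of_small hm hf hu₁ hu₂ hh hh' hu₂' hκh'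
  have hfk : l' * h + m' * ((1 - u) - κ' * h) < 1 :=
    coord_lt_of_small hm' hf' hu₁' hu₂' hh' hh hu₂ (by linarith)
  have hja := rel_coord_swap hj'
  have hkb := rel_coord_swap hk'
  refine hc.sees_of_caps hS hk (s := h) (t := u - κ * h) (by rw [hk']; module) hh (sub_pos.2 hu₁) hf
    (s₁ := h') (t₁ := (1 - u') - κ * h') (by rw [hja]; module) hfj hc' hj (s' := h')
    (t' := u' - κ' * h') (by rw [hj']; module) hh' (sub_pos.2 hu₁') hf' (s₁' := h)
    (t₁' := (1 - u) - κ' * h) (by rw [hkb]; module) hfk fun τ h0 h1 => ?_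
  have h1' : 0 < 1 - τ := sub_pos.2 h1
  set v := (1 - τ) * (1 - u') + τ * u with hv
  set g := (1 - τ) * h' + τ * h with hg
  have hg0 : 0 < g := add_pos (mul_pos h1' hh') (mul_pos h0 hh)
  have hg1 : (κ + κ') * g ≤ 1 := by
    have e : (κ + κ') * g = (1 - τ) * ((κ + κ') * h') + τ * ((κ + κ') * h) := by rw [hg]; ring
    have := mul_le_mul_of_nonneg_left hκh' h1'.le
    have := mul_le_mul_of_nonneg_left hκh h0.le
    linarith
  have hq : hbSupport j + τ • rel j k = hbSupport a + (v • rel a b + g • n) := by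
    rw [rel_eq_sub a j k, ← add_rel a j, hja, hk', hv, hg]; module
  rcases le_or_gt (κ * g) v with hle | hlt
  · rw [hq]
    refine hc.mem_coord hg0.le hle (by linarith) ?_
    have e : l * g + m * (v - κ * g) = (1 - τ) * (l * h' + m * ((1 - u') - κ * h')) +
      τ * (l * h + m * (u - κ * h)) := by rw [hv, hg]; ring
    have := mul_lt_mul_of_pos_left hfj h1'
    rw [e, hf]; linarith
  · rw [hq, ← add_coord_swap]
    refine hc'.mem_coord hg0.le (by linarith) (by linarith) ?_
    have e : l' * g + m' * ((1 - v) - κ' * g) = (1 - τ) * (l' * h' + m' * (u' - κ' * h')) +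
      τ * (l' * h + m' * ((1 - u) - κ' * h)) := by rw [hv, hg]; ring
    have := mul_lt_mul_of_pos_left hfk h0
    rw [e, hf']; linarith

theorem coord_lt_of_opposite {l m u h κ v g : ℝ} (hm : 1 ≤ m) (hl : 0 < l)
    (hf : l * h + m * (u - κ * h) = 1) (hh : 0 < h) (hu : 1 / 2 ≤ u - κ * h) (hg : 0 < g)
    (hv : v + κ * g < 1 / 2) : l * -g + m * (v - κ * -g) < 1 := by
  have h1 := mul_le_mul_of_nonneg_left hu (by linarith : 0 ≤ m)
  have h2 := mul_pos hl hh
  have h3 := mul_pos hl hg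
  have h4 := mul_lt_mul_of_pos_left hv (by linarith : 0 < m)
  linarith

theorem crossing_pos {l m κ u h v g : ℝ} (hm : 1 ≤ m) (hh : 0 < h) (hg : 0 < g)
    (hf : l * h + m * (u - κ * h) = 1) (hlt : l * -g + m * ((1 - v) - κ * -g) < 1) :
    0 < h * v + g * (1 - u) := by
  have h1 := mul_lt_mul_of_pos_left hlt hh
  have e : h * (l * -g + m * ((1 - v) - κ * -g)) + g * (l * h + m * (u - κ * h)) =
    m * ((h + g) - (h * v + g * (1 - u))) := by ring
  rw [hf] at e
  by_contra hn
  have := mul_le_mul_of_nonneg_right hm (by linarith : 0 ≤ (h + g) - (h * v + g * (1 - u)))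
  linarith

theorem Cap.mem_of_opposite {o w n : Euc 2} {l m κ u h v g τ : ℝ}
    (hc : Cap S o (κ • w + n) w l m) (hh : 0 < h)
    (hf : l * h + m * (u - κ * h) = 1) (hu : 0 < u - κ * h)
    (hlt : l * -g + m * (v - κ * -g) < 1) (hX : 0 < h * v + g * u) (h1 : τ < 1)
    (hpos : 0 ≤ (1 - τ) * -g + τ * h) :
    o + (((1 - τ) * v + τ * u) • w + ((1 - τ) * -g + τ * h) • n) ∈ S := by
  have h1' : 0 < 1 - τ := sub_pos.2 h1
  set x := (1 - τ) * v + τ * u with hx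
  set y := (1 - τ) * -g + τ * h with hy
  have hxy : 0 < x - κ * y := by
    have e : h * (x - κ * y) = (1 - τ) * (h * v + g * u) + y * (u - κ * h) := by
      rw [hx, hy]; ring
    have h2 := mul_pos h1' hX
    have h3 := mul_nonneg hpos hu.le
    exact pos_of_mul_pos_right (by linarith : 0 < h * (x - κ * y)) hh.le
  refine hc.mem_coord hpos (by linarith) (by linarith) ?_
  have e : l * y + m * (x - κ * y) = (1 - τ) * (l * -g + m * (v - κ * -g)) +
    τ * (l * h + m * (u - κ * h)) := by rw [hx, hy]; ring
  have := mul_lt_mul_of_pos_left hlt h1'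
  rw [e, hf]; linarith

/-- Points on the lines bounding free caps at the two ends of `ab`, on opposite sides of `ab` and
close to the opposite ends of `ab`, see each other. -/
theorem Cap.sees_of_opposite_side (hS : IsOpen S) {n : Euc 2} {l m u h κ l' m' u' h' κ' : ℝ}
    (hc : Cap S (hbSupport a) (κ • rel a b + n) (rel a b) l m)
    (hk : Sees a k) (hk' : rel a k = u • rel a b + h • n) (hh : 0 < h) (hm : 1 ≤ m) (hl : 0 < l)
    (hf : l * h + m * (u - κ * h) = 1) (hu₁ : 1 / 2 ≤ u - κ * h) (hu₂ : 1 - u + κ' * h < 1 / 2)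
    (hc' : Cap S (hbSupport b) (κ' • rel b a + -n) (rel b a) l' m')
    (hj : Sees b j) (hj' : rel b j = u' • rel b a + h' • -n) (hh' : 0 < h') (hm' : 1 ≤ m')
    (hl' : 0 < l') (hf' : l' * h' + m' * (u' - κ' * h') = 1) (hu₁' : 1 / 2 ≤ u' - κ' * h')
    (hu₂' : 1 - u' + κ * h' < 1 / 2) : Sees j k := by
  have hfj := coord_lt_of_opposite hm hl hf hh hu₁ hh' hu₂'
  have hfk := coord_lt_of_opposite hm' hl' hf' hh' hu₁' hh hu₂
  have hX := crossing_pos hm' hh' hh hf' hfk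
  have hX' := crossing_pos hm hh hh' hf hfj
  have hja := rel_coord_swap hj'
  have hkb := rel_coord_swap hk'
  refine hc.sees_of_caps hS hk (s := h) (t := u - κ * h) (by rw [hk']; module) hh (by linarith) hf
    (s₁ := -h') (t₁ := (1 - u') - κ * -h') (by rw [hja]; module) hfj hc' hj (s' := h')
    (t' := u' - κ' * h') (by rw [hj']; module) hh' (by linarith) hf' (s₁' := -h)
    (t₁' := (1 - u) - κ' * -h) (by rw [hkb]; module) hfk fun τ h0 h1 => ?_
  rcases le_total 0 ((1 - τ) * -h' + τ * h) with hle | hle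
  · convert hc.mem_of_opposite hh hf (by linarith) hfj (by linarith) h1 hle using 1
    rw [rel_eq_sub a j k, ← add_rel a j, hja, hk']; module
  · convert hc'.mem_of_opposite (τ := 1 - τ) hh' hf' (by linarith) hfk (by linarith)
      (by linarith) (by linarith) using 1
    rw [rel_eq_sub b j k, ← add_rel b j, hkb, hj']; module

/-- Visible boundary points on lines bounding free caps at `a` accumulate at `b`
on the side of `n`. -/
def AccAt (a b : HausdorffBoundary S) (n : Euc 2) (κ : ℝ) : Prop :=
  ∀ ε : ℝ, 0 < ε → ∃ (k : HausdorffBoundary S) (u h l m : ℝ),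
    rel a k = u • rel a b + h • n ∧ 0 < h ∧ h < ε ∧ |u - 1| < ε ∧ BA k a b ∧
    Cap S (hbSupport a) (κ • rel a b + n) (rel a b) l m ∧ 1 ≤ m ∧ 0 < l ∧
    l * h + m * (u - κ * h) = 1

/-- Some boundary point on the side of `n` spans boundary angles with `ab` at both ends. -/
def GapAt (a b : HausdorffBoundary S) (n : Euc 2) : Prop :=
  ∃ (e : HausdorffBoundary S) (u h : ℝ), 0 < h ∧ rel a e = u • rel a b + h • n ∧
    BA e a b ∧ BA e b a

theorem BA.accAt_or_gapAt (hS : IsOpen S) (h : BA c a b) {n : Euc 2} {κ r : ℝ} (hr : 0 < r)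
    (hc : rel a c = r • (κ • rel a b + n)) : AccAt a b n κ ∨ GapAt a b n := by
  rcases h.gap_or_acc hS with hacc | ⟨e, s, t, hs, ht, he, h1, h2⟩
  · refine Or.inl fun ε hε => ?_
    set A := 1 + r + r * |κ| with hA
    have hA0 : 0 < A := by positivity
    obtain ⟨k, s, t, l, m, hk, hs, ht, hsε, htε, hak, hcap, hf⟩ := hacc (ε / A) (by positivity)
    rw [lt_div_iff₀ hA0] at hsε htε
    have hl := hcap.one_le_left hS
    have hm := hcap.one_le_right hS
    have hsr : 0 ≤ s * r := by positivity
    have hsrκ : 0 ≤ s * (r * |κ|) := by positivity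
    have hk' : rel a k = (t + s * r * κ) • rel a b + (s * r) • n := by rw [hk, hc]; module
    refine ⟨k, t + s * r * κ, s * r, l / r, m, hk', mul_pos hs hr, ?_, ?_, ?_, ?_, hm,
      div_pos (by linarith) hr, ?_⟩
    · have : s * A = s + s * r + s * (r * |κ|) := by rw [hA]; ring
      linarith
    · have e1 : t + s * r * κ - 1 = (t - 1) + s * r * κ := by ring
      have e2 := abs_add_le (t - 1) (s * r * κ)
      rw [abs_mul, abs_of_nonneg hsr, ← e1] at e2
      rcases le_total |t - 1| s with hle | hle
      · have : s * A = s + s * r + s * r * |κ| := by rw [hA]; ring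
        linarith
      · have e3 : |t - 1| * A = |t - 1| + |t - 1| * r + |t - 1| * (r * |κ|) := by rw [hA]; ring
        have e4 := mul_le_mul_of_nonneg_right hle (by positivity : 0 ≤ r * |κ|)
        have e5 : 0 ≤ |t - 1| * r := by positivity
        linarith
    · refine ⟨hak, h.right, ?_, ?_⟩
      · rw [hk, cross_add_left, cross_smul_left, cross_smul_left, cross_self_eq, mul_zero, add_zero]
        exact mul_ne_zero hs.ne' h.indep
      · have := h.free.mono hs.le ht le_rfl zero_le_one (by linarith) (by norm_num)
        rwa [← hk, zero_smul, one_smul, zero_add] at this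
    · intro p q hp hq hpq hlt
      have e1 : p / r * r = p := div_mul_cancel₀ _ hr.ne'
      have hpr : 0 ≤ p / r := by positivity
      convert hcap (p / r) q hpr hq ?_ ?_ using 2
      · rw [hc, smul_smul, e1]
      · rcases hq.eq_or_lt with rfl | hq
        · have : 0 < p / r := div_pos (by linarith) hr
          linarith
        · linarith
      · have : l * (p / r) = l / r * p := by ring
        rw [this]
        linarith
    · rw [← hf]; field_simp; ring
  · refine Or.inr ⟨e, t + s * r * κ, s * r, mul_pos hs hr, ?_, h1, h2⟩
    rw [he, hc]; module

end Core

section Turn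

variable {U V : Set (Euc 2)} {a b c d e j k : HausdorffBoundary U}

theorem BA.free_coord (h : BA c a b) {n : Euc 2} {κ r : ℝ} (hr : 0 < r)
    (hc : rel a c = r • (κ • rel a b + n)) :
    Free U (hbSupport a) (κ • rel a b + n) (rel a b) := by
  have := h.free.mono (inv_pos.2 hr).le le_rfl le_rfl zero_le_one
    (by rw [add_zero]; exact inv_pos.2 hr) (by norm_num)
  rwa [hc, smul_smul, inv_mul_cancel₀ hr.ne', one_smul, zero_smul, zero_smul, one_smul, add_zero,
    zero_add] at this

theorem Free.coord_gt (hU : IsOpen U) {n : Euc 2} {κ : ℝ}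
    (hf : Free U (hbSupport a) (κ • rel a b + n) (rel a b)) :
    ∃ R : ℝ, 0 < R ∧ ∀ (j : HausdorffBoundary U) (u h : ℝ), rel a j = u • rel a b + h • n →
      0 < h → h + (u - κ * h) < R → u < κ * h := by
  obtain ⟨R, hR, hf⟩ := hf
  refine ⟨R, hR, fun j u h hj hh hlt => ?_⟩
  by_contra! hcon
  have := hf h (u - κ * h) hh.le (by linarith) (by linarith) hlt
  rw [show h • (κ • rel a b + n) + (u - κ * h) • rel a b = u • rel a b + h • n by module, ← hj,
    add_rel] at this
  exact hbSupport_notMem hU j this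

theorem abs_mul_bounds {κ h ε : ℝ} (hh : 0 < h) (hε : h < ε) :
    -(|κ| * ε) ≤ κ * h ∧ κ * h ≤ |κ| * ε := by
  have h1 := mul_le_mul_of_nonneg_left hε.le (abs_nonneg κ)
  have h2 : |κ * h| = |κ| * h := by rw [abs_mul, abs_of_pos hh]
  exact abs_le.1 (by rw [h2]; exact h1)

theorem BA.orient_eq_of_gapAt (I : HBIso U V) (hc : BA c a b) (hd : BA d b a) {n : Euc 2}
    {u h u' h' : ℝ} (hh : 0 < h) (hh' : 0 < h') (hc' : rel a c = u • rel a b + h • n)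
    (hd' : rel b d = u' • rel b a + h' • n) (hg : GapAt a b n) :
    orient I a b c = orient I a b d := by
  obtain ⟨e, v, g, hg, he, h1, h2⟩ := hg
  rw [hc.orient_eq_of_same_side h1 hc' he hh hg, ← orient_swap I a b e,
    h2.orient_eq_of_same_side hd (rel_coord_swap he) hd' hg hh', orient_swap]

/-- Two boundary angles at the ends of `ab`, on the same side of `ab`,
are mapped with the same orientation. -/
theorem BA.orient_eq_of_ends_same_side (I : HBIso U V) (hc : BA c a b) (hd : BA d b a) {n : Euc 2}
    {κ κ' r r' : ℝ} (hr : 0 < r) (hr' : 0 < r') (hc' : rel a c = r • (κ • rel a b + n))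
    (hd' : rel b d = r' • (κ' • rel b a + n)) : orient I a b c = orient I a b d := by
  have hU := I.isOpen_left
  have ec : rel a c = (r * κ) • rel a b + r • n := by rw [hc']; module
  have ed : rel b d = (r' * κ') • rel b a + r' • n := by rw [hd']; module
  rcases hc.accAt_or_gapAt hU hr hc' with h1 | h1
  swap
  · exact hc.orient_eq_of_gapAt I hd hr hr' ec ed h1
  rcases hd.accAt_or_gapAt hU hr' hd' with h2 | h2
  swap
  · rw [← orient_swap I a b c, ← orient_swap I a b d]
    exact (hd.orient_eq_of_gapAt I hc hr' hr ed ec h2).symm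
  obtain ⟨R, hR, hfa⟩ := (hc.free_coord hr hc').coord_gt hU
  obtain ⟨R', hR', hfb⟩ := (hd.free_coord hr' hd').coord_gt hU
  set A := 2 + |κ| + |κ'| with hA
  have hA0 : 0 < A := by positivity
  set ρ := min 1 (min R R') with hρ
  have hρ0 : 0 < ρ := by positivity
  have hρ1 : ρ ≤ 1 := min_le_left _ _
  have hρR : ρ ≤ R := (min_le_right _ _).trans (min_le_left _ _)
  have hρR' : ρ ≤ R' := (min_le_right _ _).trans (min_le_right _ _)
  set ε := ρ / A with hε
  have hε0 : 0 < ε := by positivity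
  have hεA : 2 * ε + |κ| * ε + |κ'| * ε = ρ := by
    have : 2 * ε + |κ| * ε + |κ'| * ε = ε * A := by rw [hA]; ring
    rw [this, hε, div_mul_cancel₀ _ hA0.ne']
  have q1 : 0 ≤ |κ| * ε := by positivity
  have q2 : 0 ≤ |κ'| * ε := by positivity
  obtain ⟨k, u, h, l, m, hk, hh, hhε, huε, hka, hcap, hm, hl, hf⟩ := h1 ε hε0
  obtain ⟨j, u', h', l', m', hj, hh', hhε', huε', hjb, hcap', hm', hl', hf'⟩ := h2 ε hε0
  obtain ⟨b1, b2⟩ := abs_lt.1 huε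
  obtain ⟨b3, b4⟩ := abs_lt.1 huε'
  obtain ⟨k1, k2⟩ := abs_mul_bounds (κ := κ) hh hhε
  obtain ⟨k3, k4⟩ := abs_mul_bounds (κ := κ') hh hhε
  obtain ⟨k5, k6⟩ := abs_mul_bounds (κ := κ) hh' hhε'
  obtain ⟨k7, k8⟩ := abs_mul_bounds (κ := κ') hh' hhε'
  have hjk : Sees j k := hcap.sees_of_same_side hU hka.left hk hh hm hf (by linarith)
    (hfb k _ _ (rel_coord_swap hk) hh (by linarith)) (by linarith) hcap' hjb.left hj hh' hm' hf'
    (by linarith) (hfa j _ _ (rel_coord_swap hj) hh' (by linarith)) (by linarith)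
  rw [hc.orient_eq_of_same_side hka ec hk hr hh,
    (hka.rigid I).orient_eq_of_sees (hjb.rigid I).symm hjk.symm, ← orient_swap I a b j,
    hjb.orient_eq_of_same_side hd hj ed hh' hr', orient_swap]

theorem BA.orient_eq_of_gapAt_opposite (I : HBIso U V) (hc : BA c a b) (hd : BA d b a) {n : Euc 2}
    {u h κ r : ℝ} (hh : 0 < h) (hr : 0 < r) (hc' : rel a c = u • rel a b + h • n)
    (hd' : rel b d = r • (κ • rel b a + -n)) (hg : GapAt a b n) :
    orient I a b c = orient I a b d := by
  obtain ⟨e, v, g, hg, he, h1, h2⟩ := hg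
  have ed : rel b d = (r * κ) • rel b a + r • -n := by rw [hd']; module
  have he' := rel_coord_swap he
  rw [hc.orient_eq_of_same_side h1 hc' he hh hg]
  rcases hd.accAt_or_gapAt I.isOpen_left hr hd' with hacc | ⟨e', v', g', hg', hb, h3, h4⟩
  · set A := 2 + 2 * |1 - v| / g with hA
    have hA0 : 0 < A := by positivity
    obtain ⟨k, u', h', l', m', hk, hh', hhε', huε', hkb, -⟩ := hacc (1 / A) (by positivity)
    rw [lt_div_iff₀ hA0] at hhε' huε'
    have hpos : 0 < (1 - v) * h' + u' * g := by
      have e1 : |u' - 1| * A = 2 * |u' - 1| + 2 * (|u' - 1| * (|1 - v| / g)) := by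
        rw [hA]; ring
      have e2 : h' * A * g = 2 * (h' * g) + 2 * (h' * |1 - v|) := by rw [hA]; field_simp
      have e3 : 0 ≤ |u' - 1| * (|1 - v| / g) := by positivity
      have e4 : 1 / 2 < u' := by
        have := neg_abs_le (u' - 1)
        linarith
      have e5 := mul_lt_mul_of_pos_right hhε' hg
      have e6 := mul_lt_mul_of_pos_right e4 hg
      have e7 := mul_le_mul_of_nonneg_left (neg_abs_le (1 - v)) hh'.le
      have e8 := mul_pos hh' hg
      linarith
    rw [← orient_swap I a b e, h2.orient_eq_of_opposite_side hkb he' hk hg hh' hpos,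
      hkb.orient_eq_of_same_side hd hk ed hh' hr, orient_swap]
  · have hed : orient I a b e = orient I a b e' := by
      by_cases hpos : 0 < v * g' + (1 - v') * g
      · exact h1.orient_eq_of_opposite_side h4 he (rel_coord_swap hb) hg hg' hpos
      · rw [← orient_swap I a b e, ← orient_swap I a b e']
        refine h2.orient_eq_of_opposite_side h3 he' hb hg hg' ?_
        linarith
    rw [hed, ← orient_swap I a b e', h3.orient_eq_of_same_side hd hb ed hg' hr, orient_swap]

/-- Two boundary angles at the ends of `ab`, on opposite sides of `ab`,
are mapped with the same orientation. -/
theorem BA.orient_eq_of_ends_opposite_side (I : HBIso U V) (hc : BA c a b) (hd : BA d b a)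
    {n : Euc 2} {κ κ' r r' : ℝ} (hr : 0 < r) (hr' : 0 < r')
    (hc' : rel a c = r • (κ • rel a b + n)) (hd' : rel b d = r' • (κ' • rel b a + -n)) :
    orient I a b c = orient I a b d := by
  have hU := I.isOpen_left
  have ec : rel a c = (r * κ) • rel a b + r • n := by rw [hc']; module
  have ed : rel b d = (r' * κ') • rel b a + r' • -n := by rw [hd']; module
  rcases hc.accAt_or_gapAt hU hr hc' with h1 | h1
  swap
  · exact hc.orient_eq_of_gapAt_opposite I hd hr hr' ec hd' h1
  rcases hd.accAt_or_gapAt hU hr' hd' with h2 | h2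
  swap
  · rw [← orient_swap I a b c, ← orient_swap I a b d]
    exact (hd.orient_eq_of_gapAt_opposite I hc hr' hr ed (by rw [neg_neg]; exact hc') h2).symm
  set A := 4 * (1 + |κ| + |κ'|) with hA
  have hA0 : 0 < A := by positivity
  set ε := 1 / A with hε
  have hε0 : 0 < ε := by positivity
  have hεA : ε + |κ| * ε + |κ'| * ε = 1 / 4 := by
    have : ε * A = 4 * (ε + |κ| * ε + |κ'| * ε) := by rw [hA]; ring
    have h3 : ε * A = 1 := by rw [hε, div_mul_cancel₀ _ hA0.ne']
    linarith
  have q1 : 0 ≤ |κ| * ε := by positivity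
  have q2 : 0 ≤ |κ'| * ε := by positivity
  obtain ⟨k, u, h, l, m, hk, hh, hhε, huε, hka, hcap, hm, hl, hf⟩ := h1 ε hε0
  obtain ⟨j, u', h', l', m', hj, hh', hhε', huε', hjb, hcap', hm', hl', hf'⟩ := h2 ε hε0
  obtain ⟨b1, b2⟩ := abs_lt.1 huε
  obtain ⟨b3, b4⟩ := abs_lt.1 huε'
  obtain ⟨k1, k2⟩ := abs_mul_bounds (κ := κ) hh hhε
  obtain ⟨k3, k4⟩ := abs_mul_bounds (κ := κ') hh hhε
  obtain ⟨k5, k6⟩ := abs_mul_bounds (κ := κ) hh' hhε'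
  obtain ⟨k7, k8⟩ := abs_mul_bounds (κ := κ') hh' hhε'
  have hjk : Sees j k := hcap.sees_of_opposite_side hU hka.left hk hh hm hl hf (by linarith)
    (by linarith) hcap' hjb.left hj hh' hm' hl' hf' (by linarith) (by linarith)
  rw [hc.orient_eq_of_same_side hka ec hk hr hh,
    (hka.rigid I).orient_eq_of_sees (hjb.rigid I).symm hjk.symm, ← orient_swap I a b j,
    hjb.orient_eq_of_same_side hd hj ed hh' hr', orient_swap]

theorem BA.orient_eq_of_ends (I : HBIso U V) (hc : BA c a b) (hd : BA d b a) :
    orient I a b c = orient I a b d := by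
  have hc' : rel a c = (1:ℝ) • ((0:ℝ) • rel a b + rel a c) := by module
  obtain ⟨x, y, hxy⟩ : ∃ x y : ℝ, rel b d = x • rel b a + y • rel a c := by
    have h0 : cross (rel b a) (rel a c) ≠ 0 := by
      rw [rel_swap a b, ← neg_one_smul ℝ (rel a b), cross_smul_left, cross_swap]
      intro h0; apply hc.indep; linarith
    exact ⟨_, _, exists_coords h0 (rel b d)⟩
  have hy : y ≠ 0 := by
    rintro rfl
    apply hd.indep
    rw [hxy, zero_smul, add_zero, cross_smul_left, cross_self_eq, mul_zero]
  rcases lt_or_gt_of_ne hy with hneg | hpos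
  · refine hc.orient_eq_of_ends_opposite_side I hd one_pos (neg_pos.2 hneg) hc' (κ' := x / -y) ?_
    rw [hxy, smul_add, smul_smul, mul_div_cancel₀ _ (neg_pos.2 hneg).ne']; module
  · refine hc.orient_eq_of_ends_same_side I hd one_pos hpos hc' (κ' := x / y) ?_
    rw [hxy, smul_add, smul_smul, mul_div_cancel₀ _ hy]

/-- Consecutive boundary angles: the distance of the outer points is preserved. -/
theorem BA.norm_rel_map_of_chain (I : HBIso U V) (h₁ : BA c a b) (h₂ : BA a b d) :
    ‖rel (I c) (I d)‖ = ‖rel c d‖ :=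
  ((h₁.rigid I).orient_eq_iff_norm (h₂.symm.rigid I).symm).1 (h₁.orient_eq_of_ends I h₂.symm)

end Turn

section Polygon

theorem inner_eq_of_dist_eq {p q r p' q' r' : Euc 2} (hp : dist p' r' = dist p r)
    (hq : dist q' r' = dist q r) (hpq : dist p' q' = dist p q) :
    inner ℝ (p' - r') (q' - r') = inner ℝ (p - r) (q - r) := by
  rw [real_inner_eq_norm_mul_self_add_norm_mul_self_sub_norm_sub_mul_self_div_two,
    real_inner_eq_norm_mul_self_add_norm_mul_self_sub_norm_sub_mul_self_div_two,
    sub_sub_sub_cancel_right, sub_sub_sub_cancel_right]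
  simp only [← dist_eq_norm, hp, hq, hpq]

theorem dist_eq_of_inner_eq {p q r p' q' r' : Euc 2} (hp : dist p' r' = dist p r)
    (hq : dist q' r' = dist q r)
    (h : inner ℝ (p' - r') (q' - r') = inner ℝ (p - r) (q - r)) : dist p' q' = dist p q := by
  have e : ‖(p' - r') - (q' - r')‖ ^ 2 = ‖(p - r) - (q - r)‖ ^ 2 := by
    rw [norm_sub_sq_real, norm_sub_sq_real (p - r), h]
    simp only [← dist_eq_norm, hp, hq]
  rw [sub_sub_sub_cancel_right, sub_sub_sub_cancel_right] at e
  rw [dist_eq_norm, dist_eq_norm]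
  exact (sq_eq_sq₀ (norm_nonneg _) (norm_nonneg _)).1 e

/-- A linear relation among three vectors is determined by their Gram matrix. -/
theorem eq_comb_of_inner_eq {E : Type*} [NormedAddCommGroup E] [InnerProductSpace ℝ E]
    {X W D X' W' D' : E} {α β : ℝ} (hD : D = α • X + β • W)
    (h1 : inner ℝ X' X' = inner ℝ X X) (h2 : inner ℝ W' W' = inner ℝ W W)
    (h3 : inner ℝ D' D' = inner ℝ D D) (h4 : inner ℝ X' W' = inner ℝ X W)
    (h5 : inner ℝ D' X' = inner ℝ D X) (h6 : inner ℝ D' W' = inner ℝ D W) :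
    D' = α • X' + β • W' := by
  have key : ∀ A B C : E, inner ℝ (A - (α • B + β • C)) (A - (α • B + β • C)) =
      inner ℝ A A - 2 * α * inner ℝ A B - 2 * β * inner ℝ A C + α ^ 2 * inner ℝ B B
        + 2 * α * β * inner ℝ B C + β ^ 2 * inner ℝ C C := by
    intro A B C
    simp only [inner_sub_left, inner_sub_right, inner_add_left, inner_add_right,
      real_inner_smul_left, real_inner_smul_right, real_inner_comm A B, real_inner_comm A C,
      real_inner_comm B C]
    ring
  have h0 := key D X W
  rw [← hD, sub_self, inner_zero_left] at h0
  have := key D' X' W'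
  rw [h1, h2, h3, h4, h5, h6, ← h0, inner_self_eq_zero, sub_eq_zero] at this
  exact this

/-- A polygonal line in the plane whose consecutive triples are not collinear is determined up to
isometry by the distances between vertices at most three apart. -/
theorem dist_eq_of_consecutive {m : ℕ} {x x' : ℕ → Euc 2}
    (h1 : ∀ i, 1 ≤ i → i + 1 ≤ m → dist (x' i) (x' (i + 1)) = dist (x i) (x (i + 1)))
    (h2 : ∀ i, 1 ≤ i → i + 2 ≤ m → dist (x' i) (x' (i + 2)) = dist (x i) (x (i + 2)))
    (h3 : ∀ i, 1 ≤ i → i + 3 ≤ m → dist (x' i) (x' (i + 3)) = dist (x i) (x (i + 3)))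
    (hc : ∀ i, 1 ≤ i → i + 2 ≤ m → cross (x i - x (i + 1)) (x (i + 2) - x (i + 1)) ≠ 0) (j : ℕ) :
    j ≤ m → ∀ i, 1 ≤ i → i ≤ j → dist (x' i) (x' j) = dist (x i) (x j) := by
  induction j using Nat.strong_induction_on with
  | _ j ih =>
    intro hj i hi hij
    obtain rfl | h := eq_or_lt_of_le hij
    · simp
    obtain rfl | h := eq_or_lt_of_le (Nat.succ_le_of_lt h)
    · exact h1 i hi hj
    obtain rfl | h := eq_or_lt_of_le (Nat.succ_le_of_lt h)
    · exact h2 i hi hj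
    obtain rfl | h := eq_or_lt_of_le (Nat.succ_le_of_lt h)
    · exact h3 i hi hj
    obtain ⟨n, rfl⟩ : ∃ n, j = n + 3 := ⟨j - 3, by omega⟩
    have hn : 1 ≤ n := by omega
    have dXy := h1 n hn (by omega)
    have dyW := h1 (n + 1) (by omega) (by omega)
    have dXW := h2 n hn (by omega)
    have dyD := h2 (n + 1) (by omega) (by omega)
    have dXD := h3 n hn (by omega)
    have dWD := h1 (n + 2) (by omega) (by omega)
    have dEy := ih (n + 1) (by omega) (by omega) i hi (by omega)
    have dEX := ih n (by omega) (by omega) i hi (by omega)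
    have dEW := ih (n + 2) (by omega) (by omega) i hi (by omega)
    have dWy : dist (x' (n + 2)) (x' (n + 1)) = dist (x (n + 2)) (x (n + 1)) := by
      rw [dist_comm, dyW, dist_comm]
    have dDy : dist (x' (n + 3)) (x' (n + 1)) = dist (x (n + 3)) (x (n + 1)) := by
      rw [dist_comm, dyD, dist_comm]
    have dDX : dist (x' (n + 3)) (x' n) = dist (x (n + 3)) (x n) := by
      rw [dist_comm, dXD, dist_comm]
    have dDW : dist (x' (n + 3)) (x' (n + 2)) = dist (x (n + 3)) (x (n + 2)) := by
      rw [dist_comm, dWD, dist_comm]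
    have hD := exists_coords (hc n hn (by omega)) (x (n + 3) - x (n + 1))
    have hD' := eq_comb_of_inner_eq hD (inner_eq_of_dist_eq dXy dXy (by simp))
      (inner_eq_of_dist_eq dWy dWy (by simp)) (inner_eq_of_dist_eq dDy dDy (by simp))
      (inner_eq_of_dist_eq dXy dWy dXW) (inner_eq_of_dist_eq dDy dXy dDX)
      (inner_eq_of_dist_eq dDy dWy dDW)
    refine dist_eq_of_inner_eq dEy dDy ?_
    rw [hD', congrArg (inner ℝ (x i - x (n + 1))) hD]
    simp only [inner_add_right, real_inner_smul_right, inner_eq_of_dist_eq dEy dXy dEX,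
      inner_eq_of_dist_eq dEy dWy dEW]

end Polygon

section BoundaryAngle

variable {U : Set (Euc 2)} {x y z : Euc 2} {a b c : HausdorffBoundary U}

theorem exists_eq_smul_of_cross_eq_zero {X W : Euc 2} (hX : X ≠ 0) (h : cross X W = 0) :
    ∃ r : ℝ, W = r • X := by
  have hn : inner ℝ X X ≠ 0 := inner_self_ne_zero.2 hX
  refine ⟨inner ℝ X W / inner ℝ X X, ?_⟩
  rw [div_eq_inv_mul, mul_smul, eq_inv_smul_iff₀ hn]
  rw [cross] at h
  ext i
  simp only [PiLp.smul_apply, smul_eq_mul, PiLp.inner_apply, RCLike.inner_apply, conj_trivial,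
    Fin.sum_univ_two]
  fin_cases i
  · simp only [Fin.zero_eta]
    linear_combination (-X 1) * h
  · simp only [Fin.mk_one]
    linear_combination (X 0) * h

theorem IsBoundaryAngle.cross_ne_zero (h : IsBoundaryAngle U x y z) :
    cross (x - y) (z - y) ≠ 0 := by
  intro h0
  refine h.1 ?_
  rw [collinear_iff_of_mem (p₀ := y) (by simp)]
  by_cases hX : x - y = 0
  · refine ⟨z - y, ?_⟩
    simp only [mem_insert_iff, mem_singleton_iff, forall_eq_or_imp, forall_eq, vadd_eq_add]
    exact ⟨⟨0, by rw [zero_smul, zero_add, sub_eq_zero.1 hX]⟩, ⟨0, by simp⟩, ⟨1, by simp⟩⟩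
  · obtain ⟨r, hr⟩ := exists_eq_smul_of_cross_eq_zero hX h0
    refine ⟨x - y, ?_⟩
    simp only [mem_insert_iff, mem_singleton_iff, forall_eq_or_imp, forall_eq, vadd_eq_add]
    exact ⟨⟨1, by simp⟩, ⟨0, by simp⟩, ⟨r, by rw [← hr, sub_add_cancel]⟩⟩

theorem IsBoundaryAngle.isFree (h : IsBoundaryAngle U x y z) : Free U y (x - y) (z - y) := by
  have hc := h.cross_ne_zero
  obtain ⟨-, -, -, -, -, -, r, hr, hU⟩ := h
  refine ⟨r / (‖x - y‖ + ‖z - y‖ + 1), by positivity, fun s t hs ht hst hlt => hU ⟨⟨?_, ?_⟩, ?_⟩⟩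
  · rw [mem_ball, dist_eq_norm, add_sub_cancel_left]
    rw [lt_div_iff₀ (by positivity)] at hlt
    have h1 := norm_add_le (s • (x - y)) (t • (z - y))
    rw [norm_smul, norm_smul, Real.norm_of_nonneg hs, Real.norm_of_nonneg ht] at h1
    have := mul_nonneg hs (norm_nonneg (z - y))
    have := mul_nonneg ht (norm_nonneg (x - y))
    linarith
  · exact ⟨s, t, hs, ht, (add_assoc _ _ _).symm⟩
  · rw [mem_singleton_iff, add_eq_left, comb_eq_zero_iff hc]
    rintro ⟨rfl, rfl⟩
    simp at hst

theorem Free.generates_eq (hf : Free U y (x - y) (z - y)) (hx : openSegment ℝ y x ⊆ U)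
    (hz : openSegment ℝ y z ⊆ U) (ha : GeneratesEndpoint U y x a)
    (hb : GeneratesEndpoint U y z b) : a = b := by
  obtain ⟨R, hR, hf⟩ := hf
  refine eq_of_forall_ptLE fun ε hε => ?_
  have hK : 0 < ‖x - y‖ + ‖z - y‖ + 1 := by positivity
  obtain ⟨t, ht0, ht⟩ := exists_between
    (show 0 < min 1 (min R (ε / (2 * (‖x - y‖ + ‖z - y‖ + 1)))) by positivity)
  obtain ⟨ht1, ht⟩ := lt_min_iff.1 ht
  obtain ⟨htR, htε⟩ := lt_min_iff.1 ht
  rw [lt_div_iff₀ (by positivity)] at htε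
  have hmem : ∀ w : Euc 2, y + t • (w - y) ∈ openSegment ℝ y w := fun w =>
    ⟨1 - t, t, by linarith, ht0, by ring, by module⟩
  have hdist : ∀ w : Euc 2, dist (y + t • (w - y)) y = t * ‖w - y‖ := fun w => by
    rw [dist_eq_norm, add_sub_cancel_left, norm_smul, Real.norm_of_nonneg ht0.le]
  have h1 := ha.ptLE hx (hmem x)
  have h2 := hb.ptLE hz (hmem z)
  have hs : segment ℝ (y + t • (x - y)) (y + t • (z - y)) ⊆ U :=
    segment_subset_of_smul fun s hs0 hs1 => by
      rw [smul_smul, smul_smul]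
      have e : (1 - s) * t + s * t = t := by ring
      exact hf _ _ (mul_nonneg (by linarith) ht0.le) (mul_nonneg hs0 ht0.le) (by rwa [e])
        (by rwa [e])
  have h3 := (IntLE.of_segment hs).trans_pt h2
  have h4 := dist_triangle_right (y + t • (x - y)) (y + t • (z - y)) y
  rw [hdist] at h1 h3
  rw [hdist, hdist] at h4
  have := mul_nonneg ht0.le (norm_nonneg (x - y))
  have := mul_nonneg ht0.le (norm_nonneg (z - y))
  exact ⟨_, h1.mono (by linarith), h3.mono (by linarith)⟩

theorem IsBoundaryAngle.symm (h : IsBoundaryAngle U x y z) : IsBoundaryAngle U z y x := by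
  obtain ⟨h1, h2, h3, h4, h5, h6, r, hr, h7⟩ := h
  refine ⟨?_, h4, h3, h2, by rwa [openSegment_symm], by rwa [openSegment_symm], r, hr, ?_⟩
  · rwa [insert_comm, pair_comm, insert_comm]
  · rintro p ⟨⟨hp, t, s, ht, hs, e⟩, hpy⟩
    exact h7 ⟨⟨hp, s, t, hs, ht, by rw [e, add_right_comm]⟩, hpy⟩

theorem IsBoundaryAngle.generates (hU : IsOpen U) (h : IsBoundaryAngle U x y z)
    (ha : GeneratesEndpoint U y x a) : GeneratesEndpoint U y z a := by
  have hf := h.isFree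
  obtain ⟨-, -, -, hz, hx, hz', -⟩ := h
  rw [openSegment_symm] at hx
  have hy : y ∉ U := ha.support ▸ hbSupport_notMem hU a
  obtain ⟨b, hb⟩ := exists_generatesEndpoint (w := z) (by rwa [openSegment_symm]) hy
  rwa [hf.generates_eq hx hz' ha hb]

theorem IsBoundaryAngle.ba (h : IsBoundaryAngle U x y z) (hx : hbSupport a = x)
    (hy : hbSupport b = y) (hz : hbSupport c = z) (hba : Sees b a) (hbc : Sees b c) :
    BA a b c := by
  have hX : rel b a = x - y := by rw [rel, hx, hy]
  have hZ : rel b c = z - y := by rw [rel, hz, hy]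
  exact ⟨hba, hbc, by rw [hX, hZ]; exact h.cross_ne_zero, by rw [hX, hZ, hy]; exact h.isFree⟩

theorem IsBoundaryAngle.ne (h : IsBoundaryAngle U x y z) : x ≠ y := by
  rintro rfl
  exact h.1 (by simp [collinear_pair])

end BoundaryAngle

/-- Lemma 2.11: if `x₁, …, x_m ∈ ∂U` are such that the ordered triples
`x_i, x_{i+1}, x_{i+2}` determine boundary angles for `U` (`i = 1, …, m−2`),
and `x'_i` is the support of the `f`-image of the Hausdorff-boundary element
with support `x_i` generated by an adjacent boundary interval, then
`|x'_i − x'_j| = |x_i − x_j|` for all `i, j = 1, …, m`. -/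
theorem boundary_angle_chain_invariance
    (U V : Set (Euc 2))
    (hU : IsEucDomain U) (hV : IsEucDomain V) (hU' : U ≠ univ) (hV' : V ≠ univ)
    (f : HausdorffBoundary U → HausdorffBoundary V) (hf : IsHBIsometry f)
    (m : ℕ) (hm : 3 ≤ m) (x : ℕ → Euc 2)
    (hbd : ∀ i, 1 ≤ i → i ≤ m → x i ∈ frontier U)
    (hangles : ∀ i, 1 ≤ i → i ≤ m - 2 →
      IsBoundaryAngle U (x i) (x (i + 1)) (x (i + 2)))
    (xt : ℕ → HausdorffBoundary U)
    (hgen : ∀ i, 1 ≤ i → i ≤ m →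
      (i < m ∧ GeneratesEndpoint U (x i) (x (i + 1)) (xt i)) ∨
      (1 < i ∧ GeneratesEndpoint U (x i) (x (i - 1)) (xt i))) :
    ∀ i, 1 ≤ i → i ≤ m → ∀ j, 1 ≤ j → j ≤ m →
      dist (hbSupport (f (xt i))) (hbSupport (f (xt j))) = dist (x i) (x j) := by
  let I : HBIso U V :=
    { isOpen_left := hU.1
      isOpen_right := hV.1
      ne_univ_left := hU'
      ne_univ_right := hV'
      toEquiv := Equiv.ofBijective f hf.1
      bdLE_iff' := fun a b r => by
        rw [bdLE_iff, bdLE_iff, Equiv.ofBijective_apply, Equiv.ofBijective_apply, hf.2] }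
  have hI : ∀ a, I a = f a := fun _ => rfl
  have hseg : ∀ i, 1 ≤ i → i < m → openSegment ℝ (x i) (x (i + 1)) ⊆ U ∧ x i ≠ x (i + 1) := by
    intro i hi him
    by_cases h : i ≤ m - 2
    · have ha := hangles i hi h
      exact ⟨ha.2.2.2.2.1, ha.ne⟩
    · obtain ⟨k, rfl⟩ : ∃ k, i = k + 1 := ⟨i - 1, by omega⟩
      have ha := hangles k (by omega) (by omega)
      exact ⟨ha.2.2.2.2.2.1, ha.symm.ne.symm⟩
  have hright : ∀ i, 1 ≤ i → i < m → GeneratesEndpoint U (x i) (x (i + 1)) (xt i) := by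
    intro i hi him
    obtain h | ⟨h1, h⟩ := hgen i hi him.le
    · exact h.2
    · obtain ⟨k, rfl⟩ : ∃ k, i = k + 1 := ⟨i - 1, by omega⟩
      exact (hangles k (by omega) (by omega)).generates hU.1 h
  have hleft : ∀ i, 1 ≤ i → i < m → GeneratesEndpoint U (x (i + 1)) (x i) (xt (i + 1)) := by
    intro i hi him
    obtain ⟨h1, h⟩ | h := hgen (i + 1) (by omega) him
    · exact (hangles i hi (by omega)).symm.generates hU.1 h
    · exact h.2
  have hsupp : ∀ i, 1 ≤ i → i ≤ m → hbSupport (xt i) = x i := by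
    intro i hi him
    obtain h | h := hgen i hi him
    · exact h.2.support
    · exact h.2.support
  have hsees : ∀ i, 1 ≤ i → i < m → Sees (xt i) (xt (i + 1)) := fun i hi him =>
    Sees.of_generates (hseg i hi him).1 (hseg i hi him).2 (hright i hi him) (hleft i hi him)
  have hba : ∀ i, 1 ≤ i → i + 2 ≤ m → BA (xt i) (xt (i + 1)) (xt (i + 2)) := fun i hi him =>
    (hangles i hi (by omega)).ba (hsupp i hi (by omega)) (hsupp (i + 1) (by omega) (by omega))
      (hsupp (i + 2) (by omega) him) (hsees i hi (by omega)).symm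
      (hsees (i + 1) (by omega) (by omega))
  have hdist : ∀ i j, 1 ≤ i → i ≤ m → 1 ≤ j → j ≤ m →
      ‖rel (I (xt i)) (I (xt j))‖ = ‖rel (xt i) (xt j)‖ →
      dist (hbSupport (f (xt i))) (hbSupport (f (xt j))) = dist (x i) (x j) := by
    intro i j hi him hj hjm h
    rwa [norm_rel, norm_rel, hI, hI, hsupp i hi him, hsupp j hj hjm] at h
  have key := dist_eq_of_consecutive (m := m) (x := x) (x' := fun i => hbSupport (f (xt i)))
    (fun i hi him => hdist i (i + 1) hi (by omega) (by omega) him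
      ((hsees i hi him).norm_rel_map I))
    (fun i hi him => hdist i (i + 2) hi (by omega) (by omega) him
      ((norm_rel_eq_iff_inner ((hba i hi him).left.norm_rel_map I)
        ((hba i hi him).right.norm_rel_map I)).2 ((hba i hi him).inner_map I)))
    (fun i hi him => hdist i (i + 3) hi (by omega) (by omega) him
      (BA.norm_rel_map_of_chain I (hba i hi (by omega)) (hba (i + 1) (by omega) (by omega))))
    (fun i hi him => (hangles i hi (by omega)).cross_ne_zero)
  intro i hi him j hj hjm
  obtain h | h := le_total i j
  · exact key j hjm i hi h
  · rw [dist_comm, dist_comm (x i)]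
    exact key i him j hj h
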